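/- arXiv:1702.03524 — 3 statements merged into one kernel-verified Lean document; each statement's English description precedes it below -/
import Mathlib

section
/- If G is a connected graph with minimum degree at least 2 and maximum degree Δ, then the distinguishing index satisfies D'(G) ≤ ⌈√Δ⌉ + 1. -/
open SimpleGraph

/-- The distinguishing index: least number of labels in an edge labeling
preserved only by the identity automorphism. -/
noncomputable def distinguishingIndex {V : Type*} (G : SimpleGraph V) : ℕ :=
  sInf {d : ℕ | ∃ f : Sym2 V → Fin d,
    ∀ φ : G ≃g G, (∀ e ∈ G.edgeSet, f (Sym2.map ⇑φ e) = f e) → ∀ v, φ v = v}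

/-- The distinguishing number: least number of labels in a vertex labeling
preserved only by the identity automorphism. -/
noncomputable def distinguishingNumber {V : Type*} (G : SimpleGraph V) : ℕ :=
  sInf {d : ℕ | ∃ f : V → Fin d,
    ∀ φ : G ≃g G, (∀ v, f (φ v) = f v) → ∀ v, φ v = v}

/-- The dutch windmill graph `D_n^k`: `n` copies of the cycle `C_k`
sharing one common central vertex (`none`). -/
def windmill (n k : ℕ) : SimpleGraph (Option (Fin n × Fin (k - 1))) :=
  SimpleGraph.fromRel (fun a b =>
    match a, b with
    | none, some (_, j) => j.val = 0 ∨ j.val = k - 2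
    | some (i, j), some (i', j') => i = i' ∧ j'.val = j.val + 1
    | _, _ => False)



/-- Numerical value of a label; the extra label `none` counts as `0`. -/
def oval {m : ℕ} (o : Option (ZMod m)) : ZMod m := o.getD 0

theorem exists_inj_maps {α β : Type*} [DecidableEq α] [Nonempty β] (s : Finset α) (t : Finset β)
    (h : s.card ≤ t.card) :
    ∃ f : α → β, (∀ x ∈ s, f x ∈ t) ∧ ∀ x ∈ s, ∀ y ∈ s, f x = f y → x = y := by
  obtain ⟨e⟩ : Nonempty (s ↪ t) := Function.Embedding.nonempty_of_card_le (by simpa using h)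
  refine ⟨fun x => if hx : x ∈ s then (e ⟨x, hx⟩ : β) else Classical.arbitrary β, ?_, ?_⟩
  · intro x hx; simp [hx]
  · intro x hx y hy hxy
    simp only [hx, hy, dite_true] at hxy
    have := e.injective (Subtype.ext hxy)
    simpa using this

/-- Base assignments can be shifted to obtain any sum. -/
theorem shift_sum {V : Type*} {m : ℕ} (C : Finset V) (a : V → Option (ZMod m)) (c : ZMod m) :
    ∑ x ∈ C, oval ((a x).map (· + c)) =
      ∑ x ∈ C, oval (a x) + ((C.filter (fun x => a x ≠ none)).card : ZMod m) * c := by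
  classical
  rw [Finset.card_filter]
  push_cast
  rw [Finset.sum_mul, ← Finset.sum_add_distrib]
  refine Finset.sum_congr rfl fun x _ => ?_
  cases h : a x <;> simp [oval]

/-- The conclusion wanted from a base assignment. -/
theorem base_exists {V : Type*} [DecidableEq V] {m : ℕ} (hm : 2 ≤ m) (C S : Finset V)
    (hS : S ⊆ C) (j : ℕ) (hj : j + 2 ≤ m)
    (h : (j ≤ (C \ S).card ∧ (S.Nonempty → (C \ S).card - j ≤ m * (m - 1)) ∧
            (C \ S).card - j ≤ m * m) ∨
         ((C \ S).card ≤ m ∧ j ≤ S.card)) :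
    ∃ (a : V → Option (ZMod m)) (b : V → ZMod m),
      (∀ x ∈ C \ S, ∀ y ∈ C \ S, a x = a y → b x = b y → x = y) ∧
      (∀ x ∈ S, ∀ y ∈ C \ S, a x ≠ a y) ∧ (C.filter (fun x => a x = none)).card = j := by
  have : NeZero m := ⟨by omega⟩
  have : Fact (1 < m) := ⟨by omega⟩
  have hcu : (Finset.univ : Finset (ZMod m)).card = m := by simp [ZMod.card]
  rcases h with ⟨h1, h2, h3⟩ | ⟨h1, h2⟩
  · obtain ⟨D1, hD1, hD1c⟩ := Finset.exists_subset_card_eq h1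
    obtain ⟨f, -, hf⟩ := exists_inj_maps D1 (Finset.univ : Finset (ZMod m)) (by rw [hcu]; omega)
    let Q : Finset (ZMod m) := if S.Nonempty then Finset.univ.erase 0 else Finset.univ
    have hQ : ((C \ S) \ D1).card ≤ (Q ×ˢ (Finset.univ : Finset (ZMod m))).card := by
      rw [Finset.card_sdiff_of_subset hD1, Finset.card_product, hcu, hD1c]
      by_cases hSn : S.Nonempty
      · have : Q.card = m - 1 := by
          simp only [Q, hSn, if_true]
          rw [Finset.card_erase_of_mem (Finset.mem_univ _), hcu]
        rw [this, mul_comm]; exact h2 hSn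
      · have : Q.card = m := by simp only [Q, hSn, if_false, hcu]
        rw [this]; exact h3
    obtain ⟨g, hg1, hg2⟩ := exists_inj_maps _ _ hQ
    refine ⟨fun x => if x ∈ S then some 0 else if x ∈ D1 then none else some (g x).1,
      fun x => if x ∈ D1 then f x else (g x).2, ?_, ?_, ?_⟩
    · intro x hx y hy hab hb
      have hx' := (Finset.mem_sdiff.1 hx).2
      have hy' := (Finset.mem_sdiff.1 hy).2
      simp only [hx', hy', if_false] at hab
      by_cases hx1 : x ∈ D1 <;> by_cases hy1 : y ∈ D1 <;> simp only [hx1, hy1, if_true, if_false] at hab hb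
      · exact hf x hx1 y hy1 hb
      · simp at hab
      · simp at hab
      · exact hg2 x (Finset.mem_sdiff.2 ⟨hx, hx1⟩) y (Finset.mem_sdiff.2 ⟨hy, hy1⟩)
          (Prod.ext (Option.some.inj hab) hb)
    · intro x hx y hy
      have hy' := (Finset.mem_sdiff.1 hy).2
      simp only [hx, hy', if_true, if_false]
      by_cases hy1 : y ∈ D1
      · simp [hy1]
      · simp only [hy1, if_false]
        intro h
        have h0 := Option.some.inj h
        have := hg1 y (Finset.mem_sdiff.2 ⟨hy, hy1⟩)
        have hSn : S.Nonempty := ⟨x, hx⟩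
        simp only [Q, hSn, if_true, Finset.mem_product, Finset.mem_erase] at this
        exact this.1.1 h0.symm
    · rw [← hD1c]; congr 1
      ext x
      simp only [Finset.mem_filter]
      constructor
      · rintro ⟨_, h⟩
        by_contra hx; by_cases hxS : x ∈ S <;> simp [hx, hxS] at h
      · intro hx
        have := Finset.mem_sdiff.1 (hD1 hx)
        simp [hx, this.1, this.2]
  · obtain ⟨S1, hS1, hS1c⟩ := Finset.exists_subset_card_eq h2
    obtain ⟨f, -, hf⟩ := exists_inj_maps (C \ S) (Finset.univ : Finset (ZMod m)) (by rw [hcu]; omega)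
    refine ⟨fun x => if x ∈ S1 then none else if x ∈ S then some 0 else some 1, f, ?_, ?_, ?_⟩
    · intro x hx y hy _ hb
      exact hf x hx y hy hb
    · intro x hx y hy
      have hy' := (Finset.mem_sdiff.1 hy).2
      have hy1 : y ∉ S1 := fun h => hy' (hS1 h)
      by_cases hx1 : x ∈ S1 <;> simp [hx, hy', hy1, hx1]
    · rw [← hS1c]; congr 1
      ext x
      simp only [Finset.mem_filter]
      constructor
      · rintro ⟨_, h⟩
        by_contra hx; by_cases hxS : x ∈ S <;> simp [hx, hxS] at h
      · intro hx
        simp [hx, hS (hS1 hx)]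

/-- Assignment at a nonroot vertex. -/
theorem assign_exists {V : Type*} [DecidableEq V] {m : ℕ} (hm : 2 ≤ m) (C S : Finset V)
    (hS : S ⊆ C) (hC : C.Nonempty) (hcard : C.card + 1 ≤ m * m) :
    ∃ b : V → ZMod m, ∀ T : ZMod m, ∃ a : V → Option (ZMod m),
      ∑ x ∈ C, oval (a x) = T ∧
      (∀ x ∈ C \ S, ∀ y ∈ C \ S, a x = a y → b x = b y → x = y) ∧
      (∀ x ∈ S, ∀ y ∈ C \ S, a x ≠ a y) ∧
      ((C.filter (fun x => a x = none)).card + 2 ≤ m ∨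
        (m = 2 ∧ T = 0 ∧ ∃ s z, C = {s, z} ∧ s ∈ S ∧ z ∉ S ∧ a s = none ∧ a z = some 0)) := by
  have : NeZero m := ⟨by omega⟩
  have : Fact (1 < m) := ⟨by omega⟩
  have hcu : (Finset.univ : Finset (ZMod m)).card = m := by simp [ZMod.card]
  have hsum : (C \ S).card + S.card = C.card := Finset.card_sdiff_add_card_eq_card hS
  have hCpos := hC.card_pos
  -- the shifting argument
  have key : ∀ j : ℕ, j + 2 ≤ m → j ≤ C.card →
      (IsUnit ((C.card - j : ℕ) : ZMod m)) →
      ((j ≤ (C \ S).card ∧ (S.Nonempty → (C \ S).card - j ≤ m * (m - 1)) ∧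
            (C \ S).card - j ≤ m * m) ∨
         ((C \ S).card ≤ m ∧ j ≤ S.card)) → 
      ∃ b : V → ZMod m, ∀ T : ZMod m, ∃ a : V → Option (ZMod m),
      ∑ x ∈ C, oval (a x) = T ∧
      (∀ x ∈ C \ S, ∀ y ∈ C \ S, a x = a y → b x = b y → x = y) ∧
      (∀ x ∈ S, ∀ y ∈ C \ S, a x ≠ a y) ∧
      ((C.filter (fun x => a x = none)).card + 2 ≤ m ∨
        (m = 2 ∧ T = 0 ∧ ∃ s z, C = {s, z} ∧ s ∈ S ∧ z ∉ S ∧ a s = none ∧ a z = some 0)) := by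
    intro j hj hjC hu h
    obtain ⟨a, b, h1, h2, h3⟩ := base_exists hm C S hS j hj h
    refine ⟨b, fun T => ?_⟩
    have hcnt : (C.filter (fun x => a x ≠ none)).card = C.card - j := by
      have := Finset.card_filter_add_card_filter_not (s := C) (fun x => a x = none)
      simp only [ne_eq]
      omega
    obtain ⟨u, hu⟩ := hu
    have hinj : Function.Injective (Option.map (· + (↑u⁻¹ * (T - ∑ x ∈ C, oval (a x))))) :=
      Option.map_injective (add_left_injective _)
    refine ⟨fun x => (a x).map (· + (↑u⁻¹ * (T - ∑ x ∈ C, oval (a x)))), ?_, ?_, ?_, ?_⟩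
    · rw [shift_sum, hcnt, ← hu, Units.mul_inv_cancel_left]; ring
    · intro x hx y hy hab hb
      exact h1 x hx y hy (hinj hab) hb
    · intro x hx y hy hab
      exact h2 x hx y hy (hinj hab)
    · left
      simp only [Option.map_eq_none_iff, h3]
      exact hj
  -- direct argument
  have direct : S.card + 2 ≤ m → 1 ≤ (C \ S).card → (C \ S).card ≤ m → 
      ∃ b : V → ZMod m, ∀ T : ZMod m, ∃ a : V → Option (ZMod m),
      ∑ x ∈ C, oval (a x) = T ∧
      (∀ x ∈ C \ S, ∀ y ∈ C \ S, a x = a y → b x = b y → x = y) ∧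
      (∀ x ∈ S, ∀ y ∈ C \ S, a x ≠ a y) ∧
      ((C.filter (fun x => a x = none)).card + 2 ≤ m ∨
        (m = 2 ∧ T = 0 ∧ ∃ s z, C = {s, z} ∧ s ∈ S ∧ z ∉ S ∧ a s = none ∧ a z = some 0)) := by
    intro hs hn1 hn2
    obtain ⟨z, hz⟩ := Finset.card_pos.1 hn1
    obtain ⟨f, -, hf⟩ := exists_inj_maps (C \ S) (Finset.univ : Finset (ZMod m)) (by rw [hcu]; omega)
    have hz' := Finset.mem_sdiff.1 hz
    refine ⟨f, fun T => ⟨fun x => if x ∈ S then none else if x = z then some T else some 0,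
      ?_, ?_, ?_, Or.inl ?_⟩⟩
    · rw [Finset.sum_eq_single z]
      · simp [hz'.2, oval]
      · intro x _ hxz
        by_cases hxS : x ∈ S <;> simp [hxS, hxz, oval]
      · intro h; exact absurd hz'.1 h
    · intro x hx y hy _ hb
      exact hf x hx y hy hb
    · intro x hx y hy
      have hy' := (Finset.mem_sdiff.1 hy).2
      simp only [hx, hy', if_true, if_false]
      split_ifs <;> simp
    · refine le_trans (Nat.add_le_add_right (Finset.card_le_card ?_) 2) hs
      intro x hx
      by_contra hxS
      have := (Finset.mem_filter.1 hx).2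
      simp only [hxS, if_false] at this
      split_ifs at this
  by_cases hdvd : m ∣ C.card
  · by_cases hm2 : m = 2
    · subst hm2
      have hc2 : C.card = 2 := by
        obtain ⟨k, hk⟩ := hdvd
        omega
      by_cases hs0 : S.card = 0
      · exact direct (by omega) (by omega) (by omega)
      by_cases hn0 : (C \ S).card = 0
      · have hn0' := Finset.card_eq_zero.1 hn0
        obtain ⟨z, hz⟩ := hC
        refine ⟨0, fun T => ⟨fun x => if x = z then some T else some 0, ?_, ?_, ?_, Or.inl ?_⟩⟩
        · rw [Finset.sum_eq_single z]
          · simp [oval]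
          · intro x _ hxz; simp [hxz, oval]
          · intro h; exact absurd hz h
        · simp [hn0']
        · simp [hn0']
        · have : (C.filter (fun x => (if x = z then some T else some (0 : ZMod 2)) = none)) = ∅ := by
            apply Finset.filter_eq_empty_iff.2
            intro x _; split_ifs <;> simp
          rw [this]; simp
      · obtain ⟨z, hz⟩ := Finset.card_eq_one.1 (show (C \ S).card = 1 by omega)
        obtain ⟨s, hs⟩ := Finset.card_eq_one.1 (show S.card = 1 by omega)
        have hzC : z ∈ C \ S := by rw [hz]; simp
        have hzS := (Finset.mem_sdiff.1 hzC).2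
        have hsz : s ≠ z := by rintro rfl; apply hzS; rw [hs]; simp
        have hCeq : C = {s, z} := by
          rw [← Finset.sdiff_union_of_subset hS, hz, hs]
          ext; simp [or_comm]
        refine ⟨0, fun T => ?_⟩
        by_cases hT : T = 0
        · refine ⟨fun x => if x = s then none else some 0, ?_, ?_, ?_, Or.inr ⟨rfl, hT, s, z, hCeq, ?_, hzS, ?_, ?_⟩⟩
          · rw [hCeq, Finset.sum_pair hsz]; simp [hsz.symm, oval, hT]
          · rw [hz]; simp
          · rw [hz, hs]; simp [hsz.symm]
          · rw [hs]; simp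
          · simp
          · simp [hsz.symm]
        · refine ⟨fun x => if x = s then some 0 else some T, ?_, ?_, ?_, Or.inl ?_⟩
          · rw [hCeq, Finset.sum_pair hsz]; simp [hsz.symm, oval]
          · rw [hz]; simp
          · rw [hz, hs]; simp [hsz.symm, Ne.symm hT]
          · have : (C.filter (fun x => (if x = s then some 0 else some T) = none)) = ∅ := by
              apply Finset.filter_eq_empty_iff.2
              intro x _; split_ifs <;> simp
            rw [this]; simp
    · -- j = 1
      have hmC : m ≤ C.card := Nat.le_of_dvd hCpos hdvd
      have hub : C.card ≤ m * (m - 1) := by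
        obtain ⟨k, hk⟩ := hdvd
        rw [hk]
        apply Nat.mul_le_mul_left
        by_contra hcon
        have : m ≤ k := by omega
        have := Nat.mul_le_mul_left m this
        omega
      refine key 1 (by omega) (by omega) ?_ ?_
      · have h0 : ((C.card : ℕ) : ZMod m) = 0 := (ZMod.natCast_eq_zero_iff _ _).2 hdvd
        rw [Nat.cast_sub (by omega), h0]; simp
      · have hmm : m * (m - 1) ≤ m * m := Nat.mul_le_mul_left _ (by omega)
        by_cases h1 : 1 ≤ (C \ S).card
        · left; exact ⟨h1, fun _ => by omega, by omega⟩
        · right; omega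
  · set j := (C.card - 1) % m with hjdef
    have hjlt : j < m := Nat.mod_lt _ (by omega)
    have hdm : m * ((C.card - 1) / m) + j = C.card - 1 := Nat.div_add_mod _ _
    have hj2 : j + 2 ≤ m := by
      by_contra hcon
      apply hdvd
      refine ⟨(C.card - 1) / m + 1, ?_⟩
      rw [mul_add]; omega
    have hunit : IsUnit ((C.card - j : ℕ) : ZMod m) := by
      have : C.card - j = m * ((C.card - 1) / m) + 1 := by omega
      rw [this]; simp
    by_cases hn : j ≤ (C \ S).card
    · refine key j hj2 (by omega) hunit (Or.inl ⟨hn, ?_, by omega⟩)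
      intro hSn
      have hs1 := hSn.card_pos
      have hk : (C.card - 1) / m ≤ m - 1 := by
        have : (C.card - 1) / m < m := Nat.div_lt_of_lt_mul (by omega)
        omega
      have := Nat.mul_le_mul_left m hk
      omega
    · by_cases hs : j ≤ S.card
      · exact key j hj2 (by omega) hunit (Or.inr ⟨by omega, hs⟩)
      · have hjle : j ≤ C.card - 1 := Nat.mod_le _ _
        exact direct (by omega) (by omega) (by omega)


/-- Assignment at the root. -/
theorem root_assign {V : Type*} [DecidableEq V] {m : ℕ} (hm : 2 ≤ m) (C S X : Finset V)
    (hcard : C.card ≤ m * m) (hn : m ≤ (C \ S).card) (hS : S ⊆ C) :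
    ∃ (a : V → Option (ZMod m)) (b : V → ZMod m),
      (∀ x ∈ C \ S, ∀ y ∈ C \ S, a x = a y → b x = b y → x = y) ∧
      (∀ x ∈ S, ∀ y ∈ C \ S, a x ≠ a y) ∧
      m ≤ (C.filter (fun x => a x = none)).card ∧
      (∀ v ∈ X, v ∈ C \ S → a v = none → (∀ x ∈ C, a x ≠ some 0) ∨
        ((∀ x ∈ C \ S, a x ≠ none → x ∈ X) ∧ (∃ x ∈ C \ S, a x ≠ none) ∧ S.Nonempty ∧
          ∀ x ∈ S, a x = some 0)) := by
  have : NeZero m := ⟨by omega⟩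
  have : Fact (1 < m) := ⟨by omega⟩
  have hcu : (Finset.univ : Finset (ZMod m)).card = m := by simp [ZMod.card]
  have hsum : (C \ S).card + S.card = C.card := Finset.card_sdiff_add_card_eq_card hS
  obtain ⟨D1, hD1, hD1c, hD1X⟩ : ∃ D1 ⊆ C \ S, D1.card = m ∧
      ((∀ x ∈ D1, x ∉ X) ∨ (∀ x ∈ C \ S, x ∉ D1 → x ∈ X)) := by
    by_cases h : m ≤ ((C \ S) \ X).card
    · obtain ⟨D1, h1, h2⟩ := Finset.exists_subset_card_eq h
      exact ⟨D1, h1.trans Finset.sdiff_subset, h2, Or.inl fun x hx => (Finset.mem_sdiff.1 (h1 hx)).2⟩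
    · obtain ⟨D1, h1, h2, h3⟩ := Finset.exists_subsuperset_card_eq
        (Finset.sdiff_subset (s := C \ S) (t := X)) (le_of_not_ge h) hn
      refine ⟨D1, h2, h3, Or.inr fun x hx hx1 => ?_⟩
      by_contra hxX
      exact hx1 (h1 (Finset.mem_sdiff.2 ⟨hx, hxX⟩))
  obtain ⟨f, -, hf⟩ := exists_inj_maps D1 (Finset.univ : Finset (ZMod m)) (by rw [hcu]; omega)
  have hQ : ((C \ S) \ D1).card ≤
      ((Finset.univ.erase (0 : ZMod m)) ×ˢ (Finset.univ : Finset (ZMod m))).card := by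
    rw [Finset.card_sdiff_of_subset hD1, Finset.card_product, hcu, hD1c,
      Finset.card_erase_of_mem (Finset.mem_univ _), hcu, Nat.sub_mul, one_mul]
    omega
  obtain ⟨g, hg1, hg2⟩ := exists_inj_maps _ _ hQ
  have hg0 : ∀ y ∈ C \ S, y ∉ D1 → (g y).1 ≠ 0 := by
    intro y hy hy1
    have := hg1 y (Finset.mem_sdiff.2 ⟨hy, hy1⟩)
    simp only [Finset.mem_product, Finset.mem_erase] at this
    exact this.1.1
  refine ⟨fun x => if x ∈ S then (if (C \ S) ⊆ D1 then some 1 else some 0) else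
      if x ∈ D1 then none else some (g x).1,
      fun x => if x ∈ D1 then f x else (g x).2, ?_, ?_, ?_, ?_⟩
  · intro x hx y hy hab hb
    have hx' := (Finset.mem_sdiff.1 hx).2
    have hy' := (Finset.mem_sdiff.1 hy).2
    simp only [hx', hy', if_false] at hab
    by_cases hx1 : x ∈ D1 <;> by_cases hy1 : y ∈ D1 <;>
      simp only [hx1, hy1, if_true, if_false] at hab hb
    · exact hf x hx1 y hy1 hb
    · simp at hab
    · simp at hab
    · exact hg2 x (Finset.mem_sdiff.2 ⟨hx, hx1⟩) y (Finset.mem_sdiff.2 ⟨hy, hy1⟩)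
        (Prod.ext (Option.some.inj hab) hb)
  · intro x hx y hy
    have hy' := (Finset.mem_sdiff.1 hy).2
    simp only [hx, hy', if_true, if_false]
    by_cases hy1 : y ∈ D1
    · simp only [hy1, if_true]; split_ifs <;> simp
    · have hns : ¬ (C \ S) ⊆ D1 := fun h => hy1 (h hy)
      simp only [hy1, if_false, hns]
      intro h
      exact hg0 y hy hy1 (Option.some.inj h).symm
  · refine hD1c.ge.trans ?_
    apply Finset.card_le_card
    intro x hx
    have := Finset.mem_sdiff.1 (hD1 hx)
    simp [hx, this.1, this.2]
  · intro v hvX hvD hv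
    have hvS := (Finset.mem_sdiff.1 hvD).2
    have hv1 : v ∈ D1 := by
      by_contra h; simp [hvS, h] at hv
    have hX2 : ∀ x ∈ C \ S, x ∉ D1 → x ∈ X := by
      rcases hD1X with h | h
      · exact absurd hvX (h v hv1)
      · exact h
    by_cases hsub : (C \ S) ⊆ D1
    · left
      intro x hxC
      by_cases hxS : x ∈ S
      · simp [hxS, hsub]
      · have := hsub (Finset.mem_sdiff.2 ⟨hxC, hxS⟩)
        simp [hxS, this]
    · by_cases hSn : S.Nonempty
      · right
        refine ⟨?_, ?_, hSn, ?_⟩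
        · intro x hx hxa
          apply hX2 x hx
          intro h
          simp [(Finset.mem_sdiff.1 hx).2, h] at hxa
        · obtain ⟨x, hx, hx1⟩ := Finset.not_subset.1 hsub
          exact ⟨x, hx, by simp [(Finset.mem_sdiff.1 hx).2, hx1]⟩
        · intro x hx; simp [hx, hsub]
      · left
        intro x hxC
        have hxS : x ∉ S := fun h => hSn ⟨x, h⟩
        by_cases h1 : x ∈ D1
        · simp [hxS, h1]
        · have := hg0 x (Finset.mem_sdiff.2 ⟨hxC, hxS⟩) h1
          simp [hxS, h1, this]

/-- Solving for prescribed sums along an acyclic pointer structure. -/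
theorem solve_sums {V A : Type*} [DecidableEq V] [AddCommGroup A] (M : Finset V) (p : V → V)
    (ρ : V → ℕ) (N : V → Finset V) (B : V → A) (c₀ : Sym2 V → A)
    (h1 : ∀ x ∈ M, p x ∈ N x) (h2 : ∀ x ∈ M, p x ∈ M → ρ (p x) < ρ x) :
    ∃ c : Sym2 V → A, (∀ x ∈ M, ∑ u ∈ N x, c s(x, u) = B x) ∧
      ∀ e, (∀ x ∈ M, e ≠ s(x, p x)) → c e = c₀ e := by
  induction M using Finset.strongInduction with
  | H M ih =>
    rcases M.eq_empty_or_nonempty with rfl | hM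
    · exact ⟨c₀, by simp, by simp⟩
    · obtain ⟨x, hx, hmin⟩ := Finset.exists_min_image M ρ hM
      obtain ⟨c, hc1, hc2⟩ := ih (M.erase x) (Finset.erase_ssubset hx)
        (fun y hy => h1 y (Finset.mem_of_mem_erase hy))
        (fun y hy hy' => h2 y (Finset.mem_of_mem_erase hy) (Finset.mem_of_mem_erase hy'))
      have hpx : p x ∉ M := fun h => absurd (h2 x hx h) (not_lt.2 (hmin _ h))
      refine ⟨Function.update c s(x, p x) (c s(x, p x) + (B x - ∑ u ∈ N x, c s(x, u))), ?_, ?_⟩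
      · intro y hy
        by_cases hyx : y = x
        · subst hyx
          rw [← Finset.add_sum_erase _ _ (h1 y hy)]
          have : ∑ u ∈ (N y).erase (p y), Function.update c s(y, p y)
              (c s(y, p y) + (B y - ∑ u ∈ N y, c s(y, u))) s(y, u) =
              ∑ u ∈ (N y).erase (p y), c s(y, u) := by
            refine Finset.sum_congr rfl fun u hu => ?_
            rw [Function.update_of_ne]
            intro h
            exact (Finset.ne_of_mem_erase hu) (Sym2.congr_right.1 h)
          rw [this, Function.update_self, ← Finset.add_sum_erase _ _ (h1 y hy)]
          abel
        · rw [← hc1 y (Finset.mem_erase.2 ⟨hyx, hy⟩)]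
          refine Finset.sum_congr rfl fun u _ => ?_
          rw [Function.update_of_ne]
          intro h
          rcases Sym2.eq_iff.1 h with ⟨h, -⟩ | ⟨h, -⟩
          · exact hyx h
          · exact hpx (h ▸ hy)
      · intro e he
        rw [Function.update_of_ne (he x hx)]
        exact hc2 e fun y hy => he y (Finset.mem_of_mem_erase hy)

open Classical in
/-- Override a function on edges along the pointers `x ↦ s(x, f x)`. -/
noncomputable def extEdge {V A : Type*} (P : V → Prop) (f : V → V) (val : V → A) (c₀ : Sym2 V → A)
    (e : Sym2 V) : A :=
  if h : ∃ x, P x ∧ e = s(x, f x) then val h.choose else c₀ e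

theorem extEdge_apply {V A : Type*} {P : V → Prop} {f : V → V} {val : V → A} {c₀ : Sym2 V → A}
    (μ : V → ℕ) (hμ : ∀ x, P x → μ (f x) < μ x) {x : V} (hx : P x) :
    extEdge P f val c₀ s(x, f x) = val x := by
  have h : ∃ y, P y ∧ s(x, f x) = s(y, f y) := ⟨x, hx, rfl⟩
  rw [extEdge, dif_pos h]
  obtain ⟨h1, h2⟩ := h.choose_spec
  rcases Sym2.eq_iff.1 h2 with ⟨h3, -⟩ | ⟨h3, h4⟩
  · rw [← h3]
  · have a1 := hμ _ h1
    have a2 := hμ _ hx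
    rw [← h3] at a1
    rw [h4] at a2
    omega

theorem extEdge_of_not {V A : Type*} {P : V → Prop} {f : V → V} {val : V → A} {c₀ : Sym2 V → A}
    {e : Sym2 V} (h : ∀ x, P x → e ≠ s(x, f x)) : extEdge P f val c₀ e = c₀ e := by
  rw [extEdge, dif_neg]
  rintro ⟨x, hx, he⟩
  exact h x hx he

/-- Pointer structure inside a set `I` of vertices. -/
theorem internal_structure {V : Type*} (G : SimpleGraph V) (par : V → V) (I : Set V)
    (hI : ∀ x ∈ I, ∀ u ∈ I, G.Adj x u → u ≠ par x) :
    ∃ (R : Set V) (p : V → V) (ρ : V → ℕ), R ⊆ I ∧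
      (∀ x ∈ I, x ∉ R → G.Adj x (p x) ∧ p x ≠ par x ∧ (p x ∈ I → ρ (p x) < ρ x)) ∧
      (∀ z ∈ R, ∀ u, G.Adj z u → u ≠ par z → u ∈ I ∧ u ∉ R ∧
        (∀ z' ∈ R, G.Adj u z' → z' = z) ∧ (∀ u', G.Adj u u' → u' ≠ par u → u' ∈ I)) := by
  classical
  let H : SimpleGraph V :=
    { Adj := fun x u => G.Adj x u ∧ x ∈ I ∧ u ∈ I
      symm := ⟨fun x u h => ⟨h.1.symm, h.2.2, h.2.1⟩⟩
      loopless := ⟨fun x h => G.loopless.irrefl x h.1⟩ }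
  let Exit : V → Prop := fun x => ∃ u, G.Adj x u ∧ u ≠ par x ∧ u ∉ I
  have hrep : ∀ c : H.ConnectedComponent, ∃ x, H.connectedComponentMk x = c ∧
      ((∃ y, H.connectedComponentMk y = c ∧ Exit y) → Exit x) := by
    intro c
    by_cases h : ∃ y, H.connectedComponentMk y = c ∧ Exit y
    · obtain ⟨y, hy, hy'⟩ := h
      exact ⟨y, hy, fun _ => hy'⟩
    · obtain ⟨x, hx⟩ := c.exists_rep
      exact ⟨x, hx, fun h' => absurd h' h⟩
  choose rep hrep1 hrep2 using hrep
  let e : V → V := fun x => rep (H.connectedComponentMk x)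
  have he : ∀ x, H.Reachable x (e x) := fun x =>
    ConnectedComponent.exact (hrep1 (H.connectedComponentMk x)).symm
  have hadj : ∀ x u, H.Adj x u → e x = e u := by
    intro x u h
    simp only [e]
    rw [ConnectedComponent.sound h.reachable]
  have haux : ∀ x y, x ≠ y → H.Reachable x y → ∃ u, H.Adj x u ∧ H.dist u y < H.dist x y := by
    intro x y hx hr
    obtain ⟨w, hw⟩ := hr.exists_walk_length_eq_dist
    cases w with
    | nil => exact absurd rfl hx
    | cons h q =>
      rename_i u
      refine ⟨u, h, ?_⟩
      have := dist_le q
      rw [Walk.length_cons] at hw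
      omega
  have hstep : ∀ x, x ≠ e x → ∃ u, H.Adj x u ∧ H.dist u (e x) < H.dist x (e x) :=
    fun x hx => haux x (e x) hx (he x)
  let p : V → V := fun x => if h : x = e x then (if h' : Exit x then h'.choose else x)
    else (hstep x h).choose
  refine ⟨{x | x ∈ I ∧ x = e x ∧ ¬ Exit x}, p, fun x => H.dist x (e x), fun x hx => hx.1, ?_, ?_⟩
  · intro x hx hxR
    by_cases h : x = e x
    · have h' : Exit x := by
        by_contra h'; exact hxR ⟨hx, h, h'⟩
      have hp : p x = h'.choose := by
        simp only [p]; rw [dif_pos h, dif_pos h']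
      obtain ⟨h1, h2, h3⟩ := h'.choose_spec
      rw [hp]
      exact ⟨h1, h2, fun h => absurd h h3⟩
    · have hp : p x = (hstep x h).choose := by
        simp only [p]; rw [dif_neg h]
      obtain ⟨h1, h2⟩ := (hstep x h).choose_spec
      rw [hp]
      refine ⟨h1.1, hI x hx _ h1.2.2 h1.1, fun _ => ?_⟩
      show H.dist _ (e _) < H.dist x (e x)
      rw [← hadj _ _ h1]
      exact h2
  · rintro z ⟨hzI, hze, hzE⟩ u hzu huz
    have hnoexit : ∀ y, H.connectedComponentMk y = H.connectedComponentMk z → ¬ Exit y := by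
      intro y hy hyE
      apply hzE
      have := hrep2 (H.connectedComponentMk z) ⟨y, hy, hyE⟩
      rw [hze]; exact this
    have huI : u ∈ I := by
      by_contra h; exact hzE ⟨u, hzu, huz, h⟩
    have hH : H.Adj z u := ⟨hzu, hzI, huI⟩
    refine ⟨huI, ?_, ?_, ?_⟩
    · rintro ⟨-, h, -⟩
      have := hadj _ _ hH
      rw [← hze, ← h] at this
      exact hzu.ne this
    · rintro z' ⟨hz'I, hz'e, -⟩ huz'
      rw [hz'e, hze, hadj _ _ hH]
      exact (hadj _ _ (show H.Adj u z' from ⟨huz', huI, hz'I⟩)).symm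
    · intro u' h1 h2
      by_contra h3
      exact hnoexit u (ConnectedComponent.sound hH.symm.reachable) ⟨u', h1, h2, h3⟩

/-- A search order on a graph. -/
structure SearchOrder {V : Type*} (G : SimpleGraph V) where
  r : V
  ord : V → ℕ
  par : V → V
  inj : Function.Injective ord
  root_le : ∀ v, ord r ≤ ord v
  adj : ∀ x, x ≠ r → G.Adj x (par x)
  le : ∀ x, x ≠ r → ∀ u, G.Adj x u → ord (par x) ≤ ord u
  lt : ∀ x, x ≠ r → ord (par x) < ord x

theorem exists_searchOrder {V : Type*} [Fintype V] (G : SimpleGraph V) (hconn : G.Connected)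
    (r : V) : ∃ Q : SearchOrder G, Q.r = r := by
  classical
  let idx := Fintype.equivFin V
  let N := Fintype.card V
  let ord : V → ℕ := fun v => G.dist r v * N + (idx v : ℕ)
  have hlt : ∀ u v, G.dist r u < G.dist r v → ord u < ord v := by
    intro u v h
    have h1 : (G.dist r u + 1) * N ≤ G.dist r v * N := Nat.mul_le_mul_right _ h
    have h2 := (idx u).isLt
    simp only [ord]
    rw [add_mul] at h1
    simp only [N] at *
    omega
  have hstep : ∀ x, x ≠ r → ∃ u, G.Adj x u ∧ ord u < ord x := by
    intro x hx
    obtain ⟨w, hw⟩ := hconn.exists_walk_length_eq_dist x r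
    cases w with
    | nil => exact absurd rfl hx
    | cons h q =>
      rename_i u
      refine ⟨u, h, hlt _ _ ?_⟩
      have := dist_le q
      rw [Walk.length_cons] at hw
      rw [G.dist_comm (u := r), G.dist_comm (u := r)]
      omega
  have hpar : ∀ x, ∃ y, x ≠ r → G.Adj x y ∧ ∀ u, G.Adj x u → ord y ≤ ord u := by
    intro x
    by_cases hx : x = r
    · exact ⟨x, fun h => absurd hx h⟩
    · obtain ⟨u, hu, -⟩ := hstep x hx
      obtain ⟨y, hy, hmin⟩ := Finset.exists_min_image (Finset.univ.filter (G.Adj x)) ord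
        ⟨u, by simpa using hu⟩
      exact ⟨y, fun _ => ⟨by simpa using hy, fun u hu => hmin u (by simpa using hu)⟩⟩
  choose par hp using hpar
  refine ⟨⟨r, ord, par, ?_, ?_, fun x hx => (hp x hx).1, fun x hx => (hp x hx).2, ?_⟩, rfl⟩
  · intro u v h
    rcases lt_trichotomy (G.dist r u) (G.dist r v) with h1 | h1 | h1
    · exact absurd h (hlt _ _ h1).ne
    · simp only [ord, h1] at h
      exact idx.injective (Fin.ext (by omega))
    · exact absurd h (hlt _ _ h1).ne'
  · intro v
    by_cases hv : v = r
    · rw [hv]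
    · apply (hlt _ _ _).le
      rw [G.dist_self]
      exact hconn.pos_dist_of_ne (Ne.symm hv)
  · intro x hx
    obtain ⟨u, hu, hu'⟩ := hstep x hx
    exact ((hp x hx).2 u hu).trans_lt hu'


namespace SearchOrder
variable {V : Type*} {G : SimpleGraph V} (Q : SearchOrder G)

open Classical in
/-- Time at which a vertex is discovered. -/
noncomputable def tau (x : V) : ℕ := if x = Q.r then 0 else Q.ord (Q.par x) + 1

theorem tau_root : Q.tau Q.r = 0 := by simp [tau]

theorem tau_of_ne {x : V} (hx : x ≠ Q.r) : Q.tau x = Q.ord (Q.par x) + 1 := by simp [tau, hx]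

theorem ne_root_of_tau_pos {x : V} (hx : 0 < Q.tau x) : x ≠ Q.r := by
  rintro rfl; rw [Q.tau_root] at hx; omega

theorem tau_le_ord (x : V) : Q.tau x ≤ Q.ord x := by
  by_cases hx : x = Q.r
  · rw [hx, tau_root]; omega
  · rw [Q.tau_of_ne hx]; exact Q.lt x hx

theorem tau_par_lt {x : V} (hx : x ≠ Q.r) : Q.tau (Q.par x) < Q.tau x := by
  rw [Q.tau_of_ne hx]
  exact Nat.lt_succ_of_le (Q.tau_le_ord _)

theorem ne_root_of_adj {x u : V} (hx : x ≠ Q.r) (h : G.Adj x u) (hu : u ≠ Q.par x) :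
    u ≠ Q.r := by
  rintro rfl
  exact hu (Q.inj (le_antisymm (Q.root_le _) (Q.le x hx _ h)))

theorem par_eq_of_tau_eq {x y : V} (hx : x ≠ Q.r) (hy : y ≠ Q.r) (h : Q.tau x = Q.tau y) :
    Q.par x = Q.par y := by
  rw [Q.tau_of_ne hx, Q.tau_of_ne hy] at h
  exact Q.inj (by omega)

theorem tau_eq_of_par_eq {x y : V} (hx : x ≠ Q.r) (hy : y ≠ Q.r) (h : Q.par x = Q.par y) :
    Q.tau x = Q.tau y := by
  rw [Q.tau_of_ne hx, Q.tau_of_ne hy, h]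

theorem par_eq_of_lt {v x : V} (h : G.Adj v x) (hl : Q.ord v < Q.tau x) : Q.par x = v := by
  have hx : x ≠ Q.r := Q.ne_root_of_tau_pos (by omega)
  have h1 := Q.le x hx v h.symm
  rw [Q.tau_of_ne hx] at hl
  exact Q.inj (by omega)

/-- Earlier discovered neighbours. -/
def early (x : V) : Set V := {u | G.Adj x u ∧ u ≠ Q.par x ∧ Q.tau u < Q.tau x}

/-- No earlier neighbour other than the parent. -/
def Fresh (x : V) : Prop := x ≠ Q.r ∧ Q.early x = ∅

/-- All neighbours other than the parent are siblings. -/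
def Internal (x : V) : Prop :=
  x ≠ Q.r ∧ ∀ u, G.Adj x u → u ≠ Q.par x → Q.tau u = Q.tau x

/-- Has a later neighbour that is not a child. -/
def Opn (x : V) : Prop :=
  Q.Fresh x ∧ ∃ u, G.Adj x u ∧ Q.tau x < Q.tau u ∧ Q.par u ≠ x

/-- The remaining fresh vertices. -/
def Closd (x : V) : Prop := Q.Fresh x ∧ ¬ Q.Internal x ∧ ¬ Q.Opn x

theorem fresh_lt {x u : V} (hx : Q.Fresh x) (h : G.Adj x u) (hu : u ≠ Q.par x) :
    Q.tau x ≤ Q.tau u := by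
  by_contra hc
  have : u ∈ Q.early x := ⟨h, hu, by omega⟩
  rw [hx.2] at this
  exact this

theorem Internal.fresh {x : V} (h : Q.Internal x) : Q.Fresh x := by
  refine ⟨h.1, Set.eq_empty_of_forall_notMem ?_⟩
  rintro u ⟨h1, h2, h3⟩
  exact absurd (h.2 u h1 h2) h3.ne

theorem Internal.not_opn {x : V} (h : Q.Internal x) : ¬ Q.Opn x := by
  rintro ⟨h0, u, h1, h2, h3⟩
  have hu : u ≠ Q.par x := by
    rintro rfl
    have := Q.tau_par_lt h.1
    omega
  have := h.2 u h1 hu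
  omega

theorem par_ne_internal {x : V} (hx : x ≠ Q.r) : ¬ Q.Internal (Q.par x) := by
  intro h
  have h1 := Q.tau_par_lt hx
  have h2 : x ≠ Q.par (Q.par x) := by
    intro h2
    have := Q.tau_par_lt h.1
    rw [← h2] at this
    omega
  have := h.2 x (Q.adj x hx).symm h2
  omega

theorem Closd.cases {x u : V} (hx : Q.Closd x) (h : G.Adj x u) (hu : u ≠ Q.par x) :
    u ≠ Q.r ∧ ((Q.tau u = Q.tau x ∧ Q.par u = Q.par x) ∨ Q.par u = x) := by
  have hr := Q.ne_root_of_adj hx.1.1 h hu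
  refine ⟨hr, ?_⟩
  rcases (Q.fresh_lt hx.1 h hu).eq_or_lt with h1 | h1
  · exact Or.inl ⟨h1.symm, Q.par_eq_of_tau_eq hr hx.1.1 h1.symm⟩
  · right
    by_contra h2
    exact hx.2.2 ⟨hx.1, u, h, h1, h2⟩

theorem Closd.exists_child {x : V} (hx : Q.Closd x) : ∃ u, u ≠ Q.r ∧ Q.par u = x := by
  by_contra hc
  push Not at hc
  refine hx.2.1 ⟨hx.1.1, fun u h hu => ?_⟩
  obtain ⟨h1, h2 | h2⟩ := hx.cases Q h hu
  · exact h2.1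
  · exact absurd h2 (hc u h1)

/-- The target of an open vertex is not fresh. -/
theorem not_fresh_of_late {x u : V} (h : G.Adj x u) (h2 : Q.tau x < Q.tau u)
    (h3 : Q.par u ≠ x) : x ∈ Q.early u :=
  ⟨h.symm, Ne.symm h3, h2⟩

open Classical in
/-- Once the root is fixed, everything is fixed. -/
theorem fix_all [Fintype V] {m : ℕ} (c : Sym2 V → Option (ZMod m)) (a : V → Option (ZMod m))
    (b : V → ZMod m) (S : V → Prop) (w : V → V)
    (hca : ∀ x, x ≠ Q.r → c s(x, Q.par x) = a x)
    (hw : ∀ x y, Q.early x = Q.early y → w x = w y)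
    (hw2 : ∀ x, (Q.early x).Nonempty → w x ∈ Q.early x)
    (hnf : ∀ x, x ≠ Q.r → (Q.early x).Nonempty → ¬ S x → c s(x, w x) = some (b x))
    (hfresh : ∀ x, Q.Fresh x → ¬ S x →
      ∑ u ∈ Finset.univ.filter (fun u => G.Adj x u ∧ u ≠ Q.par x), oval (c s(x, u)) = b x)
    (hinj : ∀ x y, x ≠ Q.r → y ≠ Q.r → Q.par x = Q.par y → ¬ S x → ¬ S y → a x = a y →
      b x = b y → x = y)
    (hdis : ∀ x y, x ≠ Q.r → y ≠ Q.r → Q.par x = Q.par y → S x → ¬ S y → a x ≠ a y)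
    (hstar : ∀ x y, (Q.early x).Nonempty → (Q.early y).Nonempty → S x → S y → w x = w y → x = y)
    (hroot : ∀ x, Q.Fresh x → S x → ∃ u, G.Adj x u ∧ u ≠ Q.par x ∧ Q.tau u = Q.tau x ∧
      ¬ S u ∧ Q.Fresh u ∧ ∀ z, Q.Fresh z → S z → G.Adj u z → z = x)
    (φ : G ≃g G) (hφ : ∀ e ∈ G.edgeSet, c (Sym2.map φ e) = c e) (hr : φ Q.r = Q.r) :
    ∀ v, φ v = v := by
  have hφ' : ∀ x y, G.Adj x y → c s(φ x, φ y) = c s(x, y) := fun x y h => hφ s(x, y) h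
  suffices h : ∀ k, ∀ x, Q.tau x ≤ k → φ x = x from fun v => h _ v le_rfl
  intro k
  induction k with
  | zero =>
    intro x hx
    by_cases h : x = Q.r
    · rw [h, hr]
    · rw [Q.tau_of_ne h] at hx; omega
  | succ k ih =>
    -- general facts on vertices at level k+1
    have key : ∀ x, Q.tau x = k + 1 → Q.tau (φ x) = k + 1 ∧ φ x ≠ Q.r ∧ x ≠ Q.r ∧
        Q.par (φ x) = Q.par x ∧ φ (Q.par x) = Q.par x ∧ a (φ x) = a x ∧
        Q.early (φ x) = Q.early x := by
      intro x hx
      have hxr : x ≠ Q.r := Q.ne_root_of_tau_pos (by omega)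
      have hpx : φ (Q.par x) = Q.par x := ih _ (by have := Q.tau_par_lt hxr; omega)
      have hlow : ∀ u, Q.tau (φ u) ≤ k → φ u = u := fun u hu => φ.injective (ih _ hu)
      have hadj : G.Adj (Q.par x) (φ x) := by
        rw [← hpx]; exact φ.map_adj_iff.2 (Q.adj x hxr).symm
      have h1 : k + 1 ≤ Q.tau (φ x) := by
        by_contra h
        have := hlow x (by omega)
        rw [this] at h; omega
      have h2 : Q.par (φ x) = Q.par x := by
        apply Q.par_eq_of_lt hadj
        rw [Q.tau_of_ne hxr] at hx; omega
      have h3 : φ x ≠ Q.r := Q.ne_root_of_tau_pos (by omega)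
      have h4 : Q.tau (φ x) = k + 1 := by rw [← hx]; exact Q.tau_eq_of_par_eq h3 hxr h2
      refine ⟨h4, h3, hxr, h2, hpx, ?_, ?_⟩
      · rw [← hca _ h3, ← hca _ hxr, ← hφ' _ _ (Q.adj x hxr), h2, hpx]
      · ext u
        constructor
        · rintro ⟨e1, e2, e3⟩
          have := ih u (by omega)
          refine ⟨?_, h2 ▸ e2, by omega⟩
          rw [← this] at e1
          exact φ.map_adj_iff.1 e1
        · rintro ⟨e1, e2, e3⟩
          have := ih u (by omega)
          refine ⟨?_, h2 ▸ e2, by omega⟩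
          rw [← this]
          exact φ.map_adj_iff.2 e1
    have hSS : ∀ x, Q.tau x = k + 1 → (S (φ x) ↔ S x) := by
      intro x hx
      obtain ⟨h1, h2, h3, h4, h5, h6, h7⟩ := key x hx
      constructor
      · intro h; by_contra h'
        exact hdis _ _ h2 h3 h4 h h' h6
      · intro h; by_contra h'
        exact hdis _ _ h3 h2 h4.symm h h' h6.symm
    have hnS : ∀ x, Q.tau x = k + 1 → ¬ S x → φ x = x := by
      intro x hx hS
      obtain ⟨h1, h2, h3, h4, h5, h6, h7⟩ := key x hx
      have hS' : ¬ S (φ x) := fun h => hS ((hSS x hx).1 h)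
      apply hinj _ _ h2 h3 h4 hS' hS h6
      by_cases hE : (Q.early x).Nonempty
      · have hE' : (Q.early (φ x)).Nonempty := by rw [h7]; exact hE
        have e1 := hnf x h3 hE hS
        have e2 := hnf _ h2 hE' hS'
        obtain ⟨w1, w2, w3⟩ := hw2 x hE
        have hwf : φ (w x) = w x := ih _ (by omega)
        rw [hw _ _ h7, ← hwf, hφ' _ _ w1, e1] at e2
        exact (Option.some.inj e2).symm
      · have hE0 : Q.early x = ∅ := Set.not_nonempty_iff_eq_empty.1 hE
        rw [← hfresh x ⟨h3, hE0⟩ hS, ← hfresh _ ⟨h2, by rw [h7, hE0]⟩ hS']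
        symm
        refine Finset.sum_bij (fun u _ => φ u) ?_ ?_ ?_ ?_
        · intro u hu
          simp only [Finset.mem_filter, Finset.mem_univ, true_and] at hu ⊢
          refine ⟨φ.map_adj_iff.2 hu.1, ?_⟩
          rw [h4, ← h5]
          exact fun h => hu.2 (φ.injective h)
        · intro u _ v _ h; exact φ.injective h
        · intro u hu
          simp only [Finset.mem_filter, Finset.mem_univ, true_and] at hu
          refine ⟨φ.symm u, ?_, by simp⟩
          simp only [Finset.mem_filter, Finset.mem_univ, true_and]
          constructor
          · rw [← φ.map_adj_iff]; simpa using hu.1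
          · intro h
            apply hu.2
            rw [h4, ← h5, ← h]; simp
        · intro u hu
          simp only [Finset.mem_filter, Finset.mem_univ, true_and] at hu
          rw [hφ' _ _ hu.1]
    intro x hx
    rcases Nat.le_or_eq_of_le_succ hx with hx | hx
    · exact ih x hx
    · by_cases hS : S x
      · obtain ⟨h1, h2, h3, h4, h5, h6, h7⟩ := key x hx
        have hS' := (hSS x hx).2 hS
        by_cases hE : (Q.early x).Nonempty
        · exact hstar _ _ (by rw [h7]; exact hE) hE hS' hS (hw _ _ h7)
        · have hE0 : Q.early x = ∅ := Set.not_nonempty_iff_eq_empty.1 hE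
          obtain ⟨u, u1, u2, u3, u4, u5, u6⟩ := hroot x ⟨h3, hE0⟩ hS
          have hu : φ u = u := hnS u (by rw [u3]; exact hx) u4
          apply u6 _ ⟨h2, by rw [h7, hE0]⟩ hS'
          rw [← hu]
          exact φ.map_adj_iff.2 u1.symm
      · exact hnS x hx hS

end SearchOrder


namespace SearchOrder
variable {V : Type*} {G : SimpleGraph V} (Q : SearchOrder G)

/-- Auxiliary choices for a search order. -/
structure Skel where
  R : Set V
  p : V → V
  rho : V → ℕ
  pi : V → V
  w : V → V
  R_sub : ∀ x ∈ R, Q.Internal x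
  hp : ∀ x, Q.Internal x → x ∉ R → G.Adj x (p x) ∧ p x ≠ Q.par x ∧
    (Q.Internal (p x) → rho (p x) < rho x)
  hR : ∀ z ∈ R, ∀ u, G.Adj z u → u ≠ Q.par z → Q.Internal u ∧ u ∉ R ∧
    (∀ z' ∈ R, G.Adj u z' → z' = z) ∧ (∀ u', G.Adj u u' → u' ≠ Q.par u → Q.Internal u')
  hpi : ∀ x, Q.Opn x → G.Adj x (pi x) ∧ Q.tau x < Q.tau (pi x) ∧ Q.par (pi x) ≠ x
  hw : ∀ x y, Q.early x = Q.early y → w x = w y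
  hw2 : ∀ x, (Q.early x).Nonempty → w x ∈ Q.early x

/-- The special vertices. -/
def Skel.S {Q : SearchOrder G} (K : Q.Skel) (x : V) : Prop :=
  x ∈ K.R ∨ ((Q.early x).Nonempty ∧ Q.Opn (K.w x) ∧ K.pi (K.w x) = x)

theorem exists_skel : Nonempty Q.Skel := by
  classical
  obtain ⟨R, p, ρ, h1, h2, h3⟩ := internal_structure G Q.par {x | Q.Internal x} (by
    intro x hx u hu _ h
    exact Q.par_ne_internal hx.1 (h ▸ hu))
  have hpi : ∀ x, ∃ u, Q.Opn x → G.Adj x u ∧ Q.tau x < Q.tau u ∧ Q.par u ≠ x := by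
    intro x
    by_cases h : Q.Opn x
    · obtain ⟨u, hu⟩ := h.2
      exact ⟨u, fun _ => hu⟩
    · exact ⟨x, fun h' => absurd h' h⟩
  choose pi hpi using hpi
  let sel : Set V → V := fun s => if h : s.Nonempty then h.choose else Q.r
  have hsel : ∀ s : Set V, s.Nonempty → sel s ∈ s := by
    intro s h
    simp only [sel, dif_pos h]
    exact h.choose_spec
  exact ⟨⟨R, p, ρ, pi, fun x => sel (Q.early x), h1, h2, h3, hpi,
    fun x y h => by simp only [h], fun x h => hsel _ h⟩⟩

open Classical in
/-- The children of a vertex. -/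
noncomputable def ch [Fintype V] (v : V) : Finset V :=
  Finset.univ.filter (fun x => x ≠ Q.r ∧ Q.par x = v)

theorem mem_ch [Fintype V] {v x : V} : x ∈ Q.ch v ↔ x ≠ Q.r ∧ Q.par x = v := by
  simp [ch]

theorem early_ne_root {x : V} (h : (Q.early x).Nonempty) : x ≠ Q.r := by
  obtain ⟨u, -, -, h⟩ := h
  exact Q.ne_root_of_tau_pos (by omega)

theorem tree_edge_tau {x u y : V} (hy : y ≠ Q.r) (h : s(x, u) = s(y, Q.par y)) :
    Q.tau x ≠ Q.tau u := by
  have := Q.tau_par_lt hy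
  rcases Sym2.eq_iff.1 h with ⟨rfl, rfl⟩ | ⟨rfl, rfl⟩ <;> omega

open Classical in
theorem exists_labeling [Fintype V] (K : Q.Skel) {m : ℕ} (hm : 2 ≤ m)
    (hcr : (Q.ch Q.r).card ≤ m * m) (hcv : ∀ v, v ≠ Q.r → (Q.ch v).card + 1 ≤ m * m)
    (hn : m ≤ ((Q.ch Q.r).filter (fun x => ¬ K.S x)).card) :
    ∃ (c : Sym2 V → Option (ZMod m)) (a : V → Option (ZMod m)) (b : V → ZMod m),
    (∀ x, x ≠ Q.r → c s(x, Q.par x) = a x) ∧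
    (∀ x, x ≠ Q.r → (Q.early x).Nonempty → ¬ K.S x → c s(x, K.w x) = some (b x)) ∧
    (∀ x, Q.Fresh x → ¬ K.S x →
      ∑ u ∈ Finset.univ.filter (fun u => G.Adj x u ∧ u ≠ Q.par x), oval (c s(x, u)) = b x) ∧
    (∀ x y, x ≠ Q.r → y ≠ Q.r → Q.par x = Q.par y → ¬ K.S x → ¬ K.S y → a x = a y →
      b x = b y → x = y) ∧
    (∀ x y, x ≠ Q.r → y ≠ Q.r → Q.par x = Q.par y → K.S x → ¬ K.S y → a x ≠ a y) ∧
    (∀ e, c e = none → ∃ x, x ≠ Q.r ∧ e = s(x, Q.par x)) ∧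
    (∀ x u, x ≠ Q.r → u ≠ Q.r → Q.tau x = Q.tau u → ¬ Q.Internal x → ¬ Q.Internal u →
      c s(x, u) = some 0) ∧
    m ≤ ((Q.ch Q.r).filter (fun x => a x = none)).card ∧
    (∀ v ∈ Q.ch Q.r, Q.Closd v → ¬ K.S v → a v = none →
      (∀ x ∈ Q.ch Q.r, a x ≠ some 0) ∨
        ((∀ x ∈ Q.ch Q.r, ¬ K.S x → a x ≠ none → Q.Closd x) ∧
          (∃ x ∈ Q.ch Q.r, ¬ K.S x ∧ a x ≠ none) ∧
          (∃ x ∈ Q.ch Q.r, K.S x ∧ a x = some 0) ∧ ∀ x ∈ Q.ch Q.r, K.S x → a x = some 0)) ∧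
    (∀ v, v ≠ Q.r → ((Q.ch v).filter (fun x => a x = none)).card + 2 ≤ m ∨
      (m = 2 ∧ Q.Closd v ∧ ∃ s z, Q.ch v = {s, z} ∧ K.S s ∧ ¬ K.S z ∧ a s = none ∧
        a z = some 0)) := by
  have : Fact (1 < m) := ⟨by omega⟩
  -- assignments at the root
  obtain ⟨ar, br, ar1, ar2, ar3, ar4⟩ := root_assign hm (Q.ch Q.r) ((Q.ch Q.r).filter K.S)
    (Finset.univ.filter Q.Closd) hcr
    (by
      have : Q.ch Q.r \ (Q.ch Q.r).filter K.S = (Q.ch Q.r).filter (fun x => ¬ K.S x) := by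
        ext x; simp only [Finset.mem_sdiff, Finset.mem_filter]; tauto
      rw [this]; exact hn)
    (Finset.filter_subset _ _)
  have hmem : ∀ v x, x ∈ Q.ch v \ (Q.ch v).filter K.S ↔ x ∈ Q.ch v ∧ ¬ K.S x := by
    intro v x; simp only [Finset.mem_sdiff, Finset.mem_filter]; tauto
  -- assignments elsewhere
  have hbb : ∀ v, ∃ b : V → ZMod m, v ≠ Q.r → (Q.ch v).Nonempty → ∀ T,
      ∃ a : V → Option (ZMod m), ∑ x ∈ Q.ch v, oval (a x) = T ∧
        (∀ x ∈ Q.ch v \ (Q.ch v).filter K.S, ∀ y ∈ Q.ch v \ (Q.ch v).filter K.S,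
          a x = a y → b x = b y → x = y) ∧
        (∀ x ∈ (Q.ch v).filter K.S, ∀ y ∈ Q.ch v \ (Q.ch v).filter K.S, a x ≠ a y) ∧
        (((Q.ch v).filter (fun x => a x = none)).card + 2 ≤ m ∨
          (m = 2 ∧ T = 0 ∧ ∃ s z, Q.ch v = {s, z} ∧ s ∈ (Q.ch v).filter K.S ∧
            z ∉ (Q.ch v).filter K.S ∧ a s = none ∧ a z = some 0)) := by
    intro v
    by_cases h : v ≠ Q.r ∧ (Q.ch v).Nonempty
    · obtain ⟨b, hb⟩ := assign_exists hm (Q.ch v) ((Q.ch v).filter K.S)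
        (Finset.filter_subset _ _) h.2 (hcv v h.1)
      exact ⟨b, fun _ _ => hb⟩
    · exact ⟨fun _ => 0, fun h1 h2 => absurd ⟨h1, h2⟩ h⟩
  choose bb hbb using hbb
  let b : V → ZMod m := fun x => if Q.par x = Q.r then br x else bb (Q.par x) x
  let N : V → Finset V := fun x => Finset.univ.filter (fun u => G.Adj x u ∧ u ≠ Q.par x)
  have hN : ∀ x u, u ∈ N x ↔ G.Adj x u ∧ u ≠ Q.par x := by intro x u; simp [N]
  obtain ⟨c1, hc1, hc1'⟩ := solve_sums (Finset.univ.filter (fun x => Q.Internal x ∧ x ∉ K.R))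
    K.p K.rho N b (fun _ => 0)
    (by
      intro x hx
      simp only [Finset.mem_filter, Finset.mem_univ, true_and] at hx
      obtain ⟨h1, h2, -⟩ := K.hp x hx.1 hx.2
      exact (hN _ _).2 ⟨h1, h2⟩)
    (by
      intro x hx hx'
      simp only [Finset.mem_filter, Finset.mem_univ, true_and] at hx hx'
      exact (K.hp x hx.1 hx.2).2.2 hx'.1)
  let T : V → ZMod m := fun v => if Q.Closd v then
    b v - ∑ u ∈ (N v).filter (fun u => Q.tau u = Q.tau v), c1 s(v, u) else 1
  have haa : ∀ v, ∃ a : V → Option (ZMod m), v ≠ Q.r → (Q.ch v).Nonempty →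
      ∑ x ∈ Q.ch v, oval (a x) = T v ∧
        (∀ x ∈ Q.ch v \ (Q.ch v).filter K.S, ∀ y ∈ Q.ch v \ (Q.ch v).filter K.S,
          a x = a y → bb v x = bb v y → x = y) ∧
        (∀ x ∈ (Q.ch v).filter K.S, ∀ y ∈ Q.ch v \ (Q.ch v).filter K.S, a x ≠ a y) ∧
        (((Q.ch v).filter (fun x => a x = none)).card + 2 ≤ m ∨
          (m = 2 ∧ T v = 0 ∧ ∃ s z, Q.ch v = {s, z} ∧ s ∈ (Q.ch v).filter K.S ∧
            z ∉ (Q.ch v).filter K.S ∧ a s = none ∧ a z = some 0)) := by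
    intro v
    by_cases h : v ≠ Q.r ∧ (Q.ch v).Nonempty
    · obtain ⟨a, ha⟩ := hbb v h.1 h.2 (T v)
      exact ⟨a, fun _ _ => ha⟩
    · exact ⟨fun _ => none, fun h1 h2 => absurd ⟨h1, h2⟩ h⟩
  choose aa haa using haa
  let a : V → Option (ZMod m) := fun x => if Q.par x = Q.r then ar x else aa (Q.par x) x
  have har : ∀ x ∈ Q.ch Q.r, a x = ar x := by
    intro x hx
    have := (Q.mem_ch.1 hx).2
    simp [a, this]
  have haar : ∀ v, v ≠ Q.r → ∀ x ∈ Q.ch v, a x = aa v x := by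
    intro v hv x hx
    have := (Q.mem_ch.1 hx).2
    simp [a, this, hv]
  have hbr : ∀ x ∈ Q.ch Q.r, b x = br x := by
    intro x hx
    have := (Q.mem_ch.1 hx).2
    simp [b, this]
  have hbbr : ∀ v, v ≠ Q.r → ∀ x ∈ Q.ch v, b x = bb v x := by
    intro v hv x hx
    have := (Q.mem_ch.1 hx).2
    simp [b, this, hv]
  let P2 : V → Prop := fun x => (Q.early x).Nonempty ∧ ¬ K.S x
  let c2 : Sym2 V → ZMod m := extEdge P2 K.w b c1
  let base : Sym2 V → ZMod m := extEdge (fun x => x ≠ Q.r) Q.par (fun x => oval (a x)) c2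
  obtain ⟨c3, hc3, hc3'⟩ := solve_sums (Finset.univ.filter Q.Opn) K.pi (fun _ => 0) N b base
    (by
      intro x hx
      simp only [Finset.mem_filter, Finset.mem_univ, true_and] at hx
      obtain ⟨h1, h2, -⟩ := K.hpi x hx
      refine (hN _ _).2 ⟨h1, ?_⟩
      intro h
      have := Q.tau_par_lt hx.1.1
      rw [← h] at this
      omega)
    (by
      intro x hx hx'
      simp only [Finset.mem_filter, Finset.mem_univ, true_and] at hx hx'
      obtain ⟨h1, h2, h3⟩ := K.hpi x hx
      have := Q.not_fresh_of_late h1 h2 h3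
      rw [hx'.1.2] at this
      exact this.elim)
  let c : Sym2 V → Option (ZMod m) :=
    extEdge (fun x => x ≠ Q.r) Q.par a (fun e => some (c3 e))
  have hct : ∀ x, x ≠ Q.r → c s(x, Q.par x) = a x := fun x hx =>
    extEdge_apply Q.ord (fun x hx => Q.lt x hx) hx
  have hcn : ∀ e, (∀ x, x ≠ Q.r → e ≠ s(x, Q.par x)) → c e = some (c3 e) := fun e he =>
    extEdge_of_not he
  have hbt : ∀ x, x ≠ Q.r → base s(x, Q.par x) = oval (a x) := fun x hx =>
    extEdge_apply (val := fun x => oval (a x)) Q.ord (fun x hx => Q.lt x hx) hx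
  have hbn : ∀ e, (∀ x, x ≠ Q.r → e ≠ s(x, Q.par x)) → base e = c2 e := fun e he =>
    extEdge_of_not he
  have hc3b : ∀ e, (∀ y, Q.Opn y → e ≠ s(y, K.pi y)) → c3 e = base e := by
    intro e he
    apply hc3'
    intro x hx
    simp only [Finset.mem_filter, Finset.mem_univ, true_and] at hx
    exact he x hx
  have hc3t : ∀ x, x ≠ Q.r → c3 s(x, Q.par x) = oval (a x) := by
    intro x hx
    rw [← hbt x hx]
    apply hc3b
    intro y hy h
    obtain ⟨h1, h2, h3⟩ := K.hpi y hy
    have h4 := Q.tau_par_lt hx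
    rcases Sym2.eq_iff.1 h with ⟨e1, e2⟩ | ⟨e1, e2⟩
    · rw [e2, e1] at h4; omega
    · rw [← e1] at h3; exact h3 e2
  have hov : ∀ e, oval (c e) = c3 e := by
    intro e
    by_cases h : ∃ x, x ≠ Q.r ∧ e = s(x, Q.par x)
    · obtain ⟨x, hx, rfl⟩ := h
      rw [hct x hx, hc3t x hx]
    · push Not at h
      rw [hcn e h]; rfl
  have hsib : ∀ x u, Q.tau x = Q.tau u → c s(x, u) = some (c1 s(x, u)) := by
    intro x u h
    have h1 : ∀ y, y ≠ Q.r → s(x, u) ≠ s(y, Q.par y) := fun y hy h' =>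
      Q.tree_edge_tau hy h' h
    rw [hcn _ h1, hc3b, hbn _ h1]
    · congr 1
      apply extEdge_of_not
      intro y hy h'
      have := (K.hw2 y hy.1).2.2
      rcases Sym2.eq_iff.1 h' with ⟨e1, e2⟩ | ⟨e1, e2⟩ <;> rw [e1, e2] at h <;> omega
    · intro y hy h'
      have := (K.hpi y hy).2.1
      rcases Sym2.eq_iff.1 h' with ⟨e1, e2⟩ | ⟨e1, e2⟩ <;> rw [e1, e2] at h <;> omega
  have hsib3 : ∀ x u, Q.tau x = Q.tau u → c3 s(x, u) = c1 s(x, u) := by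
    intro x u h
    rw [← hov, hsib x u h]; rfl
  refine ⟨c, a, b, hct, ?_, ?_, ?_, ?_, ?_, ?_, ?_, ?_, ?_⟩
  · intro x hx hE hS
    obtain ⟨w1, w2, w3⟩ := K.hw2 x hE
    have h1 : ∀ y, y ≠ Q.r → s(x, K.w x) ≠ s(y, Q.par y) := by
      intro y hy h
      have := Q.tau_par_lt hy
      rcases Sym2.eq_iff.1 h with ⟨e1, e2⟩ | ⟨e1, e2⟩
      · rw [← e1] at e2; exact w2 e2
      · rw [← e1, ← e2] at this; omega
    rw [hcn _ h1, hc3b, hbn _ h1]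
    · congr 1
      exact extEdge_apply (P := P2) Q.tau (fun x hx => (K.hw2 x hx.1).2.2) (x := x) ⟨hE, hS⟩
    · intro y hy h
      rcases Sym2.eq_iff.1 h with ⟨e1, e2⟩ | ⟨e1, e2⟩
      · rw [← e1] at hy
        rw [hy.1.2] at hE
        exact Set.not_nonempty_empty hE
      · apply hS
        right
        rw [← e2] at hy e1
        exact ⟨hE, hy, e1.symm⟩
  · intro x hx hS
    simp only [hov]
    by_cases hO : Q.Opn x
    · exact hc3 x (by simpa using hO)
    by_cases hI : Q.Internal x
    · have hxR : x ∉ K.R := fun h => hS (Or.inl h)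
      rw [← hc1 x (by simp [hI, hxR])]
      refine Finset.sum_congr rfl fun u hu => ?_
      have := (hN x u).1 hu
      exact hsib3 _ _ (hI.2 u this.1 this.2).symm
    · have hC : Q.Closd x := ⟨hx, hI, hO⟩
      have hne : (Q.ch x).Nonempty := by
        obtain ⟨u, hu⟩ := hC.exists_child
        exact ⟨u, Q.mem_ch.2 hu⟩
      have hT := (haa x hx.1 hne).1
      have hTv : T x = b x - ∑ u ∈ (N x).filter (fun u => Q.tau u = Q.tau x), c1 s(x, u) := by
        simp only [T, if_pos hC]
      change ∑ u ∈ N x, c3 s(x, u) = b x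
      rw [← Finset.sum_filter_add_sum_filter_not (N x) (fun u => Q.tau u = Q.tau x)]
      have e1 : ∑ u ∈ (N x).filter (fun u => Q.tau u = Q.tau x), c3 s(x, u) =
          ∑ u ∈ (N x).filter (fun u => Q.tau u = Q.tau x), c1 s(x, u) := by
        refine Finset.sum_congr rfl fun u hu => ?_
        exact hsib3 _ _ (Finset.mem_filter.1 hu).2.symm
      have e2 : (N x).filter (fun u => ¬ Q.tau u = Q.tau x) = Q.ch x := by
        ext u
        rw [Finset.mem_filter, hN, Q.mem_ch]
        constructor
        · rintro ⟨⟨h1, h2⟩, h3⟩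
          obtain ⟨h4, h5 | h5⟩ := hC.cases Q h1 h2
          · exact absurd h5.1 h3
          · exact ⟨h4, h5⟩
        · rintro ⟨h1, h2⟩
          have h3 := Q.tau_par_lt h1
          have h4 := Q.tau_par_lt hx.1
          have h5 := Q.adj u h1
          rw [h2] at h3 h5
          refine ⟨⟨h5.symm, ?_⟩, by omega⟩
          intro h
          rw [← h] at h4
          omega
      have e3 : ∑ u ∈ Q.ch x, c3 s(x, u) = T x := by
        rw [← hT]
        refine Finset.sum_congr rfl fun u hu => ?_
        obtain ⟨h1, h2⟩ := Q.mem_ch.1 hu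
        rw [← haar x hx.1 u hu, ← hc3t u h1, h2, Sym2.eq_swap]
      rw [e1, e2, e3, hTv]
      abel
  · intro x y hx hy hp hSx hSy hab hb
    by_cases hr : Q.par x = Q.r
    · have mx : x ∈ Q.ch Q.r := Q.mem_ch.2 ⟨hx, hr⟩
      have my : y ∈ Q.ch Q.r := Q.mem_ch.2 ⟨hy, hp ▸ hr⟩
      rw [har x mx, har y my] at hab
      rw [hbr x mx, hbr y my] at hb
      exact ar1 x ((hmem _ _).2 ⟨mx, hSx⟩) y ((hmem _ _).2 ⟨my, hSy⟩) hab hb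
    · have mx : x ∈ Q.ch (Q.par x) := Q.mem_ch.2 ⟨hx, rfl⟩
      have my : y ∈ Q.ch (Q.par x) := Q.mem_ch.2 ⟨hy, hp.symm⟩
      rw [haar _ hr x mx, haar _ hr y my] at hab
      rw [hbbr _ hr x mx, hbbr _ hr y my] at hb
      exact (haa _ hr ⟨x, mx⟩).2.1 x ((hmem _ _).2 ⟨mx, hSx⟩) y ((hmem _ _).2 ⟨my, hSy⟩) hab hb
  · intro x y hx hy hp hSx hSy hab
    by_cases hr : Q.par x = Q.r
    · have mx : x ∈ Q.ch Q.r := Q.mem_ch.2 ⟨hx, hr⟩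
      have my : y ∈ Q.ch Q.r := Q.mem_ch.2 ⟨hy, hp ▸ hr⟩
      rw [har x mx, har y my] at hab
      exact ar2 x (Finset.mem_filter.2 ⟨mx, hSx⟩) y ((hmem _ _).2 ⟨my, hSy⟩) hab
    · have mx : x ∈ Q.ch (Q.par x) := Q.mem_ch.2 ⟨hx, rfl⟩
      have my : y ∈ Q.ch (Q.par x) := Q.mem_ch.2 ⟨hy, hp.symm⟩
      rw [haar _ hr x mx, haar _ hr y my] at hab
      exact (haa _ hr ⟨x, mx⟩).2.2.1 x (Finset.mem_filter.2 ⟨mx, hSx⟩) y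
        ((hmem _ _).2 ⟨my, hSy⟩) hab
  · intro e he
    by_contra h
    push Not at h
    rw [hcn e h] at he
    exact absurd he (by simp)
  · intro x u hx hu ht hxI huI
    rw [hsib x u ht, hc1']
    intro y hy h
    simp only [Finset.mem_filter, Finset.mem_univ, true_and] at hy
    rcases Sym2.eq_iff.1 h with ⟨e1, -⟩ | ⟨-, e1⟩
    · exact hxI (e1 ▸ hy.1)
    · exact huI (e1 ▸ hy.1)
  · refine ar3.trans (Finset.card_le_card ?_)
    intro x hx
    obtain ⟨h1, h2⟩ := Finset.mem_filter.1 hx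
    exact Finset.mem_filter.2 ⟨h1, by rw [har x h1]; exact h2⟩
  · intro v hv hC hS hav
    rcases ar4 v (by simpa using hC) ((hmem _ _).2 ⟨hv, hS⟩) (by rw [← har v hv]; exact hav)
      with h | ⟨h1, ⟨x, h2, h2'⟩, ⟨s, h3⟩, h4⟩
    · left; intro x hx; rw [har x hx]; exact h x hx
    · right
      refine ⟨?_, ?_, ?_, ?_⟩
      · intro x hx hxS hxa
        rw [har x hx] at hxa
        simpa using h1 x ((hmem _ _).2 ⟨hx, hxS⟩) hxa
      · obtain ⟨e1, e2⟩ := (hmem _ _).1 h2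
        exact ⟨x, e1, e2, by rw [har x e1]; exact h2'⟩
      · obtain ⟨e1, e2⟩ := Finset.mem_filter.1 h3
        exact ⟨s, e1, e2, by rw [har s e1]; exact h4 s h3⟩
      · intro x hx hxS
        rw [har x hx]; exact h4 x (Finset.mem_filter.2 ⟨hx, hxS⟩)
  · intro v hv
    by_cases hne : (Q.ch v).Nonempty
    · have hf : (Q.ch v).filter (fun x => a x = none) =
          (Q.ch v).filter (fun x => aa v x = none) := by
        refine Finset.filter_congr fun x hx => ?_
        rw [haar v hv x hx]
      rw [hf]
      rcases (haa v hv hne).2.2.2 with h | ⟨h1, h2, s, z, h3, h4, h5, h6, h7⟩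
      · exact Or.inl h
      · right
        have hs : s ∈ Q.ch v := by rw [h3]; simp
        have hz : z ∈ Q.ch v := by rw [h3]; simp
        refine ⟨h1, ?_, s, z, h3, (Finset.mem_filter.1 h4).2, ?_, ?_, ?_⟩
        · by_contra hC
          simp only [T, if_neg hC] at h2
          exact one_ne_zero h2
        · intro h; exact h5 (Finset.mem_filter.2 ⟨hz, h⟩)
        · rw [haar v hv s hs]; exact h6
        · rw [haar v hv z hz]; exact h7
    · left
      rw [Finset.not_nonempty_iff_eq_empty.1 hne]
      simpa using hm

end SearchOrder


namespace SearchOrder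
variable {V : Type*} {G : SimpleGraph V} (Q : SearchOrder G)

theorem early_child_root {x : V} (hx : x ≠ Q.r) (hp : Q.par x = Q.r) : Q.early x = ∅ := by
  refine Set.eq_empty_of_forall_notMem ?_
  rintro u ⟨h1, h2, h3⟩
  have h4 := Q.ne_root_of_adj hx h1 h2
  rw [Q.tau_of_ne h4, Q.tau_of_ne hx, hp] at h3
  have := Q.root_le (Q.par u)
  omega

theorem par_of_adj_root {u : V} (h : G.Adj Q.r u) : u ≠ Q.r ∧ Q.par u = Q.r := by
  have hu : u ≠ Q.r := h.ne'
  exact ⟨hu, Q.inj (le_antisymm (Q.le u hu _ h.symm) (Q.root_le _))⟩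

theorem Skel.S_fresh {Q : SearchOrder G} (K : Q.Skel) {x : V} (hx : Q.early x = ∅) (h : K.S x) :
    x ∈ K.R := by
  rcases h with h | h
  · exact h
  · rw [hx] at h; exact absurd h.1 Set.not_nonempty_empty

theorem Skel.closd_not_S {Q : SearchOrder G} (K : Q.Skel) {x : V} (hx : Q.Closd x) : ¬ K.S x :=
  fun h => hx.2.1 (K.R_sub _ (K.S_fresh hx.1.2 h))

/-- A special root has an ordinary neighbour. -/
theorem Skel.exists_partner {Q : SearchOrder G} (K : Q.Skel)
    (h2 : ∀ v w, ∃ u, G.Adj v u ∧ u ≠ w) {z : V} (hz : z ∈ K.R) :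
    ∃ y, G.Adj z y ∧ y ≠ Q.par z ∧ Q.tau y = Q.tau z ∧ Q.par y = Q.par z ∧ ¬ K.S y ∧
      Q.Internal y ∧ (∀ z' ∈ K.R, G.Adj y z' → z' = z) ∧
      (∀ u', G.Adj y u' → u' ≠ Q.par y → Q.Internal u') := by
  obtain ⟨y, hy, hyp⟩ := h2 z (Q.par z)
  obtain ⟨h1, h2, h3, h4⟩ := K.hR z hz y hy hyp
  have ht := (K.R_sub z hz).2 y hy hyp
  exact ⟨y, hy, hyp, ht, Q.par_eq_of_tau_eq h1.1 (K.R_sub z hz).1 ht,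
    fun h => h2 (K.S_fresh h1.fresh.2 h), h1, h3, h4⟩

open Classical in
/-- The root is fixed. -/
theorem fix_root [Fintype V] (K : Q.Skel) {m : ℕ}
    (h2 : ∀ v w, ∃ u, G.Adj v u ∧ u ≠ w)
    (hcr : (Q.ch Q.r).card ≤ m * m)
    (c : Sym2 V → Option (ZMod m)) (a : V → Option (ZMod m))
    (hca : ∀ x, x ≠ Q.r → c s(x, Q.par x) = a x)
    (hdis : ∀ x y, x ≠ Q.r → y ≠ Q.r → Q.par x = Q.par y → K.S x → ¬ K.S y → a x ≠ a y)
    (hnone : ∀ e, c e = none → ∃ x, x ≠ Q.r ∧ e = s(x, Q.par x))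
    (hsib : ∀ x u, x ≠ Q.r → u ≠ Q.r → Q.tau x = Q.tau u → ¬ Q.Internal x → ¬ Q.Internal u →
      c s(x, u) = some 0)
    (hrn : m ≤ ((Q.ch Q.r).filter (fun x => a x = none)).card)
    (hrc : ∀ v ∈ Q.ch Q.r, Q.Closd v → ¬ K.S v → a v = none →
      (∀ x ∈ Q.ch Q.r, a x ≠ some 0) ∨
        ((∀ x ∈ Q.ch Q.r, ¬ K.S x → a x ≠ none → Q.Closd x) ∧
          (∃ x ∈ Q.ch Q.r, ¬ K.S x ∧ a x ≠ none) ∧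
          (∃ x ∈ Q.ch Q.r, K.S x ∧ a x = some 0) ∧ ∀ x ∈ Q.ch Q.r, K.S x → a x = some 0))
    (hvn : ∀ v, v ≠ Q.r → ((Q.ch v).filter (fun x => a x = none)).card + 2 ≤ m ∨
      (m = 2 ∧ Q.Closd v ∧ ∃ s z, Q.ch v = {s, z} ∧ K.S s ∧ ¬ K.S z ∧ a s = none ∧
        a z = some 0))
    (φ : G ≃g G) (hφ : ∀ e ∈ G.edgeSet, c (Sym2.map φ e) = c e) : φ Q.r = Q.r := by
  have hφ' : ∀ x y, G.Adj x y → c s(φ x, φ y) = c s(x, y) := fun x y h => hφ s(x, y) h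
  have hcc : ∀ v, ∀ x ∈ Q.ch v, G.Adj v x ∧ c s(v, x) = a x := by
    intro v x hx
    obtain ⟨h1, h2⟩ := Q.mem_ch.1 hx
    refine ⟨?_, ?_⟩
    · rw [← h2]; exact (Q.adj x h1).symm
    · rw [← hca x h1, h2, Sym2.eq_swap]
  by_contra hv
  obtain ⟨v, hvdef⟩ : ∃ v, v = φ Q.r := ⟨_, rfl⟩
  rw [← hvdef] at hv
  have himg : m ≤ (Finset.univ.filter (fun u => G.Adj v u ∧ c s(v, u) = none)).card := by
    refine hrn.trans (Finset.card_le_card_of_injOn φ ?_ φ.injective.injOn)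
    intro x hx
    obtain ⟨h1, h2⟩ := Finset.mem_filter.1 hx
    obtain ⟨h3, h4⟩ := hcc _ _ h1
    simp only [Finset.coe_filter, Finset.mem_univ, true_and, Set.mem_ofPred_eq]
    rw [hvdef, hφ' _ _ h3, h4]
    exact ⟨φ.map_adj_iff.2 h3, h2⟩
  have hsub : ∀ u, G.Adj v u → c s(v, u) = none →
      (u = Q.par v ∧ a v = none) ∨ u ∈ (Q.ch v).filter (fun x => a x = none) := by
    intro u h1 h2
    obtain ⟨x, hx, he⟩ := hnone _ h2
    have h3 := hca x hx
    rw [← he, h2] at h3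
    rcases Sym2.eq_iff.1 he with ⟨e1, e2⟩ | ⟨e1, e2⟩
    · subst e1; exact Or.inl ⟨e2, h3.symm⟩
    · right
      rw [Finset.mem_filter, Q.mem_ch, e2]
      exact ⟨⟨hx, e1.symm⟩, h3.symm⟩
  have hle1 : (Finset.univ.filter (fun u => G.Adj v u ∧ c s(v, u) = none)).card ≤
      ((Q.ch v).filter (fun x => a x = none)).card + 1 := by
    refine le_trans (Finset.card_le_card (t := insert (Q.par v)
      ((Q.ch v).filter (fun x => a x = none))) ?_) (Finset.card_insert_le _ _)
    intro u hu
    obtain ⟨-, h1, h2⟩ := Finset.mem_filter.1 hu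
    rw [Finset.mem_insert]
    rcases hsub u h1 h2 with h | h
    · exact Or.inl h.1
    · exact Or.inr h
  rcases hvn v hv with h | ⟨hm2, hC, s, z, hch, hSs, hSz, has, haz⟩
  · omega
  have hfil : ((Q.ch v).filter (fun x => a x = none)).card ≤ 1 := by
    rw [Finset.card_le_one]
    have : ∀ x ∈ (Q.ch v).filter (fun x => a x = none), x = s := by
      intro x hx
      obtain ⟨h1, h2⟩ := Finset.mem_filter.1 hx
      rw [hch, Finset.mem_insert, Finset.mem_singleton] at h1
      rcases h1 with h1 | h1
      · exact h1
      · rw [h1, haz] at h2; simp at h2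
    intro x hx y hy
    rw [this x hx, this y hy]
  have hav : a v = none := by
    by_contra hav
    have : (Finset.univ.filter (fun u => G.Adj v u ∧ c s(v, u) = none)).card ≤
        ((Q.ch v).filter (fun x => a x = none)).card := by
      refine Finset.card_le_card ?_
      intro u hu
      obtain ⟨-, h1, h2⟩ := Finset.mem_filter.1 hu
      rcases hsub u h1 h2 with h | h
      · exact absurd h.2 hav
      · exact h
    omega
  have hSv := K.closd_not_S hC
  have hpv : Q.par v = Q.r := by
    by_contra hpr
    have hmem : v ∈ Q.ch (Q.par v) := Q.mem_ch.2 ⟨hv, rfl⟩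
    rcases hvn _ hpr with h | ⟨-, -, s', z', h1, h2, h3, h4, h5⟩
    · have : 0 < ((Q.ch (Q.par v)).filter (fun x => a x = none)).card :=
        Finset.card_pos.2 ⟨v, Finset.mem_filter.2 ⟨hmem, hav⟩⟩
      omega
    · rw [h1, Finset.mem_insert, Finset.mem_singleton] at hmem
      rcases hmem with e | e
      · rw [e] at hSv; exact hSv h2
      · rw [e, h5] at hav; simp at hav
  have hvr : v ∈ Q.ch Q.r := Q.mem_ch.2 ⟨hv, hpv⟩
  have hs : s ∈ Q.ch v := by rw [hch]; simp
  have hz : z ∈ Q.ch v := by rw [hch]; simp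
  rcases hrc v hvr hC hSv hav with h | ⟨g1, ⟨x3, hx3, hx3S, hx3a⟩, ⟨z0, hz0, hz0S, hz0a⟩, -⟩
  · obtain ⟨e1, e2⟩ := hcc v z hz
    have hadj : G.Adj Q.r (φ.symm z) := by
      rw [← φ.map_adj_iff, ← hvdef]; simpa using e1
    have hmem : φ.symm z ∈ Q.ch Q.r := Q.mem_ch.2 (Q.par_of_adj_root hadj)
    have h3 := (hcc _ _ hmem).2
    have h4 := hφ' _ _ hadj
    rw [← hvdef] at h4
    apply h _ hmem
    rw [← h3, ← h4, ← haz, ← e2]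
    simp
  · obtain ⟨hz0r, hz0p⟩ := Q.mem_ch.1 hz0
    obtain ⟨hx3r, hx3p⟩ := Q.mem_ch.1 hx3
    have hz0R : z0 ∈ K.R := K.S_fresh (Q.early_child_root hz0r hz0p) hz0S
    obtain ⟨y, y1, y2, y3, y4, y5, y6, y7, y8⟩ := K.exists_partner h2 hz0R
    have hy : y ∈ Q.ch Q.r := Q.mem_ch.2 ⟨y6.1, y4.trans hz0p⟩
    have hx3C := g1 x3 hx3 hx3S hx3a
    have hya : a y = none := by
      by_contra h
      exact (g1 y hy y5 h).2.1 y6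
    have d1 : v ≠ y := fun h => hC.2.1 (h ▸ y6)
    have d2 : v ≠ x3 := fun h => hx3a (h ▸ hav)
    have d3 : v ≠ z0 := fun h => hSv (h ▸ hz0S)
    have d4 : y ≠ x3 := fun h => hx3a (h ▸ hya)
    have d5 : y ≠ z0 := fun h => y5 (h ▸ hz0S)
    have d6 : x3 ≠ z0 := fun h => hx3S (h ▸ hz0S)
    have hall : ({v, y, x3, z0} : Finset V) = Q.ch Q.r := by
      apply Finset.eq_of_subset_of_card_le
      · intro t ht
        simp only [Finset.mem_insert, Finset.mem_singleton] at ht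
        rcases ht with rfl | rfl | rfl | rfl <;> assumption
      · have : ({v, y, x3, z0} : Finset V).card = 4 := by
          rw [Finset.card_insert_of_notMem, Finset.card_insert_of_notMem,
            Finset.card_insert_of_notMem, Finset.card_singleton] <;>
          simp [d1, d2, d3, d4, d5, d6]
        rw [this]
        rw [hm2] at hcr
        exact hcr
    have hx30 : a x3 ≠ some 0 := by
      intro h
      apply hdis z0 x3 hz0r hx3r (hz0p.trans hx3p.symm) hz0S hx3S
      rw [hz0a, h]
    obtain ⟨u, hu⟩ : ∃ u, u = φ x3 := ⟨_, rfl⟩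
    obtain ⟨f1, f2⟩ := hcc _ _ hx3
    have huv : G.Adj v u := by rw [hvdef, hu]; exact φ.map_adj_iff.2 f1
    have hcu : c s(v, u) = a x3 := by rw [hvdef, hu, hφ' _ _ f1, f2]
    have hup : u ≠ Q.par v := by
      intro h
      rw [h, hca v hv, hav] at hcu
      exact hx3a hcu.symm
    obtain ⟨hur, ⟨h5, h6⟩ | h5⟩ := hC.cases Q huv hup
    · by_cases huI : Q.Internal u
      · have hmem : u ∈ Q.ch Q.r := Q.mem_ch.2 ⟨hur, h6.trans hpv⟩
        rw [← hall] at hmem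
        simp only [Finset.mem_insert, Finset.mem_singleton] at hmem
        rcases hmem with e | e | e | e
        · exact huv.ne e.symm
        · rw [e] at huv
          apply hC.2.1 (y8 v huv.symm _)
          rw [y4, hz0p]; exact hv
        · exact hx3C.2.1 (e ▸ huI)
        · rw [e] at huv
          apply hC.2.1 (K.hR z0 hz0R v huv.symm _).1
          rw [hz0p]; exact hv
      · rw [hsib v u hv hur h5.symm hC.2.1 huI] at hcu
        exact hx30 hcu.symm
    · have hmem : u ∈ Q.ch v := Q.mem_ch.2 ⟨hur, h5⟩
      rw [(hcc v u hmem).2] at hcu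
      rw [hch, Finset.mem_insert, Finset.mem_singleton] at hmem
      rcases hmem with e | e
      · rw [e, has] at hcu; exact hx3a hcu.symm
      · rw [e, haz] at hcu; exact hx30 hcu.symm

open Classical in
/-- There are enough ordinary children of the root, except for the triangle. -/
theorem enough_children [Fintype V] (K : Q.Skel) {m : ℕ} (hm : 2 ≤ m)
    (h2 : ∀ v w, ∃ u, G.Adj v u ∧ u ≠ w)
    (hc : (m - 1) * (m - 1) < (Q.ch Q.r).card) :
    m ≤ ((Q.ch Q.r).filter (fun x => ¬ K.S x)).card ∨ Fintype.card V ≤ 3 := by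
  by_contra hcon
  push Not at hcon
  obtain ⟨hn, hV⟩ := hcon
  have hfr : ∀ x ∈ Q.ch Q.r, K.S x → x ∈ K.R := by
    intro x hx hS
    obtain ⟨h3, h4⟩ := Q.mem_ch.1 hx
    exact K.S_fresh (Q.early_child_root h3 h4) hS
  have hpt : ∀ z, ∃ y, z ∈ (Q.ch Q.r).filter K.S → y ∈ (Q.ch Q.r).filter (fun x => ¬ K.S x) ∧
      G.Adj z y ∧ Q.Internal y ∧ ∀ z' ∈ K.R, G.Adj y z' → z' = z := by
    intro z
    by_cases hz : z ∈ (Q.ch Q.r).filter K.S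
    · obtain ⟨h3, h4⟩ := Finset.mem_filter.1 hz
      obtain ⟨y, y1, y2, y3, y4, y5, y6, y7, -⟩ := K.exists_partner h2 (hfr z h3 h4)
      refine ⟨y, fun _ => ⟨Finset.mem_filter.2 ⟨Q.mem_ch.2 ⟨y6.1, ?_⟩, y5⟩, y1, y6, y7⟩⟩
      rw [y4]; exact (Q.mem_ch.1 h3).2
    · exact ⟨z, fun h => absurd h hz⟩
  choose y hy using hpt
  have hle : ((Q.ch Q.r).filter K.S).card ≤ ((Q.ch Q.r).filter (fun x => ¬ K.S x)).card := by
    refine Finset.card_le_card_of_injOn y (fun z hz => (hy z hz).1) ?_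
    intro z hz z' hz' he
    have hz'' := Finset.mem_filter.1 hz'
    refine ((hy z hz).2.2.2 z' (hfr z' hz''.1 hz''.2) ?_).symm
    rw [he]; exact (hy z' hz').2.1.symm
  have hsum := Finset.card_filter_add_card_filter_not (s := Q.ch Q.r) K.S
  obtain ⟨k, rfl⟩ : ∃ k, m = k + 2 := ⟨m - 2, by omega⟩
  have hk : k + 2 - 1 = k + 1 := by omega
  rw [hk] at hc
  have hk0 : k = 0 := by nlinarith
  subst hk0
  have hn1 : ((Q.ch Q.r).filter (fun x => ¬ K.S x)).card = 1 := by omega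
  have hs1 : ((Q.ch Q.r).filter K.S).card = 1 := by omega
  obtain ⟨z, hz⟩ := Finset.card_eq_one.1 hs1
  obtain ⟨y', hy'⟩ := Finset.card_eq_one.1 hn1
  have hzm : z ∈ (Q.ch Q.r).filter K.S := by rw [hz]; simp
  have hint : ∀ x ∈ Q.ch Q.r, Q.Internal x := by
    intro x hx
    by_cases hS : K.S x
    · exact K.R_sub _ (hfr x hx hS)
    · have h3 : x ∈ (Q.ch Q.r).filter (fun x => ¬ K.S x) := Finset.mem_filter.2 ⟨hx, hS⟩
      have h4 := (hy z hzm).1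
      rw [hy', Finset.mem_singleton] at h3 h4
      rw [h3, ← h4]; exact (hy z hzm).2.2.1
  have hall : ∀ n, ∀ x, Q.ord x ≤ n → x = Q.r ∨ x ∈ Q.ch Q.r := by
    intro n
    induction n with
    | zero =>
      intro x hx
      left
      exact Q.inj (le_antisymm (by omega) (Q.root_le x))
    | succ n ih =>
      intro x hx
      by_cases hxr : x = Q.r
      · exact Or.inl hxr
      · have := Q.lt x hxr
        rcases ih (Q.par x) (by omega) with h | h
        · exact Or.inr (Q.mem_ch.2 ⟨hxr, h⟩)
        · exact absurd (hint _ h) (Q.par_ne_internal hxr)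
  have : Fintype.card V ≤ (insert Q.r (Q.ch Q.r)).card := by
    rw [← Finset.card_univ]
    apply Finset.card_le_card
    intro x _
    rw [Finset.mem_insert]
    exact hall _ x le_rfl
  have := Finset.card_insert_le Q.r (Q.ch Q.r)
  omega

end SearchOrder

theorem distinguishingIndex_le_of_labeling {V α : Type*} [Fintype α] (G : SimpleGraph V) (d : ℕ)
    (hd : Fintype.card α ≤ d) (f : Sym2 V → α)
    (hf : ∀ φ : G ≃g G, (∀ e ∈ G.edgeSet, f (Sym2.map φ e) = f e) → ∀ v, φ v = v) :
    distinguishingIndex G ≤ d := by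
  obtain ⟨e⟩ : Nonempty (α ↪ Fin d) := Function.Embedding.nonempty_of_card_le (by simpa using hd)
  refine Nat.sInf_le ⟨fun x => e (f x), fun φ h => hf φ fun x hx => e.injective (h x hx)⟩

theorem perm_fin_three : ∀ σ : Equiv.Perm (Fin 3), (∀ i j, i ≠ j → σ i + σ j = i + j) →
    ∀ i, σ i = i := by decide

theorem distinguishingIndex_triangle {V : Type*} [Fintype V] (G : SimpleGraph V)
    (hadj : ∀ x y, x ≠ y → G.Adj x y) (hV : Fintype.card V = 3) (d : ℕ) (hd : 3 ≤ d) :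
    distinguishingIndex G ≤ d := by
  have e : V ≃ Fin 3 := Fintype.equivFinOfCardEq hV
  refine distinguishingIndex_le_of_labeling (α := Fin 3) G d (by simpa using hd)
    (Sym2.lift ⟨fun x y => e x + e y, fun x y => add_comm _ _⟩) ?_
  intro φ h v
  have := perm_fin_three ((e.symm.trans φ.toEquiv).trans e) (by
    intro i j hij
    have := h s(e.symm i, e.symm j) (hadj _ _ (fun h => hij (e.symm.injective h)))
    simpa using this) (e v)
  simpa using this

theorem distinguishingIndex_le_of_minDegree_two {V : Type*} [Fintype V]
    (G : SimpleGraph V) [DecidableRel G.Adj] (hconn : G.Connected)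
    (hδ : ∀ v, 2 ≤ G.degree v) :
    distinguishingIndex G ≤ ⌈Real.sqrt (G.maxDegree)⌉₊ + 1 := by
  classical
  have hne := hconn.nonempty
  obtain ⟨r, hr⟩ := G.exists_maximal_degree_vertex
  obtain ⟨m, hmdef⟩ : ∃ m, m = ⌈Real.sqrt (G.maxDegree)⌉₊ := ⟨_, rfl⟩
  rw [← hmdef]
  have hΔ2 : 2 ≤ G.maxDegree := by rw [hr]; exact hδ r
  have hm : 2 ≤ m := by
    rw [hmdef]
    show 1 < _
    rw [Nat.lt_ceil, Real.lt_sqrt (by norm_num)]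
    have : (2 : ℝ) ≤ (G.maxDegree : ℝ) := by exact_mod_cast hΔ2
    push_cast
    linarith
  have hΔ : G.maxDegree ≤ m * m := by
    have h1 : Real.sqrt (G.maxDegree) ≤ m := by rw [hmdef]; exact Nat.le_ceil _
    have h2 := (Real.sqrt_le_left (by positivity)).1 h1
    rw [pow_two] at h2
    exact_mod_cast h2
  have hΔ' : (m - 1) * (m - 1) < G.maxDegree := by
    have h1 : m - 1 < ⌈Real.sqrt (G.maxDegree)⌉₊ := by rw [← hmdef]; omega
    rw [Nat.lt_ceil, Real.lt_sqrt (by positivity), pow_two] at h1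
    exact_mod_cast h1
  have h2 : ∀ v w, ∃ u, G.Adj v u ∧ u ≠ w := by
    intro v w
    have : 1 < (G.neighborFinset v).card := by
      rw [card_neighborFinset_eq_degree]; exact hδ v
    obtain ⟨u, hu, huw⟩ := Finset.exists_mem_ne this w
    exact ⟨u, by simpa using hu, huw⟩
  obtain ⟨Q, hQ⟩ := exists_searchOrder G hconn r
  obtain ⟨K⟩ := Q.exists_skel
  have hchsub : ∀ v, Q.ch v ⊆ G.neighborFinset v := by
    intro v x hx
    obtain ⟨h1, h2⟩ := Q.mem_ch.1 hx
    rw [mem_neighborFinset, ← h2]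
    exact (Q.adj x h1).symm
  have hcrd : (Q.ch Q.r).card = G.maxDegree := by
    rw [hr, ← hQ, ← card_neighborFinset_eq_degree]
    congr 1
    apply Finset.Subset.antisymm (hchsub _)
    intro x hx
    exact Q.mem_ch.2 (Q.par_of_adj_root (by simpa using hx))
  have hcv : ∀ v, v ≠ Q.r → (Q.ch v).card + 1 ≤ m * m := by
    intro v hv
    have h3 : Q.par v ∉ Q.ch v := by
      intro h
      obtain ⟨h4, h5⟩ := Q.mem_ch.1 h
      have h6 := Q.tau_par_lt h4
      have h7 := Q.tau_par_lt hv
      rw [h5] at h6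
      omega
    rw [← Finset.card_insert_of_notMem h3]
    refine le_trans (Finset.card_le_card (t := G.neighborFinset v) ?_) ?_
    · intro x hx
      rcases Finset.mem_insert.1 hx with h | h
      · rw [h, mem_neighborFinset]; exact Q.adj v hv
      · exact hchsub v h
    · rw [card_neighborFinset_eq_degree]
      exact (G.degree_le_maxDegree v).trans hΔ
  rcases Q.enough_children K hm h2 (by rw [hcrd]; exact hΔ') with hn | hV
  · obtain ⟨c, a, b, e1, e2, e3, e4, e5, e6, e7, e8, e9, e10⟩ :=
      Q.exists_labeling K hm (by rw [hcrd]; exact hΔ) hcv hn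
    have : NeZero m := ⟨by omega⟩
    refine distinguishingIndex_le_of_labeling (α := Option (ZMod m)) G (m + 1)
      (by simp [ZMod.card]) c ?_
    intro φ hφ
    have hroot := Q.fix_root K h2 (by rw [hcrd]; exact hΔ) c a e1 e5 e6 e7 e8 e9 e10 φ hφ
    refine Q.fix_all c a b K.S K.w e1 K.hw K.hw2 e2 e3 e4 e5 ?_ ?_ φ hφ hroot
    · intro x y hx hy hSx hSy hwe
      have key : ∀ x, (Q.early x).Nonempty → K.S x → K.pi (K.w x) = x := by
        intro x hx hS
        rcases hS with h | h
        · have := (K.R_sub x h).fresh.2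
          rw [this] at hx
          exact absurd hx Set.not_nonempty_empty
        · exact h.2.2
      rw [← key x hx hSx, ← key y hy hSy, hwe]
    · intro x hx hS
      obtain ⟨y, y1, y2, y3, y4, y5, y6, y7, -⟩ := K.exists_partner h2 (K.S_fresh hx.2 hS)
      exact ⟨y, y1, y2, y3, y5, y6.fresh, fun z hz hzS => y7 z (K.S_fresh hz.2 hzS)⟩
  · have hlt := G.degree_lt_card_verts r
    have hV3 : Fintype.card V = 3 := by have := hδ r; omega
    refine distinguishingIndex_triangle G ?_ hV3 _ (by omega)
    intro x y hxy
    by_contra h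
    have h3 : G.neighborFinset x ⊆ (Finset.univ.erase x).erase y := by
      intro u hu
      rw [mem_neighborFinset] at hu
      simp only [Finset.mem_erase, Finset.mem_univ, and_true]
      exact ⟨fun e => h (e ▸ hu), hu.ne'⟩
    have h4 := Finset.card_le_card h3
    rw [card_neighborFinset_eq_degree, Finset.card_erase_of_mem (by simp [Ne.symm hxy]),
      Finset.card_erase_of_mem (by simp), Finset.card_univ, hV3] at h4
    have := hδ x
    omega
end

section
/- If G is a connected 2-minimally graph with exactly one vertex v of degree greater than 2, then G is obtained by identifying the central vertices of finitely many dutch windmill graphs at v; in particular every edge of G lies on a cycle through v and Δ(G) is even. -/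
open SimpleGraph

/-- A graph with minimum degree at least 2 is `2`-minimally if every proper
spanning subgraph has minimum degree less than 2. -/
def IsTwoMinimally {V : Type*} (G : SimpleGraph V) : Prop :=
  (∀ v, 2 ≤ (G.neighborSet v).ncard) ∧
    ∀ H : SimpleGraph V, H < G → ∃ v, (H.neighborSet v).ncard < 2


theorem tm_degree_eq {V : Type*} (H : SimpleGraph V) (a : V) [Fintype (H.neighborSet a)] :
    (H.neighborSet a).ncard = H.degree a := by
  rw [Set.ncard_eq_toFinset_card', ← SimpleGraph.card_neighborFinset_eq_degree]
  rfl

theorem tm_closed {V : Type*} [Fintype V] (G : SimpleGraph V) (v : V)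
    (h2 : ∀ w, w ≠ v → (G.neighborSet w).ncard = 2)
    (c : G.Walk v v) (hc : c.IsCycle) (w u : V) (hw : w ∈ c.support) (hwv : w ≠ v)
    (hwu : G.Adj w u) : c.toSubgraph.Adj w u := by
  have h1 := hc.ncard_neighborSet_toSubgraph_eq_two hw
  have h3 : c.toSubgraph.neighborSet w = G.neighborSet w :=
    Set.eq_of_subset_of_ncard_le (c.toSubgraph.neighborSet_subset w)
      (by rw [h1, h2 w hwv]) (Set.toFinite _)
  have : u ∈ c.toSubgraph.neighborSet w := by rw [h3]; exact hwu
  exact this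

theorem tm_path {V : Type*} (G : SimpleGraph V) (v : V) (A : Set V)
    (hA : ∀ a b, G.Adj a b → a ≠ v → b ≠ v → a ∈ A → b ∈ A) {x y : V} (p : G.Walk x y)
    (hy : y = v) (hp : p.IsPath) : ∀ u ∈ p.support, u ≠ v → (u ∈ A ↔ x ∈ A) := by
  induction p with
  | nil => intro u hu huv; simp at hu; rw [hu]
  | @cons a b z h q ih =>
    subst hy
    rw [SimpleGraph.Walk.cons_isPath_iff] at hp
    intro u hu huv
    rw [SimpleGraph.Walk.support_cons, List.mem_cons] at hu
    rcases hu with rfl | hu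
    · rfl
    · have hav : a ≠ z := by
        rintro rfl
        exact hp.2 q.end_mem_support
      have hbv : b ≠ z := by
        rintro rfl
        have := SimpleGraph.Walk.isPath_iff_nil.1 hp.1
        rw [SimpleGraph.Walk.nil_iff_support_eq.1 this] at hu
        exact huv (List.mem_singleton.1 hu)
      rw [ih rfl hp.1 u hu huv]
      exact ⟨hA b a h.symm hbv hav, hA a b h hav hbv⟩

theorem tm_support {V : Type*} [Fintype V] (G : SimpleGraph V) (v : V)
    (h2 : ∀ w, w ≠ v → (G.neighborSet w).ncard = 2)
    (c d : G.Walk v v) (hc : c.IsCycle) (hd : d.IsCycle) (w : V) (hwv : w ≠ v)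
    (hwc : w ∈ c.support) (hwd : w ∈ d.support) : ∀ u ∈ d.support, u ∈ c.support := by
  have hA : ∀ a b, G.Adj a b → a ≠ v → b ≠ v → a ∈ {u | u ∈ c.support} →
      b ∈ {u | u ∈ c.support} := by
    intro a b hab ha hb hac
    have := tm_closed G v h2 c hc a b hac ha hab
    exact (SimpleGraph.Walk.mem_verts_toSubgraph c).1 this.snd_mem
  intro u hu
  by_cases huv : u = v
  · subst huv; exact c.start_mem_support
  cases d with
  | nil => simp at hwd; exact absurd hwd hwv
  | cons h p =>
    rw [SimpleGraph.Walk.cons_isCycle_iff] at hd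
    have key := tm_path G v _ hA p rfl hd.1
    rw [SimpleGraph.Walk.support_cons, List.mem_cons] at hu hwd
    exact (key u (hu.resolve_left huv) huv).2 ((key w (hwd.resolve_left hwv) hwv).1 hwc)

theorem tm_exists {V : Type*} [Fintype V] (G : SimpleGraph V) (v : V)
    (h2 : ∀ w, w ≠ v → (G.neighborSet w).ncard = 2) (x : V) (hx : G.Adj v x) :
    ∃ c : G.Walk v v, c.IsCycle ∧ x ∈ c.support := by
  classical
  have hreach : (G \ SimpleGraph.fromEdgeSet {s(v, x)}).Reachable v x := by
    by_contra hr
    set G' := G \ SimpleGraph.fromEdgeSet {s(v, x)} with hG'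
    let H : SimpleGraph V :=
      { Adj := fun a b => G'.Adj a b ∧ G'.Reachable x a
        symm := ⟨fun a b h => ⟨h.1.symm, h.2.trans h.1.reachable⟩⟩
        loopless := ⟨fun a h => G'.loopless.irrefl a h.1⟩ }
    have hxv : x ≠ v := hx.ne'
    have hdx : (H.neighborSet x).ncard = 1 := by
      have : H.neighborSet x = G.neighborSet x \ {v} := by
        ext b
        simp only [SimpleGraph.mem_neighborSet, H, hG', SimpleGraph.sdiff_adj,
          SimpleGraph.fromEdgeSet_adj, Set.mem_diff, Set.mem_singleton_iff]
        constructor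
        · rintro ⟨⟨h, h'⟩, -⟩
          refine ⟨h, ?_⟩
          rintro rfl
          exact h' ⟨Sym2.eq_swap, h.ne⟩
        · rintro ⟨h, h'⟩
          refine ⟨⟨h, ?_⟩, SimpleGraph.Reachable.refl x⟩
          rintro ⟨h3, -⟩
          rw [Sym2.eq_iff] at h3
          grind
      rw [this, Set.ncard_diff_singleton_of_mem (by exact hx.symm), h2 x hxv]
    obtain ⟨w, hwx, hw⟩ := H.exists_ne_odd_degree_of_exists_odd_degree x (by rw [← tm_degree_eq, hdx]; decide)
    by_cases hrw : G'.Reachable x w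
    · have hwv : w ≠ v := by
        rintro rfl
        exact hr hrw.symm
      have : H.neighborSet w = G.neighborSet w := by
        ext b
        simp only [SimpleGraph.mem_neighborSet, H, hG', SimpleGraph.sdiff_adj,
          SimpleGraph.fromEdgeSet_adj, Set.mem_singleton_iff]
        constructor
        · rintro ⟨⟨h, h'⟩, -⟩
          exact h
        · intro h
          refine ⟨⟨h, ?_⟩, hrw⟩
          rintro ⟨h3, -⟩
          rw [Sym2.eq_iff] at h3
          grind
      rw [← tm_degree_eq, this, h2 w hwv] at hw
      exact absurd hw (by decide)
    · have : H.neighborSet w = ∅ := by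
        ext b
        simp only [SimpleGraph.mem_neighborSet, H, Set.mem_empty_iff_false, iff_false]
        exact fun h => hrw h.2
      rw [← tm_degree_eq, this, Set.ncard_empty] at hw
      exact absurd hw (by decide)
  obtain ⟨u, p, hp, he⟩ :=
    SimpleGraph.adj_and_reachable_delete_edges_iff_exists_cycle.1 ⟨hx, hreach⟩
  have hv := p.fst_mem_support_of_mem_edges he
  refine ⟨p.rotate v hv, hp.rotate hv, ?_⟩
  exact (SimpleGraph.Walk.mem_support_rotate_iff ..).2 (p.snd_mem_support_of_mem_edges he)

theorem twoMinimally_unique_big_vertex_is_windmill {V : Type*} [Fintype V]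
    (G : SimpleGraph V) [DecidableRel G.Adj] (hconn : G.Connected)
    (hmin : IsTwoMinimally G) (v : V) (hv : 2 < G.degree v)
    (huniq : ∀ w : V, 2 < G.degree w → w = v) :
    ∃ (ι : Type) (_ : Fintype ι) (c : ι → G.Walk v v),
      (∀ i, (c i).IsCycle) ∧
      (∀ e ∈ G.edgeSet, ∃ i, e ∈ (c i).edges) ∧
      (∀ i j, i ≠ j → ∀ w, w ∈ (c i).support → w ∈ (c j).support → w = v) ∧
      G.degree v = 2 * Fintype.card ι ∧
      G.maxDegree = G.degree v ∧ Even G.maxDegree := by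
  classical
  have hge : ∀ w, 2 ≤ (G.neighborSet w).ncard := hmin.1
  have h2 : ∀ w, w ≠ v → (G.neighborSet w).ncard = 2 := by
    intro w hw
    refine le_antisymm ?_ (hge w)
    rw [tm_degree_eq]
    by_contra h
    exact hw (huniq w (by omega))
  let S : Set (Set V) := {s | ∃ c : G.Walk v v, c.IsCycle ∧ s = {u | u ∈ c.support}}
  obtain ⟨n, ⟨e⟩⟩ := Finite.exists_equiv_fin S
  choose c hc hcs using fun i : Fin n => (e.symm i).2
  have hcov : ∀ d : G.Walk v v, d.IsCycle → ∃ i, ∀ u ∈ d.support, u ∈ (c i).support := by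
    intro d hd
    refine ⟨e ⟨{u | u ∈ d.support}, d, hd, rfl⟩, fun u hu => ?_⟩
    have h := hcs (e ⟨{u | u ∈ d.support}, d, hd, rfl⟩)
    rw [Equiv.symm_apply_apply] at h
    have : u ∈ {u | u ∈ d.support} := hu
    change {u | u ∈ d.support} = _ at h
    rw [h] at this
    exact this
  have hnb : ∀ x, G.Adj v x → ∃ i, x ∈ (c i).support := by
    intro x hx
    obtain ⟨d, hd, hxd⟩ := tm_exists G v h2 x hx
    obtain ⟨i, hi⟩ := hcov d hd
    exact ⟨i, hi x hxd⟩
  have hdisj : ∀ i j, i ≠ j → ∀ w, w ∈ (c i).support → w ∈ (c j).support → w = v := by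
    intro i j hij w hi hj
    by_contra hwv
    apply hij
    apply e.symm.injective
    apply Subtype.ext
    rw [hcs i, hcs j]
    ext u
    exact ⟨tm_support G v h2 _ _ (hc j) (hc i) w hwv hj hi u,
      tm_support G v h2 _ _ (hc i) (hc j) w hwv hi hj u⟩
  have hstep : ∀ a b, G.Adj a b → (∃ i, a ∈ (c i).support) → ∃ i, b ∈ (c i).support := by
    rintro a b hab ⟨i, hi⟩
    by_cases hav : a = v
    · subst hav; exact hnb b hab
    · exact ⟨i, (SimpleGraph.Walk.mem_verts_toSubgraph _).1
        (tm_closed G v h2 _ (hc i) a b hi hav hab).snd_mem⟩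
  have hvin : ∃ i, v ∈ (c i).support := by
    have : 0 < G.degree v := by omega
    obtain ⟨x, hx⟩ := (G.degree_pos_iff_exists_adj v).1 this
    obtain ⟨i, -⟩ := hnb x hx
    exact ⟨i, (c i).start_mem_support⟩
  have hall : ∀ w, ∃ i, w ∈ (c i).support := by
    intro w
    obtain ⟨p⟩ := hconn.preconnected v w
    have : ∀ {a b : V} (p : G.Walk a b), (∃ i, a ∈ (c i).support) →
        ∃ i, b ∈ (c i).support := by
      intro a b p
      induction p with
      | nil => exact id
      | cons h q ih => exact fun ha => ih (hstep _ _ h ha)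
    exact this p hvin
  have hcovE : ∀ a b, G.Adj a b → a ≠ v → ∃ i, s(a, b) ∈ (c i).edges := by
    intro a b hab hav
    obtain ⟨i, hi⟩ := hall a
    refine ⟨i, ?_⟩
    rw [← SimpleGraph.Walk.adj_toSubgraph_iff_mem_edges]
    exact tm_closed G v h2 _ (hc i) a b hi hav hab
  have hdeg : G.degree v = 2 * n := by
    have : Nonempty (Fin n) := ⟨hvin.choose⟩
    choose! f hf using hnb
    rw [← SimpleGraph.card_neighborFinset_eq_degree,
      Finset.card_eq_sum_card_fiberwise (f := f) (t := Finset.univ) (fun _ _ => by simp)]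
    rw [Finset.sum_congr rfl (g := fun _ => 2)]
    · simp [mul_comm]
    · intro i _
      rw [← (hc i).ncard_neighborSet_toSubgraph_eq_two (c i).start_mem_support,
        ← Set.ncard_coe_finset]
      congr 1
      ext x
      simp only [Finset.coe_filter, SimpleGraph.mem_neighborFinset, Set.mem_setOf_eq,
        SimpleGraph.Subgraph.mem_neighborSet]
      constructor
      · rintro ⟨hx, rfl⟩
        exact (tm_closed G v h2 _ (hc _) x v (hf x hx) hx.ne' hx.symm).symm
      · intro h
        have hx := h.adj_sub
        refine ⟨hx, ?_⟩
        by_contra hne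
        exact hx.ne' (hdisj _ _ hne x (hf x hx)
          ((SimpleGraph.Walk.mem_verts_toSubgraph _).1 h.snd_mem))
  have hmax : G.maxDegree = G.degree v := by
    refine le_antisymm (G.maxDegree_le_of_forall_degree_le _ fun w => ?_) (G.degree_le_maxDegree v)
    by_cases hw : w = v
    · rw [hw]
    · rw [← tm_degree_eq, h2 w hw]; omega
  refine ⟨Fin n, inferInstance, c, hc, ?_, hdisj, by simpa using hdeg, hmax, ?_⟩
  · intro s
    induction s with
    | _ a b =>
      intro hab
      rw [SimpleGraph.mem_edgeSet] at hab
      by_cases hav : a = v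
      · obtain ⟨i, hi⟩ := hcovE b a hab.symm (by rw [← hav]; exact hab.ne')
        exact ⟨i, by rwa [Sym2.eq_swap]⟩
      · exact hcovE a b hab hav
  · rw [hmax, hdeg]; exact even_two_mul n
end

section
/- If G is a connected 2-minimally graph with maximum degree Δ that is not a cycle C_3, C_4, C_5 and not a complete bipartite graph K_{2,r^2} for any positive integer r, then D'(G) ≤ ⌈√Δ⌉. -/
open SimpleGraph

section Aux

variable {V : Type*} {G : SimpleGraph V}

/-- Abstract local structure: `B` are the big vertices, `o x u` is the neighbour of the small
vertex `x` other than `u`. -/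
structure BigCtx (G : SimpleGraph V) (B : V → Prop) (o : V → V → V) : Prop where
  hB : ∀ u x, G.Adj u x → B u → ¬ B x
  adj : ∀ x u, ¬ B x → G.Adj x u → G.Adj x (o x u)
  ne : ∀ x u, ¬ B x → G.Adj x u → o x u ≠ u
  cases : ∀ x u z, ¬ B x → G.Adj x u → G.Adj x z → z = u ∨ z = o x u

/-- A search order rooted at `r`. -/
structure SearchOrd (G : SimpleGraph V) (r : V) (ρ : V → ℕ) : Prop where
  inj : Function.Injective ρ
  min : ∀ v, ρ r ≤ ρ v
  par : ∀ v, v ≠ r → ∃ w, G.Adj v w ∧ ρ w < ρ v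

/-- The big vertex `u` owns its neighbour `x`. -/
def Own (G : SimpleGraph V) (B : V → Prop) (o : V → V → V) (ρ : V → ℕ) (u x : V) : Prop :=
  B u ∧ G.Adj u x ∧ ρ u < ρ (o x u) ∧ (¬ B (o x u) → ρ u ≤ ρ (o (o x u) x))

variable {B : V → Prop} {o : V → V → V} {ρ : V → ℕ} {r : V}

lemma BigCtx.oo (h : BigCtx G B o) {x u : V} (hx : ¬ B x) (ha : G.Adj x u) : o x (o x u) = u := by
  rcases h.cases x (o x u) u hx (h.adj x u hx ha) ha with h1 | h1
  · exact absurd h1.symm (h.ne x u hx ha)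
  · exact h1.symm

lemma BigCtx.o_eq (h : BigCtx G B o) {x u z : V} (hx : ¬ B x) (ha : G.Adj x u) (hz : G.Adj x z)
    (hn : z ≠ u) : o x u = z :=
  ((h.cases x u z hx ha hz).resolve_left hn).symm

lemma Own.small (h : BigCtx G B o) {u x : V} (hO : Own G B o ρ u x) : ¬ B x :=
  h.hB u x hO.2.1 hO.1

lemma Own.uniq (h : BigCtx G B o) {u w x : V} (h1 : Own G B o ρ u x)
    (h2 : Own G B o ρ w x) : u = w := by
  by_contra hne
  have hx := h1.small h
  have e1 := h.o_eq hx h1.2.1.symm h2.2.1.symm (Ne.symm hne)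
  have e2 := h.o_eq hx h2.2.1.symm h1.2.1.symm hne
  have a1 := h1.2.2.1
  have a2 := h2.2.2.1
  rw [e1] at a1
  rw [e2] at a2
  omega

lemma Own.uniq2 (h : BigCtx G B o) (hρ : Function.Injective ρ) {u w x y : V}
    (h1 : Own G B o ρ u x) (h2 : Own G B o ρ w y) (hxy : o x u = y) (hyx : G.Adj x y) :
    u = w := by
  have hx := h1.small h
  have hy := h2.small h
  have nw : w ≠ x := fun e => hx (e ▸ h2.1)
  have nu : u ≠ y := fun e => hy (e ▸ h1.1)
  have e1 : o y x = w := h.o_eq hy hyx.symm h2.2.1.symm nw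
  have e2 : o y w = x := h.o_eq hy h2.2.1.symm hyx.symm nw.symm
  have e3 : o x y = u := h.o_eq hx hyx h1.2.1.symm nu
  have a1 := h1.2.2.2
  have a2 := h2.2.2.2
  rw [hxy, e1] at a1
  rw [e2, e3] at a2
  exact hρ (le_antisymm (a1 hy) (a2 hx))

lemma lt_of_lt_o (h : BigCtx G B o) (hr : B r) (hO : SearchOrd G r ρ) {u x : V} (hu : B u)
    (ha : G.Adj u x) (hlt : ρ u < ρ (o x u)) : ρ u < ρ x := by
  have hx := h.hB u x ha hu
  obtain ⟨z, hz, hlt2⟩ := hO.par x (fun e => hx (e ▸ hr))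
  rcases h.cases x u z hx ha.symm hz with rfl | rfl
  · exact hlt2
  · omega

lemma Own.tri (h : BigCtx G B o) (hr : B r) (hO : SearchOrd G r ρ) {u x : V}
    (h1 : Own G B o ρ u x) (ha : G.Adj u (o x u)) :
    Own G B o ρ u (o x u) ∧ o (o x u) u = x := by
  have hx := h1.small h
  have hy := h.hB u _ ha h1.1
  have axy := h.adj x u hx h1.2.1.symm
  have nu : x ≠ u := h1.2.1.ne'
  have e : o (o x u) u = x := h.o_eq hy ha.symm axy.symm nu
  refine ⟨⟨h1.1, ha, ?_, ?_⟩, e⟩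
  · rw [e]; exact lt_of_lt_o h hr hO h1.1 h1.2.1 h1.2.2.1
  · intro _
    rw [e, h.oo hx h1.2.1.symm]

lemma own_root (h : BigCtx G B o) (hr : B r) (hO : SearchOrd G r ρ) {x : V} (ha : G.Adj r x) :
    Own G B o ρ r x :=
  ⟨hr, ha, lt_of_le_of_ne (hO.min _)
    (fun e => h.ne x r (h.hB r x ha hr) ha.symm (hO.inj e.symm)), fun _ => hO.min _⟩

/-- Propagation. -/
lemma propagate {k : ℕ} (h : BigCtx G B o) (hr : B r) (hO : SearchOrd G r ρ) (f : Sym2 V → Fin k)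
    (hd : ∀ u x y, Own G B o ρ u x → Own G B o ρ u y → f s(u, x) = f s(u, y) →
      f s(x, o x u) = f s(y, o y u) → (G.Adj u (o x u) ↔ G.Adj u (o y u)) →
      (G.Adj u (o x u) → f s(u, o x u) = f s(u, o y u)) → x = y)
    (φ : G ≃g G) (hφ : ∀ a b, G.Adj a b → f s(φ a, φ b) = f s(a, b)) (hφr : φ r = r) :
    ∀ v, φ v = v := by
  have key : ∀ n u, ρ u = n → φ u = u ∧ ∀ z, G.Adj u z → φ z = z := by
    intro n
    induction n using Nat.strong_induction_on with
    | _ n ih =>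
    intro u hun
    subst hun
    have ih' : ∀ w, ρ w < ρ u → φ w = w ∧ ∀ z, G.Adj w z → φ z = z :=
      fun w hw => ih _ hw w rfl
    have hu : φ u = u := by
      by_cases e : u = r
      · rw [e, hφr]
      · obtain ⟨w, hw, hlt⟩ := hO.par u e
        exact (ih' w hlt).2 u hw.symm
    refine ⟨hu, fun x hx => ?_⟩
    by_cases hBu : B u
    · have hxB := h.hB u x hx hBu
      have forced : ∀ y, G.Adj u y → ¬ Own G B o ρ u y → φ y = y := by
        intro y hy hn
        have hyB := h.hB u y hy hBu
        have ao := h.adj y u hyB hy.symm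
        by_cases c1 : ρ (o y u) < ρ u
        · exact (ih' _ c1).2 y ao.symm
        · have c1' : ρ u < ρ (o y u) := lt_of_le_of_ne (not_lt.mp c1)
            (fun e => h.ne y u hyB hy.symm (hO.inj e.symm))
          have c2 : ¬ (¬ B (o y u) → ρ u ≤ ρ (o (o y u) y)) := fun c2 => hn ⟨hBu, hy, c1', c2⟩
          push Not at c2
          obtain ⟨c2, c3⟩ := c2
          have a3 := h.adj _ _ c2 ao.symm
          have f1 := (ih' _ c3).1
          have f2 := (ih' _ c3).2 _ a3.symm
          have a4 : G.Adj (o y u) (φ y) := by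
            have := φ.map_adj_iff.mpr ao.symm
            rwa [f2] at this
          rcases h.cases _ y _ c2 ao.symm a4 with e | e
          · exact e
          · rw [← f1] at e
            exact absurd (φ.injective e).symm (h.ne _ _ c2 ao.symm)
      by_cases hox : Own G B o ρ u x
      · have hy : G.Adj u (φ x) := by
          have := φ.map_adj_iff.mpr hx
          rwa [hu] at this
        by_cases hoy : Own G B o ρ u (φ x)
        · have hyB := h.hB u _ hy hBu
          have ax := h.adj x u hxB hx.symm
          have e1 : o (φ x) u = φ (o x u) := by
            apply h.o_eq hyB hy.symm (φ.map_adj_iff.mpr ax)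
            intro e
            exact h.ne x u hxB hx.symm (φ.injective (by rw [e, hu]))
          symm
          apply hd u x (φ x) hox hoy
          · rw [← hφ u x hx, hu]
          · rw [e1, hφ _ _ ax]
          · rw [e1]
            have := φ.map_adj_iff (v := u) (w := o x u)
            rw [hu] at this
            exact this.symm
          · intro hh
            rw [e1, ← hφ _ _ hh, hu]
        · exact φ.injective (forced _ hy hoy)
      · exact forced x hx hox
    · obtain ⟨w, hw, hlt⟩ := hO.par u (fun e => hBu (e ▸ hr))
      have fw := (ih' w hlt).1
      by_cases e : x = w
      · rw [e, fw]
      · have a1 : G.Adj u (φ x) := by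
          have := φ.map_adj_iff.mpr hx
          rwa [hu] at this
        rw [← h.o_eq hBu hw hx e]
        rw [← h.o_eq hBu hw hx e] at a1 e
        symm
        apply h.o_eq hBu hw a1
        intro e'
        exact e (φ.injective (by rw [e', fw]))
  exact fun v => (key _ v rfl).1

open Classical in
/-- Realising prescribed labels. -/
lemma exists_label {n : ℕ} (h : BigCtx G B o) (hO : SearchOrd G r ρ)
    (P : V → V → Fin (n + 2) × Fin (n + 2))
    (hc : ∀ u x, Own G B o ρ u x → G.Adj u (o x u) → (P u x).2 = (P u (o x u)).2) :
    ∃ f : Sym2 V → Fin (n + 2),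
      (∀ u x, Own G B o ρ u x → f s(u, x) = (P u x).1) ∧
      (∀ u x, Own G B o ρ u x → f s(x, o x u) = (P u x).2) ∧
      (∀ w x, B w → G.Adj w x → ¬ Own G B o ρ w x → (∀ u, Own G B o ρ u x → o x u ≠ w) →
        f s(w, x) = 1) := by
  let C1 : Sym2 V → V × V → Prop := fun e p => Own G B o ρ p.1 p.2 ∧ e = s(p.1, p.2)
  let C2 : Sym2 V → V × V → Prop := fun e p => Own G B o ρ p.1 p.2 ∧ e = s(p.2, o p.2 p.1)
  let f : Sym2 V → Fin (n + 2) := fun e =>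
    if h1 : ∃ p, C1 e p then (P h1.choose.1 h1.choose.2).1
    else if h2 : ∃ p, C2 e p then (P h2.choose.1 h2.choose.2).2 else 1
  refine ⟨f, ?_, ?_, ?_⟩
  · intro u x hox
    have h1 : ∃ p, C1 s(u, x) p := ⟨(u, x), hox, rfl⟩
    have hs := h1.choose_spec
    simp only [f, dif_pos h1]
    obtain ⟨hs1, hs2⟩ := hs
    rw [Sym2.eq_iff] at hs2
    rcases hs2 with ⟨e1, e2⟩ | ⟨e1, e2⟩
    · rw [← e1, ← e2]
    · exact absurd (e1 ▸ hox.1) (hs1.small h)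
  · intro u x hox
    have hx := hox.small h
    have n1 : ¬ ∃ p, C1 s(x, o x u) p := by
      rintro ⟨⟨w, y⟩, hs1, hs2⟩
      simp only [Sym2.eq_iff] at hs2 hs1
      rcases hs2 with ⟨e1, e2⟩ | ⟨e1, e2⟩
      · exact hx (e1 ▸ hs1.1)
      · rw [← e1] at hs1
        have := hox.uniq h hs1
        exact h.ne x u hx hox.2.1.symm (by rw [e2, this])
    have h2 : ∃ p, C2 s(x, o x u) p := ⟨(u, x), hox, rfl⟩
    simp only [f, dif_neg n1, dif_pos h2]
    obtain ⟨hs1, hs2⟩ := h2.choose_spec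
    generalize h2.choose = p at hs1 hs2 ⊢
    obtain ⟨w, y⟩ := p
    simp only [Sym2.eq_iff] at hs1 hs2 ⊢
    rcases hs2 with ⟨e1, e2⟩ | ⟨e1, e2⟩
    · subst e1
      rw [hox.uniq h hs1]
    · subst e2
      have hw := hox.uniq2 h hO.inj hs1 rfl (h.adj x u hx hox.2.1.symm)
      subst hw
      rw [hc u x hox hs1.2.1]
  · intro w x hw ha hn hno
    have hx := h.hB w x ha hw
    have n1 : ¬ ∃ p, C1 s(w, x) p := by
      rintro ⟨⟨u, y⟩, hs1, hs2⟩
      simp only [Sym2.eq_iff] at hs2 hs1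
      rcases hs2 with ⟨e1, e2⟩ | ⟨e1, e2⟩
      · subst e1 e2; exact hn hs1
      · exact hx (e2 ▸ hs1.1)
    have n2 : ¬ ∃ p, C2 s(w, x) p := by
      rintro ⟨⟨u, y⟩, hs1, hs2⟩
      simp only [Sym2.eq_iff] at hs2 hs1
      rcases hs2 with ⟨e1, e2⟩ | ⟨e1, e2⟩
      · exact hs1.small h (e1 ▸ hw)
      · subst e2; exact hno u hs1 e1.symm
    simp only [f, dif_neg n1, dif_neg n2]

/-- Propagation with prescribed labels. -/
lemma main_label {n : ℕ} (h : BigCtx G B o) (hr : B r) (hO : SearchOrd G r ρ)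
    (P : V → V → Fin (n + 2) × Fin (n + 2))
    (hc : ∀ u x, Own G B o ρ u x → G.Adj u (o x u) → (P u x).2 = (P u (o x u)).2)
    (hP : ∀ u x y, Own G B o ρ u x → Own G B o ρ u y → P u x = P u y →
      (G.Adj u (o x u) ↔ G.Adj u (o y u)) →
      (G.Adj u (o x u) → (P u (o x u)).1 = (P u (o y u)).1) → x = y) :
    ∃ f : Sym2 V → Fin (n + 2),
      (∀ u x, Own G B o ρ u x → f s(u, x) = (P u x).1) ∧
      (∀ u x, Own G B o ρ u x → f s(x, o x u) = (P u x).2) ∧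
      (∀ w x, B w → G.Adj w x → ¬ Own G B o ρ w x → (∀ u, Own G B o ρ u x → o x u ≠ w) →
        f s(w, x) = 1) ∧
      ∀ φ : G ≃g G, (∀ a b, G.Adj a b → f s(φ a, φ b) = f s(a, b)) → φ r = r →
        ∀ v, φ v = v := by
  obtain ⟨f, h1, h2, h3⟩ := exists_label h hO P hc
  refine ⟨f, h1, h2, h3, fun φ hφ hφr => propagate h hr hO f ?_ φ hφ hφr⟩
  intro u x y ox oy e1 e2 e3 e4
  rw [h1 u x ox, h1 u y oy] at e1
  rw [h2 u x ox, h2 u y oy] at e2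
  refine hP u x y ox oy (Prod.ext e1 e2) e3 (fun ha => ?_)
  have := e4 ha
  rwa [h1 u _ (ox.tri h hr hO ha).1, h1 u _ (oy.tri h hr hO (e3.mp ha)).1] at this

/-- A big vertex sees `(0, 0)` only through an owned pair `(0, 0)`. -/
lemma zero_pair {n : ℕ} (h : BigCtx G B o)
    (P : V → V → Fin (n + 2) × Fin (n + 2)) (f : Sym2 V → Fin (n + 2))
    (h1 : ∀ u x, Own G B o ρ u x → f s(u, x) = (P u x).1)
    (h2 : ∀ u x, Own G B o ρ u x → f s(x, o x u) = (P u x).2)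
    (h3 : ∀ w x, B w → G.Adj w x → ¬ Own G B o ρ w x → (∀ u, Own G B o ρ u x → o x u ≠ w) →
        f s(w, x) = 1)
    {w x : V} (hw : B w) (ha : G.Adj w x) (z1 : f s(w, x) = 0) {c : Fin (n + 2)}
    (z2 : f s(x, o x w) = c) :
    (Own G B o ρ w x ∧ P w x = (0, c)) ∨
      ∃ u, Own G B o ρ u x ∧ o x u = w ∧ P u x = (c, 0) := by
  by_cases hox : Own G B o ρ w x
  · left
    refine ⟨hox, Prod.ext ?_ ?_⟩
    · rw [← h1 _ _ hox, z1]
    · rw [← h2 _ _ hox, z2]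
  · by_cases hu : ∀ u, Own G B o ρ u x → o x u ≠ w
    · rw [h3 w x hw ha hox hu] at z1
      simp at z1
    · push Not at hu
      obtain ⟨u, hu, e⟩ := hu
      right
      refine ⟨u, hu, e, ?_⟩
      have hx := hu.small h
      have e2 : o x w = u := by rw [← e, h.oo hx hu.2.1.symm]
      refine Prod.ext ?_ ?_
      · rw [← h1 _ _ hu, ← z2, e2, Sym2.eq_swap]
      · rw [← h2 _ _ hu, e, ← z1, Sym2.eq_swap]

end Aux

section Count

variable {V : Type*} {G : SimpleGraph V} {B : V → Prop} {o : V → V → V} {ρ : V → ℕ} {r : V}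

lemma exists_inj {β : Type*} [Nonempty β] (S : Finset V) (Q : Finset β)
    (hc : S.card ≤ Q.card) : ∃ g : V → β, (∀ x ∈ S, g x ∈ Q) ∧ Set.InjOn g S := by
  classical
  obtain ⟨e⟩ : Nonempty (S ↪ Q) := Function.Embedding.nonempty_of_card_le (by simpa using hc)
  refine ⟨fun x => if hx : x ∈ S then (e ⟨x, hx⟩ : β) else Classical.arbitrary β, ?_, ?_⟩
  · intro x hx
    simp [hx]
  · intro x hx y hy hxy
    have hx' : x ∈ S := hx
    have hy' : y ∈ S := hy
    simp only [hx', hy', dif_pos] at hxy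
    have := e.injective (Subtype.ext hxy)
    simpa using this

lemma exists_inj_pt {β : Type*} [Nonempty β] (S : Finset V) (Q : Finset β)
    (hc : S.card ≤ Q.card) (x0 : V) (q0 : β) (hx0 : x0 ∈ S) (hq0 : q0 ∈ Q) :
    ∃ g : V → β, (∀ x ∈ S, g x ∈ Q) ∧ Set.InjOn g S ∧ g x0 = q0 := by
  classical
  obtain ⟨g, h1, h2⟩ := exists_inj (S.erase x0) (Q.erase q0) (by
    rw [Finset.card_erase_of_mem hx0, Finset.card_erase_of_mem hq0]; omega)
  refine ⟨Function.update g x0 q0, ?_, ?_, by simp⟩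
  · intro x hx
    by_cases e : x = x0
    · subst e; simpa using hq0
    · rw [Function.update_of_ne e]
      exact Finset.mem_of_mem_erase (h1 x (Finset.mem_erase.mpr ⟨e, hx⟩))
  · intro x hx y hy hxy
    by_cases e : x = x0
    · by_cases e' : y = x0
      · rw [e, e']
      · rw [e, Function.update_self, Function.update_of_ne e'] at hxy
        exact absurd hxy.symm (Finset.ne_of_mem_erase (h1 y (Finset.mem_erase.mpr ⟨e', hy⟩)))
    · by_cases e' : y = x0
      · rw [e', Function.update_self, Function.update_of_ne e] at hxy
        exact absurd hxy (Finset.ne_of_mem_erase (h1 x (Finset.mem_erase.mpr ⟨e, hx⟩)))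
      · rw [Function.update_of_ne e, Function.update_of_ne e'] at hxy
        exact h2 (Finset.mem_coe.mpr (Finset.mem_erase.mpr ⟨e, hx⟩))
          (Finset.mem_coe.mpr (Finset.mem_erase.mpr ⟨e', hy⟩)) hxy

lemma card_pairs (n : ℕ) : (Finset.univ : Finset (Fin (n + 2) × Fin (n + 2))).card = (n + 2) ^ 2 := by
  simp [sq]

/-- The local requirement on the labels at `u`. -/
def Good (G : SimpleGraph V) (B : V → Prop) (o : V → V → V) (ρ : V → ℕ) {n : ℕ} (u : V)
    (p : V → Fin (n + 2) × Fin (n + 2)) : Prop :=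
  (∀ x, Own G B o ρ u x → G.Adj u (o x u) → (p x).2 = (p (o x u)).2) ∧
  (∀ x y, Own G B o ρ u x → Own G B o ρ u y → p x = p y →
      (G.Adj u (o x u) ↔ G.Adj u (o y u)) →
      (G.Adj u (o x u) → (p (o x u)).1 = (p (o y u)).1) → x = y)

open Classical in
/-- Combining labels for ordinary threads and for triangles. -/
lemma good_combine {n : ℕ} (h : BigCtx G B o) (hr : B r) (hO : SearchOrd G r ρ) (u : V)
    (g hh : V → Fin (n + 2) × Fin (n + 2))
    (hg : ∀ x y, Own G B o ρ u x → Own G B o ρ u y → ¬ G.Adj u (o x u) → ¬ G.Adj u (o y u) →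
      g x = g y → x = y)
    (h0 : ∀ x, Own G B o ρ u x → G.Adj u (o x u) → ρ x < ρ (o x u) → (hh x).2 ≠ 0)
    (hi : ∀ x y, Own G B o ρ u x → G.Adj u (o x u) → ρ x < ρ (o x u) →
      Own G B o ρ u y → G.Adj u (o y u) → ρ y < ρ (o y u) → hh x = hh y → x = y) :
    ∃ p : V → Fin (n + 2) × Fin (n + 2), Good G B o ρ u p ∧
      (∀ x, ¬ G.Adj u (o x u) → p x = g x) ∧
      (∀ x, G.Adj u (o x u) → ρ x < ρ (o x u) → p x = (0, (hh x).1)) ∧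
      (∀ x, G.Adj u (o x u) → ¬ ρ x < ρ (o x u) → p x = ((hh (o x u)).2, (hh (o x u)).1)) := by
  let p : V → Fin (n + 2) × Fin (n + 2) := fun x =>
    if G.Adj u (o x u) then
      if ρ x < ρ (o x u) then (0, (hh x).1) else ((hh (o x u)).2, (hh (o x u)).1)
    else g x
  have p1 : ∀ x, ¬ G.Adj u (o x u) → p x = g x := fun x hx => by simp [p, hx]
  have p2 : ∀ x, G.Adj u (o x u) → ρ x < ρ (o x u) → p x = (0, (hh x).1) :=
    fun x hx hl => by simp [p, hx, hl]
  have p3 : ∀ x, G.Adj u (o x u) → ¬ ρ x < ρ (o x u) →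
      p x = ((hh (o x u)).2, (hh (o x u)).1) := fun x hx hl => by
    simp only [p, hx, hl, if_true, if_false]
  -- facts on triangles
  have T : ∀ x, Own G B o ρ u x → G.Adj u (o x u) → Own G B o ρ u (o x u) ∧ o (o x u) u = x ∧
      G.Adj u (o (o x u) u) ∧ (¬ ρ x < ρ (o x u) → ρ (o x u) < ρ (o (o x u) u)) := by
    intro x hx ha
    obtain ⟨t1, t2⟩ := hx.tri h hr hO ha
    refine ⟨t1, t2, by rw [t2]; exact hx.2.1, fun hl => ?_⟩
    rw [t2]
    refine lt_of_le_of_ne (not_lt.mp hl) (fun e => ?_)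
    have := hO.inj e
    exact (h.adj x u (hx.small h) hx.2.1.symm).ne' this
  refine ⟨p, ⟨?_, ?_⟩, p1, p2, p3⟩
  · intro x hx ha
    obtain ⟨t1, t2, t3, t4⟩ := T x hx ha
    by_cases hl : ρ x < ρ (o x u)
    · rw [p2 x ha hl, p3 _ t3 (by rw [t2]; omega), t2]
    · rw [p3 x ha hl, p2 _ t3 (t4 hl)]
  · intro x y hx hy hxy hiff h3
    by_cases ha : G.Adj u (o x u)
    · have hb := hiff.mp ha
      have h3 := h3 ha
      obtain ⟨t1, t2, t3, t4⟩ := T x hx ha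
      obtain ⟨s1, s2, s3, s4⟩ := T y hy hb
      by_cases hl : ρ x < ρ (o x u)
      · by_cases hm : ρ y < ρ (o y u)
        · rw [p2 x ha hl, p2 y hb hm] at hxy
          rw [p3 _ t3 (by rw [t2]; omega), p3 _ s3 (by rw [s2]; omega), t2, s2] at h3
          exact hi x y hx ha hl hy hb hm (Prod.ext (Prod.ext_iff.mp hxy).2 h3)
        · rw [p2 x ha hl, p3 y hb hm] at hxy
          exact absurd (Prod.ext_iff.mp hxy).1.symm (h0 _ s1 s3 (s4 hm))
      · by_cases hm : ρ y < ρ (o y u)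
        · rw [p3 x ha hl, p2 y hb hm] at hxy
          exact absurd (Prod.ext_iff.mp hxy).1 (h0 _ t1 t3 (t4 hl))
        · rw [p3 x ha hl, p3 y hb hm] at hxy
          have := hi _ _ t1 t3 (t4 hl) s1 s3 (s4 hm)
            (Prod.ext (Prod.ext_iff.mp hxy).2 (Prod.ext_iff.mp hxy).1)
          rw [← t2, this, s2]
    · rw [p1 x ha, p1 y (fun hb => ha (hiff.mpr hb))] at hxy
      exact hg x y hx hy ha (fun hb => ha (hiff.mpr hb)) hxy

variable [Fintype V]

open Classical in
/-- The owned neighbours. -/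
noncomputable def ownF (G : SimpleGraph V) (B : V → Prop) (o : V → V → V) (ρ : V → ℕ) (u : V) :
    Finset V := Finset.univ.filter (fun x => Own G B o ρ u x)

open Classical in
lemma card_tri (h : BigCtx G B o) (hr : B r) (hO : SearchOrd G r ρ) (u : V) :
    2 * ((ownF G B o ρ u).filter (fun x => G.Adj u (o x u) ∧ ρ x < ρ (o x u))).card +
      ((ownF G B o ρ u).filter (fun x => ¬ G.Adj u (o x u))).card ≤ (ownF G B o ρ u).card := by
  set S := ownF G B o ρ u with hS
  have mS : ∀ x, x ∈ S ↔ Own G B o ρ u x := fun x => by simp [hS, ownF]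
  set T := S.filter (fun x => G.Adj u (o x u) ∧ ρ x < ρ (o x u)) with hT
  have h1 : (T.image (fun x => o x u)).card = T.card := by
    apply Finset.card_image_of_injOn
    intro x hx y hy hxy
    simp only [hT, Finset.coe_filter, Set.mem_ofPred_eq, mS] at hx hy
    have e1 := (hx.1.tri h hr hO hx.2.1).2
    have e2 := (hy.1.tri h hr hO hy.2.1).2
    simp only at hxy
    rw [← e1, hxy, e2]
  have h2 : Disjoint T (T.image (fun x => o x u)) := by
    rw [Finset.disjoint_left]
    intro x hx hx'
    simp only [hT, Finset.mem_image, Finset.mem_filter, mS] at hx hx'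
    obtain ⟨y, hy, rfl⟩ := hx'
    have e2 := (hy.1.tri h hr hO hy.2.1).2
    rw [e2] at hx
    omega
  have h3 : T ∪ T.image (fun x => o x u) ⊆ S.filter (fun x => G.Adj u (o x u)) := by
    intro x hx
    rw [Finset.mem_union] at hx
    rcases hx with hx | hx
    · simp only [hT, Finset.mem_filter] at hx ⊢
      exact ⟨hx.1, hx.2.1⟩
    · simp only [hT, Finset.mem_image, Finset.mem_filter, mS] at hx ⊢
      obtain ⟨y, hy, rfl⟩ := hx
      obtain ⟨e1, e2⟩ := (hy.1.tri h hr hO hy.2.1)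
      refine ⟨e1, ?_⟩
      rw [e2]; exact hy.1.2.1
  have h4 := Finset.card_le_card h3
  rw [Finset.card_union_of_disjoint h2, h1] at h4
  have h5 := Finset.card_filter_add_card_filter_not (s := S) (fun x => G.Adj u (o x u))
  omega

/-- Labels at a non-root vertex. -/
lemma good_nonroot {n : ℕ} (h : BigCtx G B o) (hr : B r) (hO : SearchOrd G r ρ) (u : V)
    (hcard : (ownF G B o ρ u).card + 1 ≤ (n + 2) ^ 2) :
    ∃ p : V → Fin (n + 2) × Fin (n + 2), Good G B o ρ u p ∧
      ∀ x, Own G B o ρ u x → p x ≠ (0, 0) := by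
  classical
  have hct := card_tri h hr hO u
  set S := ownF G B o ρ u with hS
  have mS : ∀ x, x ∈ S ↔ Own G B o ρ u x := fun x => by simp [hS, ownF]
  obtain ⟨g, g1, g2⟩ := exists_inj (S.filter (fun x => ¬ G.Adj u (o x u)))
    ((Finset.univ : Finset (Fin (n + 2) × Fin (n + 2))).erase (0, 0)) (by
      rw [Finset.card_erase_of_mem (Finset.mem_univ _), card_pairs]; omega)
  obtain ⟨hh, i1, i2⟩ := exists_inj (S.filter (fun x => G.Adj u (o x u) ∧ ρ x < ρ (o x u)))
    (((Finset.univ : Finset (Fin (n + 2))).erase 0) ×ˢ ((Finset.univ : Finset (Fin (n + 2))).erase 0))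
    (by
      rw [Finset.card_product, Finset.card_erase_of_mem (Finset.mem_univ _), Finset.card_univ,
        Fintype.card_fin]
      simp only [show n + 2 - 1 = n + 1 by omega]
      by_contra hcon
      push Not at hcon
      have : 2 * ((n + 1) * (n + 1)) + 2 ≤ (n + 2) ^ 2 - 1 := by omega
      have h2 : 1 ≤ (n + 2) ^ 2 := Nat.one_le_pow _ _ (by omega)
      zify [h2] at this
      rcases Nat.eq_zero_or_pos n with rfl | hn
      · norm_num at this
      · nlinarith)
  have mT : ∀ x, Own G B o ρ u x → G.Adj u (o x u) → ρ x < ρ (o x u) →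
      x ∈ S.filter (fun x => G.Adj u (o x u) ∧ ρ x < ρ (o x u)) := fun x a b c => by
    simp [mS, a, b, c]
  have mN : ∀ x, Own G B o ρ u x → ¬ G.Adj u (o x u) →
      x ∈ S.filter (fun x => ¬ G.Adj u (o x u)) := fun x a b => by
    simp [mS, a, b]
  have i3 : ∀ x, Own G B o ρ u x → G.Adj u (o x u) → ρ x < ρ (o x u) →
      (hh x).1 ≠ 0 ∧ (hh x).2 ≠ 0 := fun x a b c => by
    have := i1 x (mT x a b c)
    simpa using this
  obtain ⟨p, p0, p1, p2, p3⟩ := good_combine h hr hO u g hh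
    (fun x y a b c d e => g2 (Finset.mem_coe.mpr (mN x a c)) (Finset.mem_coe.mpr (mN y b d)) e)
    (fun x a b c => (i3 x a b c).2)
    (fun x y a b c d e f k => i2 (Finset.mem_coe.mpr (mT x a b c))
      (Finset.mem_coe.mpr (mT y d e f)) k)
  refine ⟨p, p0, fun x hx => ?_⟩
  by_cases ha : G.Adj u (o x u)
  · by_cases hl : ρ x < ρ (o x u)
    · rw [p2 x ha hl]
      intro e
      exact (i3 x hx ha hl).1 (Prod.ext_iff.mp e).2
    · rw [p3 x ha hl]
      intro e
      obtain ⟨t1, t2⟩ := hx.tri h hr hO ha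
      refine (i3 (o x u) t1 (by rw [t2]; exact hx.2.1) ?_).2 (Prod.ext_iff.mp e).1
      rw [t2]
      refine lt_of_le_of_ne (not_lt.mp hl) (fun e => ?_)
      exact (h.adj x u (hx.small h) hx.2.1.symm).ne' (hO.inj e)
  · rw [p1 x ha]
    exact Finset.ne_of_mem_erase (g1 x (mN x hx ha))

/-- Labels at the root, in the presence of two adjacent small vertices. -/
lemma good_root {n : ℕ} (h : BigCtx G B o) (hr : B r) (hO : SearchOrd G r ρ)
    (hcard : (ownF G B o ρ r).card ≤ (n + 2) ^ 2) (x0 : V) (hx0 : Own G B o ρ r x0)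
    (hs0 : ¬ B (o x0 r)) :
    ∃ p : V → Fin (n + 2) × Fin (n + 2), Good G B o ρ r p ∧
      (∃ x, Own G B o ρ r x ∧ p x = (0, 0)) ∧
      ∀ x, Own G B o ρ r x → p x = (0, 0) → ¬ B (o x r) := by
  classical
  have hct := card_tri h hr hO r
  set S := ownF G B o ρ r with hS
  have mS : ∀ x, x ∈ S ↔ Own G B o ρ r x := fun x => by simp [hS, ownF]
  have mT : ∀ x, x ∈ S.filter (fun x => G.Adj r (o x r) ∧ ρ x < ρ (o x r)) ↔
      Own G B o ρ r x ∧ G.Adj r (o x r) ∧ ρ x < ρ (o x r) := fun x => by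
    simp [mS]
  have mN : ∀ x, x ∈ S.filter (fun x => ¬ G.Adj r (o x r)) ↔
      Own G B o ρ r x ∧ ¬ G.Adj r (o x r) := fun x => by
    simp [mS]
  have hcc : (S.filter (fun x => G.Adj r (o x r) ∧ ρ x < ρ (o x r))).card ≤
      ((Finset.univ : Finset (Fin (n + 2))) ×ˢ ((Finset.univ : Finset (Fin (n + 2))).erase 0)).card := by
    rw [Finset.card_product, Finset.card_erase_of_mem (Finset.mem_univ _), Finset.card_univ,
        Fintype.card_fin]
    simp only [show n + 2 - 1 = n + 1 by omega]
    nlinarith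
  by_cases hT : ∃ t, t ∈ S.filter (fun x => G.Adj r (o x r) ∧ ρ x < ρ (o x r))
  · obtain ⟨t, ht⟩ := hT
    have hpos := Finset.card_pos.mpr ⟨t, ht⟩
    obtain ⟨g, g1, g2⟩ := exists_inj (S.filter (fun x => ¬ G.Adj r (o x r)))
      ((Finset.univ : Finset (Fin (n + 2) × Fin (n + 2))).erase (0, 0)) (by
        rw [Finset.card_erase_of_mem (Finset.mem_univ _), card_pairs]; omega)
    obtain ⟨hh, i1, i2, i3⟩ := exists_inj_pt _ _ hcc t (0, 1) ht (by simp)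
    obtain ⟨p, p0, p1, p2, p3⟩ := good_combine h hr hO r g hh
      (fun x y a b c d e => g2 (Finset.mem_coe.mpr ((mN x).mpr ⟨a, c⟩))
        (Finset.mem_coe.mpr ((mN y).mpr ⟨b, d⟩)) e)
      (fun x a b c => by
        have := i1 x ((mT x).mpr ⟨a, b, c⟩)
        simpa using this)
      (fun x y a b c d e f k => i2 (Finset.mem_coe.mpr ((mT x).mpr ⟨a, b, c⟩))
        (Finset.mem_coe.mpr ((mT y).mpr ⟨d, e, f⟩)) k)
    have ht' := (mT t).mp ht
    refine ⟨p, p0, ⟨t, ht'.1, ?_⟩, fun x hx e => ?_⟩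
    · rw [p2 t ht'.2.1 ht'.2.2, i3]
    · by_cases ha : G.Adj r (o x r)
      · exact h.hB r _ ha hr
      · rw [p1 x ha] at e
        exact absurd e (Finset.ne_of_mem_erase (g1 x ((mN x).mpr ⟨hx, ha⟩)))
  · have hno : ∀ x, Own G B o ρ r x → ¬ G.Adj r (o x r) := by
      intro x hx ha
      by_cases hl : ρ x < ρ (o x r)
      · exact hT ⟨x, (mT x).mpr ⟨hx, ha, hl⟩⟩
      · obtain ⟨t1, t2⟩ := hx.tri h hr hO ha
        refine hT ⟨o x r, (mT _).mpr ⟨t1, by rw [t2]; exact hx.2.1, ?_⟩⟩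
        rw [t2]
        refine lt_of_le_of_ne (not_lt.mp hl) (fun e => ?_)
        exact (h.adj x r (hx.small h) hx.2.1.symm).ne' (hO.inj e)
    obtain ⟨g, g1, g2, g3⟩ := exists_inj_pt S
      (Finset.univ : Finset (Fin (n + 2) × Fin (n + 2))) (by
        rw [card_pairs]; omega) x0 (0, 0) ((mS _).mpr hx0) (Finset.mem_univ _)
    refine ⟨g, ⟨fun x hx ha => absurd ha (hno x hx), fun x y hx hy e _ _ =>
      g2 (Finset.mem_coe.mpr ((mS x).mpr hx)) (Finset.mem_coe.mpr ((mS y).mpr hy)) e⟩,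
      ⟨x0, hx0, g3⟩, fun x hx e => ?_⟩
    have : x = x0 := g2 (Finset.mem_coe.mpr ((mS x).mpr hx)) (Finset.mem_coe.mpr ((mS x0).mpr hx0))
      (by rw [e, g3])
    rw [this]; exact hs0

/-- Non-root big vertices do not own all of their neighbours. -/
lemma ownF_card_lt [DecidableRel G.Adj] (h : BigCtx G B o) (hr : B r) (hO : SearchOrd G r ρ)
    (u : V) (hu : u ≠ r) : (ownF G B o ρ u).card + 1 ≤ G.degree u := by
  classical
  by_cases hBu : B u
  · obtain ⟨x, hx, hl⟩ := hO.par u hu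
    rw [← G.card_neighborFinset_eq_degree]
    apply Finset.card_lt_card
    refine ⟨fun y hy => ?_, fun hsub => ?_⟩
    · simp only [ownF, Finset.mem_filter, Finset.mem_univ, true_and] at hy
      simpa using hy.2.1
    · have := hsub ((G.mem_neighborFinset u x).mpr hx)
      simp only [ownF, Finset.mem_filter, Finset.mem_univ, true_and] at this
      have := lt_of_lt_o h hr hO hBu hx this.2.2.1
      omega
  · have : ownF G B o ρ u = ∅ := by
      apply Finset.eq_empty_of_forall_notMem
      intro y hy
      simp only [ownF, Finset.mem_filter, Finset.mem_univ, true_and] at hy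
      exact hBu hy.1
    rw [this, Finset.card_empty]
    obtain ⟨x, hx, hl⟩ := hO.par u hu
    exact (G.degree_pos_iff_exists_adj u).mpr ⟨x, hx⟩

lemma ownF_card_le [DecidableRel G.Adj] (u : V) : (ownF G B o ρ u).card ≤ G.degree u := by
  classical
  rw [← G.card_neighborFinset_eq_degree]
  apply Finset.card_le_card
  intro y hy
  simp only [ownF, Finset.mem_filter, Finset.mem_univ, true_and] at hy
  simpa using hy.2.1

end Count

section Cases

variable {V : Type*} {G : SimpleGraph V} {B : V → Prop} {o : V → V → V} {ρ : V → ℕ} {r : V}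

lemma exists_closer (H : SimpleGraph V) {a w : V} (hr : H.Reachable a w) (hne : w ≠ a) :
    ∃ z, H.Adj w z ∧ H.dist a z < H.dist a w := by
  obtain ⟨p, hp⟩ := hr.symm.exists_walk_length_eq_dist
  cases p with
  | nil => exact absurd rfl hne
  | cons hadj q =>
    refine ⟨_, hadj, ?_⟩
    rw [SimpleGraph.dist_comm, SimpleGraph.dist_comm (u := a), ← hp, SimpleGraph.Walk.length_cons]
    have := SimpleGraph.dist_le q
    omega

lemma closed_eq_univ (hconn : G.Connected) (s : Set V) (a : V) (ha : a ∈ s)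
    (hs : ∀ x y, x ∈ s → G.Adj x y → y ∈ s) : ∀ x, x ∈ s := by
  intro x
  obtain ⟨p⟩ := hconn.preconnected a x
  induction p with
  | nil => exact ha
  | cons hadj q ih => exact ih (hs _ _ ha hadj)

lemma closed_reach {H : SimpleGraph V} (s : Set V) {a x : V} (hr : H.Reachable a x) (ha : a ∈ s)
    (hs : ∀ x y, x ∈ s → H.Adj x y → y ∈ s) : x ∈ s := by
  obtain ⟨p⟩ := hr
  induction p with
  | nil => exact ha
  | cons hadj q ih => exact ih (hs _ _ ha hadj)

lemma exists_order [Fintype V] (d : V → ℕ) (hmin : ∀ v, v ≠ r → d r < d v)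
    (hpar : ∀ v, v ≠ r → ∃ w, G.Adj v w ∧ d w < d v) :
    ∃ ρ : V → ℕ, SearchOrd G r ρ ∧ ∀ a b, d a < d b → ρ a < ρ b := by
  classical
  let e := Fintype.equivFin V
  let N := Fintype.card V
  have mono : ∀ a b, d a < d b → d a * N + (e a : ℕ) < d b * N + (e b : ℕ) := by
    intro a b hab
    have h1 : (e a : ℕ) < N := (e a).2
    have h2 : (d a + 1) * N ≤ d b * N := Nat.mul_le_mul_right _ hab
    rw [Nat.add_mul, one_mul] at h2
    omega
  refine ⟨fun x => d x * N + (e x : ℕ), ⟨?_, ?_, ?_⟩, mono⟩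
  · intro a b hab
    rcases lt_trichotomy (d a) (d b) with hl | hl | hl
    · have := mono a b hl
      simp only at hab
      omega
    · simp only [hl] at hab
      exact e.injective (Fin.ext (by omega))
    · have := mono b a hl
      simp only at hab
      omega
  · intro v
    by_cases hv : v = r
    · rw [hv]
    · exact (mono r v (hmin v hv)).le
  · intro v hv
    obtain ⟨w, hw, hl⟩ := hpar v hv
    exact ⟨w, hw, mono w v hl⟩

lemma BigCtx.map_o (h : BigCtx G B o) (φ : G ≃g G) (hφB : ∀ v, B (φ v) ↔ B v) {x u : V}
    (hx : ¬ B x) (ha : G.Adj x u) : o (φ x) (φ u) = φ (o x u) :=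
  h.o_eq (fun hh => hx ((hφB x).mp hh)) (φ.map_adj_iff.mpr ha)
    (φ.map_adj_iff.mpr (h.adj x u hx ha)) (fun e => h.ne x u hx ha (φ.injective e))

variable [Fintype V] [DecidableRel G.Adj]

/-- The case in which two small vertices are adjacent. -/
lemma case_one {n : ℕ} (h : BigCtx G B o) (hconn : G.Connected)
    (hB : ∀ (φ : G ≃g G) v, B (φ v) ↔ B v) (hdeg : ∀ v, G.degree v ≤ (n + 2) ^ 2)
    (r x0 : V) (hr : B r) (hx0 : G.Adj r x0) (hs0 : ¬ B (o x0 r)) :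
    ∃ f : Sym2 V → Fin (n + 2), ∀ φ : G ≃g G,
      (∀ a b, G.Adj a b → f s(φ a, φ b) = f s(a, b)) → ∀ v, φ v = v := by
  classical
  obtain ⟨ρ, hO, -⟩ := exists_order (G := G) (r := r) (fun v => G.dist r v)
    (fun v hv => by
      simp only [SimpleGraph.dist_self]
      exact (hconn.preconnected r v).pos_dist_of_ne hv.symm)
    (fun v hv => exists_closer G (hconn.preconnected r v) hv)
  obtain ⟨pr, pr1, ⟨x, hx, hx00⟩, pr3⟩ := good_root (n := n) h hr hO
    ((ownF_card_le r).trans (hdeg r)) x0 (own_root h hr hO hx0) hs0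
  have hnr : ∀ u, ∃ p : V → Fin (n + 2) × Fin (n + 2), u ≠ r → (Good G B o ρ u p ∧
      ∀ x, Own G B o ρ u x → p x ≠ (0, 0)) := by
    intro u
    by_cases hu : u = r
    · exact ⟨fun _ => (0, 0), fun e => absurd hu e⟩
    · obtain ⟨p, hp⟩ := good_nonroot (n := n) h hr hO u ((ownF_card_lt h hr hO u hu).trans (hdeg u))
      exact ⟨p, fun _ => hp⟩
  choose Q hQ using hnr
  let P : V → V → Fin (n + 2) × Fin (n + 2) := fun u => if u = r then pr else Q u
  have Pr : P r = pr := by simp [P]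
  have Pn : ∀ u, u ≠ r → P u = Q u := fun u hu => by simp [P, hu]
  have hgood : ∀ u, Good G B o ρ u (P u) := by
    intro u
    by_cases hu : u = r
    · rw [hu, Pr]; exact pr1
    · rw [Pn u hu]; exact (hQ u hu).1
  have hzero : ∀ u x, Own G B o ρ u x → P u x = (0, 0) → u = r := by
    intro u x hx e
    by_contra hu
    rw [Pn u hu] at e
    exact (hQ u hu).2 x hx e
  obtain ⟨f, f1, f2, f3, f4⟩ := main_label h hr hO P (fun u => (hgood u).1) (fun u => (hgood u).2)
  refine ⟨f, fun φ hφ => f4 φ hφ ?_⟩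
  have hxs := hx.small h
  have hmo := h.map_o φ (hB φ) hxs hx.2.1.symm
  have hadj := h.adj x r hxs hx.2.1.symm
  rcases zero_pair h P f f1 f2 f3 (w := φ r) (x := φ x) (c := 0) ((hB φ r).mpr hr)
    (φ.map_adj_iff.mpr hx.2.1) (by rw [hφ _ _ hx.2.1, f1 _ _ hx, Pr, hx00])
    (by rw [hmo, hφ _ _ hadj, f2 _ _ hx, Pr, hx00]) with ⟨h1, h2⟩ | ⟨u, h1, h2, h3⟩
  · exact hzero _ _ h1 h2
  · have hu := hzero _ _ h1 h3
    subst hu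
    rw [Pr] at h3
    exact absurd ((hB φ u).mpr hr) (h2 ▸ pr3 _ h1 h3)

lemma exists_inj_pt2 {W β : Type*} [Nonempty β] (S : Finset W) (Q : Finset β)
    (hc : S.card ≤ Q.card) (x0 x1 : W) (q0 q1 : β) (hx0 : x0 ∈ S) (hx1 : x1 ∈ S) (hx : x0 ≠ x1)
    (hq0 : q0 ∈ Q) (hq1 : q1 ∈ Q) (hq : q0 ≠ q1) :
    ∃ g : W → β, (∀ x ∈ S, g x ∈ Q) ∧ Set.InjOn g S ∧ g x0 = q0 ∧ g x1 = q1 := by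
  classical
  obtain ⟨g, g1, g2, g3⟩ := exists_inj_pt S Q hc x0 q0 hx0 hq0
  refine ⟨fun x => Equiv.swap (g x1) q1 (g x), ?_, ?_, ?_, ?_⟩
  · intro x hx
    simp only [Equiv.swap_apply_def]
    split_ifs
    · exact hq1
    · exact g1 _ hx1
    · exact g1 _ hx
  · intro x hx y hy hxy
    exact g2 hx hy ((Equiv.swap (g x1) q1).injective hxy)
  · simp only
    rw [g3]
    apply Equiv.swap_apply_of_ne_of_ne _ hq
    intro e
    exact hx (g2 (Finset.mem_coe.mpr hx0) (Finset.mem_coe.mpr hx1) (by rw [g3, e]))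
  · simp

/-- A graph consisting of two poles and common neighbours is complete bipartite. -/
lemma iso_bip {N : ℕ} (r v : V) (hrv : r ≠ v) (hnrv : ¬ G.Adj r v)
    (hS : ∀ x, x ≠ r → x ≠ v → G.Adj r x ∧ G.Adj v x ∧ ∀ y, G.Adj x y → y = r ∨ y = v)
    (hN : G.degree r = N) :
    Nonempty (G ≃g completeBipartiteGraph (Fin 2) (Fin N)) := by
  classical
  have hc : (G.neighborFinset r).card = N := by rw [G.card_neighborFinset_eq_degree, hN]
  let e : Fin N ≃ G.neighborFinset r := ((G.neighborFinset r).equivFinOfCardEq hc).symm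
  have he : ∀ i, G.Adj r (e i) := fun i => (G.mem_neighborFinset r _).mp (e i).2
  have her : ∀ i, (e i : V) ≠ r := fun i => (he i).ne'
  have hev : ∀ i, (e i : V) ≠ v := fun i hh => hnrv (hh ▸ he i)
  let m : Fin 2 ⊕ Fin N → V := Sum.elim ![r, v] (fun i => (e i : V))
  have hm : Function.Bijective m := by
    constructor
    · rintro (i | i) (j | j) hij
      · fin_cases i <;> fin_cases j <;> simp [m, hrv, hrv.symm] at hij ⊢
      · fin_cases i
        · exact absurd hij.symm (her j)
        · exact absurd hij.symm (hev j)
      · fin_cases j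
        · exact absurd hij (her i)
        · exact absurd hij (hev i)
      · simp only [m, Sum.elim_inr] at hij
        rw [e.injective (Subtype.ext hij)]
    · intro x
      by_cases h1 : x = r
      · exact ⟨Sum.inl 0, by simp [m, h1]⟩
      by_cases h2 : x = v
      · exact ⟨Sum.inl 1, by simp [m, h2]⟩
      refine ⟨Sum.inr (e.symm ⟨x, (G.mem_neighborFinset r x).mpr (hS x h1 h2).1⟩), by simp [m]⟩
  refine ⟨RelIso.symm ⟨Equiv.ofBijective m hm, ?_⟩⟩
  have e1 : ∀ i, G.Adj v (e i) := fun i => (hS _ (her i) (hev i)).2.1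
  have e2 : ∀ i j, ¬ G.Adj (e i : V) (e j) := fun i j hij => by
    rcases (hS _ (her i) (hev i)).2.2 _ hij with hh | hh
    · exact her j hh
    · exact hev j hh
  rintro (i | i) (j | j)
  · fin_cases i <;> fin_cases j <;> simp [m, hnrv, G.adj_comm v r]
  · fin_cases i <;> simp [m, he, e1]
  · fin_cases j <;> simp [m, (he _).symm, (e1 _).symm]
  · simp [m, e2]

end Cases

section CaseTwo

variable {V : Type*} {G : SimpleGraph V} {B : V → Prop} {o : V → V → V} {ρ : V → ℕ} {r : V}

/-- `G` with the vertex `v` isolated. -/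
def isolate (G : SimpleGraph V) (v : V) : SimpleGraph V where
  Adj a b := G.Adj a b ∧ a ≠ v ∧ b ≠ v
  symm := ⟨fun _ _ h => ⟨h.1.symm, h.2.2, h.2.1⟩⟩
  loopless := ⟨fun a h => G.loopless.irrefl a h.1⟩

variable [Fintype V] [DecidableRel G.Adj]

/-- Choice of a non-separating big vertex. -/
lemma exists_last (h : BigCtx G B o) (hconn : G.Connected)
    (hns : ∀ a b, G.Adj a b → ¬ B a → B b) (hdeg3 : ∀ u, B u → 3 ≤ G.degree u)
    (r0 : V) (hr0 : B r0) :
    ∃ v, B v ∧ ∀ a b, a ≠ v → b ≠ v → (isolate G v).Reachable a b := by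
  classical
  obtain ⟨v, hv, hmax⟩ := Finset.exists_max_image (Finset.univ.filter B) (fun w => G.dist r0 w)
    ⟨r0, by simpa using hr0⟩
  simp only [Finset.mem_filter, Finset.mem_univ, true_and] at hv hmax
  have hne : r0 ≠ v := by
    rintro rfl
    have h3 := hdeg3 r0 hr0
    obtain ⟨x, hx⟩ := (G.degree_pos_iff_exists_adj r0).mp (by omega)
    have hxs := h.hB _ _ hx hr0
    have := hmax (o x r0) (hns x _ (h.adj x r0 hxs hx.symm) hxs)
    rw [SimpleGraph.dist_self] at this
    have h4 := (hconn.preconnected r0 (o x r0)).pos_dist_of_ne (h.ne x r0 hxs hx.symm).symm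
    omega
  have key : ∀ m w, G.dist r0 w = m → w ≠ v → (isolate G v).Reachable r0 w := by
    intro m
    induction m using Nat.strong_induction_on with
    | _ m ih =>
    intro w hm hw
    subst hm
    by_cases e : w = r0
    · rw [e]
    · obtain ⟨z, hz, hl⟩ := exists_closer G (hconn.preconnected r0 w) e
      by_cases hzv : z = v
      · subst hzv
        have hws := h.hB _ _ hz.symm hv
        have ha := h.adj w z hws hz
        have hn := h.ne w z hws hz
        have hle := hmax _ (hns w _ ha hws)
        exact (ih _ (lt_of_le_of_lt hle hl) _ rfl hn).trans
          (SimpleGraph.Adj.reachable (G := isolate G z) ⟨ha.symm, hn, hw⟩)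
      · exact (ih _ hl z rfl hzv).trans
          (SimpleGraph.Adj.reachable (G := isolate G v) ⟨hz.symm, hzv, hw⟩)
  exact ⟨v, hv, fun a b ha hb => (key _ a rfl ha).symm.trans (key _ b rfl hb)⟩

/-- The case in which no two small vertices are adjacent. -/
lemma case_two {n : ℕ} (h : BigCtx G B o) (hconn : G.Connected)
    (hB : ∀ (φ : G ≃g G) v, B (φ v) ↔ B v) (hdeg : ∀ v, G.degree v ≤ (n + 2) ^ 2)
    (hdeg3 : ∀ u, B u → 3 ≤ G.degree u)
    (hns : ∀ a b, G.Adj a b → ¬ B a → B b)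
    (hbip : ¬ Nonempty (G ≃g completeBipartiteGraph (Fin 2) (Fin ((n + 2) ^ 2))))
    (r0 : V) (hr0 : B r0) :
    ∃ f : Sym2 V → Fin (n + 2), ∀ φ : G ≃g G,
      (∀ a b, G.Adj a b → f s(φ a, φ b) = f s(a, b)) → ∀ v, φ v = v := by
  classical
  obtain ⟨v, hv, hreach⟩ := exists_last h hconn hns hdeg3 r0 hr0
  have hk4 : 4 ≤ (n + 2) ^ 2 :=
    Nat.pow_le_pow_left (show 2 ≤ n + 2 by omega) 2
  let D : V → Finset V := fun u => G.neighborFinset u ∩ G.neighborFinset v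
  have mD : ∀ u x, x ∈ D u ↔ G.Adj u x ∧ G.Adj v x := fun u x => by simp [D]
  -- a big neighbour of `v`
  obtain ⟨xv, hxv⟩ := (G.degree_pos_iff_exists_adj v).mp (by have := hdeg3 v hv; omega)
  have hxvs := h.hB _ _ hxv hv
  have hw0a := h.adj xv v hxvs hxv.symm
  have hw0n := h.ne xv v hxvs hxv.symm
  obtain ⟨r, hr, hmax⟩ := Finset.exists_max_image (Finset.univ.filter (fun w => B w ∧ w ≠ v))
    (fun w => (D w).card) ⟨o xv v, by simpa using ⟨hns _ _ hw0a hxvs, hw0n⟩⟩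
  simp only [Finset.mem_filter, Finset.mem_univ, true_and] at hr hmax
  obtain ⟨hr, hrv⟩ := hr
  have hDr : 0 < (D r).card := lt_of_lt_of_le
    (Finset.card_pos.mpr ⟨xv, (mD _ _).mpr ⟨hw0a.symm, hxv⟩⟩)
    (hmax (o xv v) ⟨hns _ _ hw0a hxvs, hw0n⟩)
  obtain ⟨x0, hx0⟩ := Finset.card_pos.mp hDr
  obtain ⟨hx0r, hx0v⟩ := (mD _ _).mp hx0
  -- the order
  let M := Finset.univ.sup (fun w => (isolate G v).dist r w)
  have hM : ∀ w, (isolate G v).dist r w ≤ M := fun w =>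
    Finset.le_sup (f := fun w => (isolate G v).dist r w) (Finset.mem_univ w)
  let d : V → ℕ := fun w => if w = v then M + 1 else (isolate G v).dist r w
  have dv : d v = M + 1 := by simp [d]
  have dn : ∀ w, w ≠ v → d w = (isolate G v).dist r w := fun w hw => by simp [d, hw]
  obtain ⟨ρ, hO, hlast⟩ := exists_order (G := G) (r := r) d
    (fun w hw => by
      rw [dn r hrv, SimpleGraph.dist_self]
      by_cases hwv : w = v
      · rw [hwv, dv]; omega
      · rw [dn w hwv]
        exact (hreach r w hrv hwv).pos_dist_of_ne hw.symm)
    (fun w hw => by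
      by_cases hwv : w = v
      · subst hwv
        refine ⟨xv, hxv, ?_⟩
        rw [dv, dn xv hxv.ne']
        have := hM xv
        omega
      · obtain ⟨z, hz, hl⟩ := exists_closer _ (hreach r w hrv hwv) hw
        refine ⟨z, hz.1, ?_⟩
        rw [dn w hwv, dn z hz.2.2]
        exact hl)
  have hlt : ∀ w, w ≠ v → ρ w < ρ v := fun w hw => hlast w v (by
    rw [dv, dn w hw]
    have := hM w
    omega)
  have hoB : ∀ x u, ¬ B x → G.Adj x u → B (o x u) := fun x u hx ha =>
    hns x _ (h.adj x u hx ha) hx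
  have notri : ∀ u x, Own G B o ρ u x → ¬ G.Adj u (o x u) := fun u x hx ha =>
    h.hB _ _ ha hx.1 (hoB x u (hx.small h) hx.2.1.symm)
  have ownv : ∀ x, ¬ Own G B o ρ v x := fun x hx => by
    have h1 := hx.2.2.1
    have h2 := hlt _ (h.ne x v (hx.small h) hx.2.1.symm)
    omega
  have mS : ∀ u x, x ∈ ownF G B o ρ u ↔ Own G B o ρ u x := fun u x => by simp [ownF]
  -- labels at the root
  have hroot : ∃ (q : Fin (n + 2) × Fin (n + 2)) (g : V → Fin (n + 2) × Fin (n + 2)),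
      q.swap ≠ (0, 0) ∧ Set.InjOn g (ownF G B o ρ r) ∧ g x0 = (0, 0) ∧
      (∃ x1, Own G B o ρ r x1 ∧ g x1 = q) ∧
      ∀ x, Own G B o ρ r x → G.Adj v x → g x ≠ q.swap := by
    have ox0 : x0 ∈ ownF G B o ρ r := (mS _ _).mpr (own_root h hr hO hx0r)
    by_cases hA : ∃ x1, G.Adj r x1 ∧ ¬ G.Adj v x1
    · obtain ⟨x1, hx1, hx1v⟩ := hA
      have ox1 : x1 ∈ ownF G B o ρ r := (mS _ _).mpr (own_root h hr hO hx1)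
      obtain ⟨g, -, g2, g3, g4⟩ := exists_inj_pt2 (ownF G B o ρ r)
        (Finset.univ : Finset (Fin (n + 2) × Fin (n + 2)))
        (by rw [card_pairs]; exact (ownF_card_le r).trans (hdeg r)) x0 x1 (0, 0) (1, 1) ox0 ox1
        (fun e => hx1v (e ▸ hx0v)) (Finset.mem_univ _) (Finset.mem_univ _) (by simp)
      refine ⟨(1, 1), g, by simp, g2, g3, ⟨x1, (mS _ _).mp ox1, g4⟩, fun x hx hxv e => ?_⟩
      have : x = x1 := g2 (Finset.mem_coe.mpr ((mS _ _).mpr hx)) (Finset.mem_coe.mpr ox1)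
        (by rw [e, g4]; rfl)
      exact hx1v (this ▸ hxv)
    · push Not at hA
      have hnrv : ¬ G.Adj r v := fun ha => h.hB _ _ ha hr hv
      have hall : ∀ x, x ≠ v → x = r ∨ G.Adj r x := by
        intro x hx
        refine closed_reach (H := isolate G v) {x | x = r ∨ G.Adj r x} (hreach r x hrv hx)
          (Or.inl rfl) ?_
        rintro a b (rfl | ha) hab
        · exact Or.inr hab.1
        · have has := h.hB _ _ ha hr
          have : o a r = v := h.o_eq has ha.symm (hA a ha).symm hrv.symm
          rcases h.cases a r b has ha.symm hab.1 with e | e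
          · exact Or.inl e
          · exact absurd (e.trans this) hab.2.2
      have hcard : G.degree r ≠ (n + 2) ^ 2 := by
        intro hN
        apply hbip
        refine iso_bip r v hrv hnrv (fun x h1 h2 => ?_) hN
        have hx := (hall x h2).resolve_left h1
        have hxs := h.hB _ _ hx hr
        refine ⟨hx, hA x hx, fun y hy => ?_⟩
        rcases h.cases x r y hxs hx.symm hy with e | e
        · exact Or.inl e
        · exact Or.inr (e.trans (h.o_eq hxs hx.symm (hA x hx).symm hrv.symm))
      have hdr := hdeg r
      obtain ⟨x1, hx1, hne⟩ : ∃ x1, x1 ∈ G.neighborFinset r ∧ x1 ≠ x0 := by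
        apply Finset.exists_mem_ne
        rw [G.card_neighborFinset_eq_degree]
        have := hdeg3 r hr
        omega
      have ox1 : x1 ∈ ownF G B o ρ r :=
        (mS _ _).mpr (own_root h hr hO ((G.mem_neighborFinset _ _).mp hx1))
      obtain ⟨g, g1, g2, g3, g4⟩ := exists_inj_pt2 (ownF G B o ρ r)
        ((Finset.univ : Finset (Fin (n + 2) × Fin (n + 2))).erase (1, 0))
        (by
          rw [Finset.card_erase_of_mem (Finset.mem_univ _), card_pairs]
          have := ownF_card_le (G := G) (B := B) (o := o) (ρ := ρ) r
          omega) x0 x1 (0, 0) (0, 1) ox0 ox1 hne.symm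
        (by simp) (by simp) (by simp)
      refine ⟨(0, 1), g, by simp, g2, g3, ⟨x1, (mS _ _).mp ox1, g4⟩, fun x hx _ => ?_⟩
      exact Finset.ne_of_mem_erase (g1 x ((mS _ _).mpr hx))
  obtain ⟨q, pr, hq, pr1, pr2, ⟨x1, ox1, pr3⟩, pr4⟩ := hroot
  -- labels elsewhere
  have hnr : ∀ u, ∃ p : V → Fin (n + 2) × Fin (n + 2), u ≠ r →
      (Set.InjOn p (ownF G B o ρ u) ∧ (∀ x, Own G B o ρ u x → p x ≠ (0, 0)) ∧
        ∀ x, Own G B o ρ u x → G.Adj v x → p x ≠ q.swap) := by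
    intro u
    by_cases hu : u = r
    · exact ⟨fun _ => (0, 0), fun e => absurd hu e⟩
    have hcard := (ownF_card_lt h hr hO u hu).trans (hdeg u)
    have hqm : q.swap ∈ (Finset.univ : Finset (Fin (n + 2) × Fin (n + 2))).erase (0, 0) := by
      simpa using hq
    by_cases hy : ∃ y, Own G B o ρ u y ∧ ¬ G.Adj v y
    · obtain ⟨y, oy, hyv⟩ := hy
      obtain ⟨p, p1, p2, p3⟩ := exists_inj_pt (ownF G B o ρ u)
        ((Finset.univ : Finset (Fin (n + 2) × Fin (n + 2))).erase (0, 0))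
        (by rw [Finset.card_erase_of_mem (Finset.mem_univ _), card_pairs]; omega)
        y q.swap ((mS _ _).mpr oy) hqm
      refine ⟨p, fun _ => ⟨p2, fun x hx => Finset.ne_of_mem_erase (p1 x ((mS _ _).mpr hx)),
        fun x hx hxv e => hyv ?_⟩⟩
      have : x = y := p2 (Finset.mem_coe.mpr ((mS _ _).mpr hx))
        (Finset.mem_coe.mpr ((mS _ _).mpr oy)) (by rw [e, p3])
      exact this ▸ hxv
    · push Not at hy
      have hc2 : (ownF G B o ρ u).card + 2 ≤ (n + 2) ^ 2 := by
        by_cases huv : u = v ∨ ¬ B u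
        · have : ownF G B o ρ u = ∅ := by
            apply Finset.eq_empty_of_forall_notMem
            intro z hz
            rw [mS] at hz
            rcases huv with rfl | huv
            · exact ownv z hz
            · exact huv hz.1
          rw [this, Finset.card_empty]; omega
        · push Not at huv
          have hsub : ownF G B o ρ u ⊆ D u := fun x hx => by
            rw [mS] at hx
            exact (mD _ _).mpr ⟨hx.2.1, hy x hx⟩
          have h1 := Finset.card_le_card hsub
          have h2 := hmax u ⟨huv.2, huv.1⟩
          have hdis : Disjoint (D u) (D r) := by
            rw [Finset.disjoint_left]
            intro x hxu hxr
            rw [mD] at hxu hxr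
            have hxs := h.hB _ _ hxr.1 hr
            have e1 := h.o_eq hxs hxr.1.symm hxr.2.symm hrv.symm
            have e2 := h.o_eq hxs hxr.1.symm hxu.1.symm hu
            exact huv.1 (e2.symm.trans e1)
          have h3 : (D u ∪ D r).card ≤ (G.neighborFinset v).card := by
            apply Finset.card_le_card
            intro x hx
            rw [Finset.mem_union, mD, mD] at hx
            rw [G.mem_neighborFinset]
            rcases hx with hx | hx
            · exact hx.2
            · exact hx.2
          rw [Finset.card_union_of_disjoint hdis, G.card_neighborFinset_eq_degree] at h3
          have h4 := hdeg v
          omega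
      obtain ⟨p, p1, p2⟩ := exists_inj (ownF G B o ρ u)
        (((Finset.univ : Finset (Fin (n + 2) × Fin (n + 2))).erase (0, 0)).erase q.swap)
        (by
          rw [Finset.card_erase_of_mem hqm, Finset.card_erase_of_mem (Finset.mem_univ _),
            card_pairs]
          omega)
      refine ⟨p, fun _ => ⟨p2, fun x hx => ?_, fun x hx _ => ?_⟩⟩
      · have := p1 x ((mS _ _).mpr hx)
        exact Finset.ne_of_mem_erase (Finset.mem_of_mem_erase this)
      · exact Finset.ne_of_mem_erase (p1 x ((mS _ _).mpr hx))
  choose Q hQ using hnr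
  let P : V → V → Fin (n + 2) × Fin (n + 2) := fun u => if u = r then pr else Q u
  have Pr : P r = pr := by simp [P]
  have Pn : ∀ u, u ≠ r → P u = Q u := fun u hu => by simp [P, hu]
  have hinj : ∀ u, Set.InjOn (P u) (ownF G B o ρ u) := by
    intro u
    by_cases hu : u = r
    · rw [hu, Pr]; exact pr1
    · rw [Pn u hu]; exact (hQ u hu).1
  have hzero : ∀ u x, Own G B o ρ u x → P u x = (0, 0) → u = r := by
    intro u x hx e
    by_contra hu
    rw [Pn u hu] at e
    exact (hQ u hu).2.1 x hx e
  have hswap : ∀ u x, Own G B o ρ u x → G.Adj v x → P u x ≠ q.swap := by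
    intro u x hx hxv
    by_cases hu : u = r
    · subst hu; rw [Pr]; exact pr4 x hx hxv
    · rw [Pn u hu]; exact (hQ u hu).2.2 x hx hxv
  obtain ⟨f, f1, f2, f3, f4⟩ := main_label h hr hO P
    (fun u x hx ha => absurd ha (notri u x hx))
    (fun u x y hx hy e _ _ => hinj u (Finset.mem_coe.mpr ((mS _ _).mpr hx))
      (Finset.mem_coe.mpr ((mS _ _).mpr hy)) e)
  refine ⟨f, fun φ hφ => f4 φ hφ ?_⟩
  have hx := own_root h hr hO hx0r
  have hxs := hx.small h
  have hmo := h.map_o φ (hB φ) hxs hx.2.1.symm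
  have hadj := h.adj x0 r hxs hx.2.1.symm
  rcases zero_pair h P f f1 f2 f3 (w := φ r) (x := φ x0) (c := 0) ((hB φ r).mpr hr)
    (φ.map_adj_iff.mpr hx.2.1) (by rw [hφ _ _ hx.2.1, f1 _ _ hx, Pr, pr2])
    (by rw [hmo, hφ _ _ hadj, f2 _ _ hx, Pr, pr2]) with ⟨h1, h2⟩ | ⟨u, h1, h2, h3⟩
  · exact hzero _ _ h1 h2
  · exfalso
    have hu := hzero _ _ h1 h3
    rw [hu] at h1 h2 h3
    rw [Pr] at h3
    have e0 : φ x0 = x0 := pr1 (Finset.mem_coe.mpr ((mS _ _).mpr h1))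
      (Finset.mem_coe.mpr ((mS _ _).mpr hx)) (by rw [h3, pr2])
    have ev : φ r = v := by
      rw [← h2, e0]
      exact h.o_eq hxs hx0r.symm hx0v.symm hrv.symm
    -- look at `x1`
    have x1s := ox1.small h
    have y1 : G.Adj v (φ x1) := by
      have := φ.map_adj_iff.mpr ox1.2.1
      rwa [ev] at this
    have ys := h.hB _ _ y1 hv
    have yo : o (φ x1) v = φ (o x1 r) := by
      rw [← ev]; exact h.map_o φ (hB φ) x1s ox1.2.1.symm
    have c1 : f s(v, φ x1) = q.1 := by
      rw [← ev, hφ _ _ ox1.2.1, f1 _ _ ox1, Pr, pr3]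
    have c2 : f s(φ x1, o (φ x1) v) = q.2 := by
      rw [yo, hφ _ _ (h.adj _ _ x1s ox1.2.1.symm), f2 _ _ ox1, Pr, pr3]
    have hn := h.ne _ _ ys y1.symm
    have ha := h.adj _ _ ys y1.symm
    have hoo := h.oo ys y1.symm
    have own : Own G B o ρ (o (φ x1) v) (φ x1) := by
      refine ⟨hoB _ _ ys y1.symm, ha.symm, ?_, ?_⟩
      · rw [hoo]; exact hlt _ hn
      · rw [hoo]; exact fun hh => absurd hv hh
    apply hswap _ _ own y1
    refine Prod.ext ?_ ?_
    · rw [← f1 _ _ own, Sym2.eq_swap, c2]; rfl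
    · rw [← f2 _ _ own, hoo, Sym2.eq_swap, c1]; rfl

end CaseTwo

section Cycle

variable {V : Type*} {G : SimpleGraph V} {o : V → V → V}

set_option maxHeartbeats 4000000 in
/-- The cycle case. -/
lemma case_cycle (h : BigCtx G (fun _ => False) o) (hconn : G.Connected)
    (hne : ∃ a b, G.Adj a b)
    (hcyc : ¬∃ m : ℕ, 3 ≤ m ∧ m ≤ 5 ∧ Nonempty (G ≃g SimpleGraph.cycleGraph m)) :
    ∃ f : Sym2 V → Fin 2, ∀ φ : G ≃g G,
      (∀ a b, G.Adj a b → f s(φ a, φ b) = f s(a, b)) → ∀ v, φ v = v := by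
  classical
  obtain ⟨v0, v1, a01⟩ := hne
  have nxt : ∀ a b, G.Adj a b → ∃ c, G.Adj b c ∧ c ≠ a ∧ ∀ z, G.Adj b z → z = a ∨ z = c :=
    fun a b hab => ⟨o b a, h.adj b a id hab.symm, h.ne b a id hab.symm,
      fun z hz => h.cases b a z id hab.symm hz⟩
  obtain ⟨v2, a12, n20, c1⟩ := nxt v0 v1 a01
  obtain ⟨v3, a23, n31, c2⟩ := nxt v1 v2 a12
  obtain ⟨v4, a34, n42, c3⟩ := nxt v2 v3 a23
  obtain ⟨v5, a45, n53, c4⟩ := nxt v3 v4 a34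
  obtain ⟨w, b0w, nw1, c0⟩ := nxt v1 v0 a01.symm
  have n01 := a01.ne
  have n12 := a12.ne
  have n23 := a23.ne
  have n34 := a34.ne
  have n45 := a45.ne
  -- transfer to the small cycles
  have mk : ∀ (m : ℕ) (g : Fin m → V), 3 ≤ m → m ≤ 5 → Function.Bijective g →
      (∀ i j, G.Adj (g i) (g j) ↔ (SimpleGraph.cycleGraph m).Adj i j) → False := by
    intro m g h3 h5 hg hadj
    exact hcyc ⟨m, h3, h5, ⟨RelIso.symm ⟨Equiv.ofBijective g hg, fun {i j} => hadj i j⟩⟩⟩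
  have n30 : v3 ≠ v0 := by
    rintro rfl
    have hall := closed_eq_univ hconn {x | x = v3 ∨ x = v1 ∨ x = v2} v1 (by simp) (by
      rintro x y (rfl | rfl | rfl) hxy
      · have e := c0 y hxy; have e2 := c0 v2 a23.symm; grind
      · have e := c1 y hxy; grind
      · have e := c2 y hxy; grind)
    refine mk 3 ![v3, v1, v2] (by norm_num) (by norm_num) ⟨?_, ?_⟩ ?_
    · intro i j hij
      fin_cases i <;> fin_cases j <;> simp_all
    · intro x
      rcases hall x with rfl | rfl | rfl
      · exact ⟨0, rfl⟩
      · exact ⟨1, rfl⟩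
      · exact ⟨2, rfl⟩
    · intro i j
      fin_cases i <;> fin_cases j <;>
        simp [SimpleGraph.cycleGraph_adj, a01, a12, a23, a01.symm, a12.symm, a23.symm] <;> decide
  have n40 : v4 ≠ v0 := by
    rintro rfl
    have hall := closed_eq_univ hconn {x | x = v4 ∨ x = v1 ∨ x = v2 ∨ x = v3} v1 (by simp) (by
      rintro x y (rfl | rfl | rfl | rfl) hxy
      · have e := c0 y hxy; have e2 := c0 v3 a34.symm; grind
      · have e := c1 y hxy; grind
      · have e := c2 y hxy; grind
      · have e := c3 y hxy; grind)
    have x02 : ¬ G.Adj v4 v2 := fun hh => by have := c2 v4 hh.symm; grind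
    have x13 : ¬ G.Adj v1 v3 := fun hh => by have := c1 v3 hh; grind
    refine mk 4 ![v4, v1, v2, v3] (by norm_num) (by norm_num) ⟨?_, ?_⟩ ?_
    · intro i j hij
      fin_cases i <;> fin_cases j <;> simp_all
    · intro x
      rcases hall x with rfl | rfl | rfl | rfl
      · exact ⟨0, rfl⟩
      · exact ⟨1, rfl⟩
      · exact ⟨2, rfl⟩
      · exact ⟨3, rfl⟩
    · intro i j
      fin_cases i <;> fin_cases j <;>
        simp [SimpleGraph.cycleGraph_adj, a01, a12, a23, a34, a01.symm, a12.symm, a23.symm,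
          a34.symm, x02, x13, G.adj_comm v2 v4, G.adj_comm v3 v1] <;> decide
  have n41 : v4 ≠ v1 := by
    rintro rfl
    have := c1 v3 a34.symm
    grind
  have n50 : v5 ≠ v0 := by
    rintro rfl
    have hall := closed_eq_univ hconn {x | x = v5 ∨ x = v1 ∨ x = v2 ∨ x = v3 ∨ x = v4} v1
      (by simp) (by
      rintro x y (rfl | rfl | rfl | rfl | rfl) hxy
      · have e := c0 y hxy; have e2 := c0 v4 a45.symm; grind
      · have e := c1 y hxy; grind
      · have e := c2 y hxy; grind
      · have e := c3 y hxy; grind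
      · have e := c4 y hxy; grind)
    have x02 : ¬ G.Adj v5 v2 := fun hh => by have := c2 v5 hh.symm; grind
    have x03 : ¬ G.Adj v5 v3 := fun hh => by have := c3 v5 hh.symm; grind
    have x13 : ¬ G.Adj v1 v3 := fun hh => by have := c1 v3 hh; grind
    have x14 : ¬ G.Adj v1 v4 := fun hh => by have := c1 v4 hh; grind
    have x24 : ¬ G.Adj v2 v4 := fun hh => by have := c2 v4 hh; grind
    refine mk 5 ![v5, v1, v2, v3, v4] (by norm_num) (by norm_num) ⟨?_, ?_⟩ ?_
    · intro i j hij
      fin_cases i <;> fin_cases j <;> simp_all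
    · intro x
      rcases hall x with rfl | rfl | rfl | rfl | rfl
      · exact ⟨0, rfl⟩
      · exact ⟨1, rfl⟩
      · exact ⟨2, rfl⟩
      · exact ⟨3, rfl⟩
      · exact ⟨4, rfl⟩
    · intro i j
      fin_cases i <;> fin_cases j <;>
        simp [SimpleGraph.cycleGraph_adj, a01, a12, a23, a34, a45, a01.symm, a12.symm, a23.symm,
          a34.symm, a45.symm, x02, x03, x13, x14, x24, G.adj_comm v2 v5, G.adj_comm v3 v5,
          G.adj_comm v3 v1, G.adj_comm v4 v1, G.adj_comm v4 v2] <;> decide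
  -- long cycles
  let f : Sym2 V → Fin 2 := fun e => if e = s(v0, v1) ∨ e = s(v1, v2) ∨ e = s(v3, v4) then 0 else 1
  have f0 : ∀ e, f e = 0 ↔ (e = s(v0, v1) ∨ e = s(v1, v2) ∨ e = s(v3, v4)) := by
    intro e
    simp only [f]
    split_ifs with hh
    · simp [hh]
    · simp [hh]
  refine ⟨f, fun φ hφ => ?_⟩
  have inj := φ.injective
  have z1 := (f0 _).mp ((hφ v0 v1 a01).trans ((f0 _).mpr (Or.inl rfl)))
  have z2 := (f0 _).mp ((hφ v1 v2 a12).trans ((f0 _).mpr (Or.inr (Or.inl rfl))))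
  have z3 := (f0 _).mp ((hφ v3 v4 a34).trans ((f0 _).mpr (Or.inr (Or.inr rfl))))
  simp only [Sym2.eq_iff] at z1 z2 z3
  have m02 : φ v0 ≠ φ v2 := fun e => n20 (inj e).symm
  have m01 : φ v0 ≠ φ v1 := fun e => n01 (inj e)
  have m12 : φ v1 ≠ φ v2 := fun e => n12 (inj e)
  have m31 : φ v3 ≠ φ v1 := fun e => n31 (inj e)
  have m30 : φ v3 ≠ φ v0 := fun e => n30 (inj e)
  have m32 : φ v2 ≠ φ v3 := fun e => n23 (inj e)
  have e1 : φ v1 = v1 := by grind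
  have e2 : φ v2 = v2 := by
    by_contra hcon
    have e2 : φ v2 = v0 := by grind
    have e0 : φ v0 = v2 := by grind
    have a : G.Adj v0 (φ v3) := by
      have := φ.map_adj_iff.mpr a23
      rwa [e2] at this
    have : φ v3 = v3 ∨ φ v3 = v4 := by grind
    rcases this with e | e
    · rw [e] at a
      have := c3 v0 a.symm
      grind
    · rw [e] at a
      have := c4 v0 a.symm
      grind
  have hall := closed_eq_univ hconn {x | φ x = x ∧ ∃ y, G.Adj x y ∧ φ y = y} v1
    ⟨e1, v2, a12, e2⟩ (by
      rintro x y ⟨hx, z, hz, hzz⟩ hxy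
      refine ⟨?_, x, hxy.symm, hx⟩
      by_cases e : y = z
      · rw [e, hzz]
      · have a : G.Adj x (φ y) := by
          have := φ.map_adj_iff.mpr hxy
          rwa [hx] at this
        have h1 := h.o_eq (x := x) id hz hxy e
        have h2 := h.o_eq (x := x) id hz a (fun e' => e (inj (e'.trans hzz.symm)))
        exact h2.symm.trans h1)
  exact fun v => (hall v).1

end Cycle

/-- In a 2-minimally graph each edge has an end of degree 2. -/
lemma twoMin_edge {V : Type*} [Fintype V] (G : SimpleGraph V) [DecidableRel G.Adj]
    (hmin : IsTwoMinimally G) {a b : V} (hab : G.Adj a b) :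
    G.degree a = 2 ∨ G.degree b = 2 := by
  classical
  have hdeg : ∀ v, (G.neighborSet v).ncard = G.degree v := fun v => by
    rw [← G.card_neighborSet_eq_degree, Set.ncard_eq_toFinset_card', Set.toFinset_card]
  obtain ⟨v, hv⟩ := hmin.2 (G.deleteEdges {s(a, b)}) (by
    refine lt_of_le_of_ne (SimpleGraph.deleteEdges_le _) (fun e => ?_)
    have := hab
    rw [← e] at this
    simp at this)
  have key : ∀ c d, s(a, b) = s(c, d) → v = c → G.degree c = 2 := by
    intro c d hcd hvc
    subst hvc
    have hsub : G.neighborSet v \ {d} ⊆ (G.deleteEdges {s(a, b)}).neighborSet v := by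
      rintro x ⟨hx, hxd⟩
      simp only [SimpleGraph.mem_neighborSet, SimpleGraph.deleteEdges_adj] at hx ⊢
      refine ⟨hx, ?_⟩
      rw [hcd]
      simp only [Set.mem_singleton_iff, Sym2.eq_iff] at hxd ⊢
      rintro (⟨-, h2⟩ | ⟨h1, h2⟩)
      · exact hxd h2
      · exact hx.ne h2.symm
    have h1 := Set.ncard_le_ncard hsub (Set.toFinite _)
    have h2 := Set.ncard_le_ncard_diff_add_ncard (G.neighborSet v) {d} (Set.toFinite _)
    rw [Set.ncard_singleton] at h2
    have h3 := hmin.1 v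
    rw [hdeg] at h2 h3
    omega
  by_cases hva : v = a
  · exact Or.inl (key a b rfl hva)
  · by_cases hvb : v = b
    · exact Or.inr (key b a Sym2.eq_swap hvb)
    · exfalso
      have : (G.deleteEdges {s(a, b)}).neighborSet v = G.neighborSet v := by
        ext x
        simp only [SimpleGraph.mem_neighborSet, SimpleGraph.deleteEdges_adj, Set.mem_singleton_iff,
          Sym2.eq_iff]
        grind
      rw [this] at hv
      have := hmin.1 v
      omega

/-- The other neighbour. -/
lemma exists_other {V : Type*} [Fintype V] (G : SimpleGraph V) [DecidableRel G.Adj] {x u : V}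
    (hx : G.degree x = 2) (hxu : G.Adj x u) :
    ∃ y, G.Adj x y ∧ y ≠ u ∧ ∀ z, G.Adj x z → z = u ∨ z = y := by
  classical
  rw [← G.card_neighborFinset_eq_degree, Finset.card_eq_two] at hx
  obtain ⟨a, b, hab, hs⟩ := hx
  have mem : ∀ z, G.Adj x z ↔ z = a ∨ z = b := fun z => by
    rw [← G.mem_neighborFinset, hs]; simp
  rcases (mem u).mp hxu with rfl | rfl
  · exact ⟨b, (mem b).mpr (Or.inr rfl), hab.symm, fun z hz => (mem z).mp hz⟩
  · exact ⟨a, (mem a).mpr (Or.inl rfl), hab, fun z hz => ((mem z).mp hz).symm⟩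

theorem distinguishingIndex_twoMinimally {V : Type*} [Fintype V]
    (G : SimpleGraph V) [DecidableRel G.Adj] (hconn : G.Connected)
    (hmin : IsTwoMinimally G)
    (hcyc : ¬∃ m : ℕ, 3 ≤ m ∧ m ≤ 5 ∧ Nonempty (G ≃g cycleGraph m))
    (hbip : ¬∃ r : ℕ, 0 < r ∧ Nonempty (G ≃g completeBipartiteGraph (Fin 2) (Fin (r ^ 2)))) :
    distinguishingIndex G ≤ ⌈Real.sqrt (G.maxDegree)⌉₊ := by
  classical
  have hncard : ∀ v, (G.neighborSet v).ncard = G.degree v := fun v => by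
    rw [← G.card_neighborSet_eq_degree, Set.ncard_eq_toFinset_card', Set.toFinset_card]
  have hdeg2 : ∀ v, 2 ≤ G.degree v := fun v => (hncard v) ▸ hmin.1 v
  obtain ⟨v0⟩ := hconn.nonempty
  -- the number of colours
  have hk : ∃ n, ⌈Real.sqrt (G.maxDegree)⌉₊ = n + 2 ∧ G.maxDegree ≤ (n + 2) ^ 2 := by
    have h2 : 2 ≤ G.maxDegree := (hdeg2 v0).trans (G.degree_le_maxDegree v0)
    set k := ⌈Real.sqrt (G.maxDegree)⌉₊ with hkdef
    have h3 : Real.sqrt (G.maxDegree) ≤ k := Nat.le_ceil _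
    have h4 : (G.maxDegree : ℝ) ≤ (k : ℝ) ^ 2 := (Real.sqrt_le_left (by positivity)).mp h3
    have h5 : G.maxDegree ≤ k ^ 2 := by exact_mod_cast h4
    have h6 : 2 ≤ k := by
      by_contra hcon
      have : k ≤ 1 := by omega
      have := Nat.pow_le_pow_left this 2
      omega
    exact ⟨k - 2, by omega, by rw [show k - 2 + 2 = k by omega]; exact h5⟩
  obtain ⟨n, hkn, hmax⟩ := hk
  rw [hkn]
  have hdeg : ∀ v, G.degree v ≤ (n + 2) ^ 2 := fun v => (G.degree_le_maxDegree v).trans hmax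
  suffices hs : ∃ f : Sym2 V → Fin (n + 2), ∀ φ : G ≃g G,
      (∀ a b, G.Adj a b → f s(φ a, φ b) = f s(a, b)) → ∀ v, φ v = v by
    obtain ⟨f, hf⟩ := hs
    refine Nat.sInf_le ⟨f, fun φ hφ => hf φ (fun a b hab => ?_)⟩
    have := hφ s(a, b) ((G.mem_edgeSet).mpr hab)
    simpa using this
  -- the structure
  let B : V → Prop := fun v => 3 ≤ G.degree v
  have hsm : ∀ x, ¬ B x → G.degree x = 2 := fun x hx => by
    have := hdeg2 x
    simp only [B] at hx
    omega
  have hex : ∀ x u, ∃ y, ¬ B x → G.Adj x u →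
      (G.Adj x y ∧ y ≠ u ∧ ∀ z, G.Adj x z → z = u ∨ z = y) := by
    intro x u
    by_cases hh : ¬ B x ∧ G.Adj x u
    · obtain ⟨y, hy⟩ := exists_other G (hsm x hh.1) hh.2
      exact ⟨y, fun _ _ => hy⟩
    · exact ⟨x, fun h1 h2 => absurd ⟨h1, h2⟩ hh⟩
  choose o ho using hex
  have h : BigCtx G B o :=
    ⟨fun u x hux hu hx => by
      have := twoMin_edge G hmin hux
      simp only [B] at hu hx
      omega,
    fun x u hx ha => (ho x u hx ha).1, fun x u hx ha => (ho x u hx ha).2.1,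
    fun x u z hx ha => (ho x u hx ha).2.2 z⟩
  have hB : ∀ (φ : G ≃g G) v, B (φ v) ↔ B v := fun φ v => by
    simp only [B, φ.degree_eq]
  by_cases hbig : ∃ r0, B r0
  · obtain ⟨r0, hr0⟩ := hbig
    by_cases hns : ∀ a b, G.Adj a b → ¬ B a → B b
    · exact case_two h hconn hB hdeg (fun u hu => hu) hns
        (fun hh => hbip ⟨n + 2, by omega, hh⟩) r0 hr0
    · push Not at hns
      obtain ⟨a, b, hab, ha, hb⟩ := hns
      have : ∃ r x, B r ∧ G.Adj r x ∧ ¬ B (o x r) := by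
        by_contra hcon
        push Not at hcon
        have hall := closed_eq_univ hconn {x | ¬ B x ∧ ∃ y, G.Adj x y ∧ ¬ B y} a ⟨ha, b, hab, hb⟩ (by
          rintro x y ⟨hx, z, hxz, hz⟩ hxy
          refine ⟨fun hy => ?_, x, hxy.symm, hx⟩
          have h1 := hcon y x hy hxy.symm
          rw [h.o_eq hx hxy hxz (fun e => hz (e ▸ hy))] at h1
          exact hz h1)
        exact (hall r0).1 hr0
      obtain ⟨r, x, hr, hrx, hox⟩ := this
      exact case_one h hconn hB hdeg r x hr hrx hox
  · have hBF : B = fun _ => False := by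
      funext v
      exact eq_false (fun hv => hbig ⟨v, hv⟩)
    rw [hBF] at h
    obtain ⟨f, hf⟩ := case_cycle h hconn
      (by
        obtain ⟨w, hw⟩ := (G.degree_pos_iff_exists_adj v0).mp (by have := hdeg2 v0; omega)
        exact ⟨v0, w, hw⟩) hcyc
    refine ⟨fun e => Fin.castLE (by omega) (f e), fun φ hφ => hf φ (fun a b hab => ?_)⟩
    exact Fin.castLE_injective _ (hφ a b hab)
end
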